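/- For any γ ∈ [3/4, 1) and any functions f, h : [1,∞) → (0,∞) satisfying f(1) = h(1) = 1, the log-Lipschitz conditions a^{3/4} f(n) ≤ f(an) ≤ a^γ f(n) and a^{3/4} h(n) ≤ h(an) ≤ a^γ h(n) for all real a, n ≥ 1, and the relation h(n) ≼ f(n) ≼ √(n·h(n)/log(n+1)), there exist a finitely generated group Γ with a finite symmetric generating set and a symmetric, finitely supported random walk X_n on Γ (whose step distribution has support generating Γ) such that E|X_n| ≍ f(n) and H(X_n) ≍ h(n), where the implied constants in ≍ depend only on γ and on the constants in the assumed relation between f and h. -/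

import Mathlib

open scoped BigOperators Classical

/-- Convolution of two measures (given as weight functions) on a group. -/
noncomputable def conv {G : Type*} [Group G] (μ ν : G → ℝ) : G → ℝ :=
  fun g => ∑' h, μ h * ν (h⁻¹ * g)

/-- The `n`-fold convolution power of `μ`; `convPow μ n` is the distribution of `X_n`. -/
noncomputable def convPow {G : Type*} [Group G] (μ : G → ℝ) : ℕ → G → ℝ
  | 0 => fun g => if g = 1 then 1 else 0
  | n + 1 => conv (convPow μ n) μ

/-- Shannon entropy of a measure on a countable group:
`H(μ) = -∑ μ(g) log μ(g)` (with `0 log 0 = 0`). -/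
noncomputable def entropy {G : Type*} (μ : G → ℝ) : ℝ :=
  ∑' g, Real.negMulLog (μ g)

/-- Word length with respect to a generating set `S`. -/
noncomputable def wordLength {G : Type*} [Group G] (S : Set G) (g : G) : ℕ :=
  sInf {n | ∃ l : List G, l.length = n ∧ (∀ x ∈ l, x ∈ S) ∧ l.prod = g}

/-- Rate of escape: `E|X_n| = ∑ μ^{*n}(g) |g|`. -/
noncomputable def speed {G : Type*} [Group G] (S : Set G) (μ : G → ℝ) (n : ℕ) : ℝ :=
  ∑' g, convPow μ n g * (wordLength S g : ℝ)

/-- `μ` is a symmetric, finitely supported probability measure whose support generates `G`. -/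
structure IsStepDist {G : Type*} [Group G] (μ : G → ℝ) : Prop where
  nonneg : ∀ g, 0 ≤ μ g
  total : ∑' g, μ g = 1
  symm : ∀ g, μ g⁻¹ = μ g
  finSupp : (Function.support μ).Finite
  gen : Subgroup.closure (Function.support μ) = ⊤

/-- `S` is a finite symmetric generating set of `G`. -/
structure IsGenSet {G : Type*} [Group G] (S : Set G) : Prop where
  finite : S.Finite
  symm : ∀ s ∈ S, s⁻¹ ∈ S
  gen : Subgroup.closure S = ⊤


namespace SE

set_option linter.unusedSectionVars false
set_option linter.unusedVariables false
set_option linter.unusedSimpArgs false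

/-- Expectation over `n` i.i.d. letters. -/
noncomputable def Ex {Ω : Type} [Fintype Ω] (p : Ω → ℝ) : ℕ → (List Ω → ℝ) → ℝ
  | 0, F => F []
  | n + 1, F => ∑ ω, p ω * Ex p n (fun l => F (ω :: l))

section ExBasic
variable {Ω : Type} [Fintype Ω] {p : Ω → ℝ}

theorem Ex_zero (F : List Ω → ℝ) : Ex p 0 F = F [] := rfl
theorem Ex_succ (n : ℕ) (F : List Ω → ℝ) :
    Ex p (n + 1) F = ∑ ω, p ω * Ex p n (fun l => F (ω :: l)) := rfl

theorem Ex_congr {n : ℕ} : ∀ {F G : List Ω → ℝ}, (∀ l, l.length = n → F l = G l) →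
    Ex p n F = Ex p n G := by
  induction n with
  | zero => intro F G h; exact h [] rfl
  | succ n ih =>
    intro F G h
    rw [Ex_succ, Ex_succ]
    refine Finset.sum_congr rfl fun ω _ => ?_
    rw [ih fun l hl => h (ω :: l) (by simp [hl])]

theorem Ex_add {n : ℕ} : ∀ (F G : List Ω → ℝ),
    Ex p n (fun l => F l + G l) = Ex p n F + Ex p n G := by
  induction n with
  | zero => intro F G; rfl
  | succ n ih =>
    intro F G
    simp only [Ex_succ, ih, mul_add, Finset.sum_add_distrib]

theorem Ex_mul_left {n : ℕ} (c : ℝ) : ∀ (F : List Ω → ℝ),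
    Ex p n (fun l => c * F l) = c * Ex p n F := by
  induction n with
  | zero => intro F; rfl
  | succ n ih =>
    intro F
    simp only [Ex_succ, ih, Finset.mul_sum]
    exact Finset.sum_congr rfl fun ω _ => by ring

theorem Ex_mul_right {n : ℕ} (c : ℝ) (F : List Ω → ℝ) :
    Ex p n (fun l => F l * c) = Ex p n F * c := by
  simp only [mul_comm _ c, Ex_mul_left]

theorem Ex_neg {n : ℕ} (F : List Ω → ℝ) :
    Ex p n (fun l => - F l) = - Ex p n F := by
  have := Ex_mul_left (p := p) (n := n) (-1) F
  simpa using this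

theorem Ex_sub {n : ℕ} (F G : List Ω → ℝ) :
    Ex p n (fun l => F l - G l) = Ex p n F - Ex p n G := by
  simp only [sub_eq_add_neg, Ex_add, Ex_neg]

theorem Ex_zero_fun {n : ℕ} : Ex p n (fun _ => 0) = 0 := by
  have := Ex_mul_left (p := p) (n := n) 0 (fun _ => 0)
  simpa using this

theorem Ex_sum {n : ℕ} {κ : Type*} (s : Finset κ) (F : κ → List Ω → ℝ) :
    Ex p n (fun l => ∑ i ∈ s, F i l) = ∑ i ∈ s, Ex p n (F i) := by
  induction s using Finset.induction_on with
  | empty => simp [Ex_zero_fun]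
  | insert a s ha ih => simp only [Finset.sum_insert ha, Ex_add, ih]

theorem Ex_const (hs : ∑ ω, p ω = 1) {n : ℕ} (c : ℝ) : Ex p n (fun _ => c) = c := by
  induction n with
  | zero => rfl
  | succ n ih => simp only [Ex_succ, ih, ← Finset.sum_mul, hs, one_mul]

theorem Ex_mono (hp : ∀ ω, 0 ≤ p ω) {n : ℕ} : ∀ {F G : List Ω → ℝ},
    (∀ l, l.length = n → F l ≤ G l) → Ex p n F ≤ Ex p n G := by
  induction n with
  | zero => intro F G h; exact h [] rfl
  | succ n ih =>
    intro F G h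
    rw [Ex_succ, Ex_succ]
    refine Finset.sum_le_sum fun ω _ => mul_le_mul_of_nonneg_left ?_ (hp ω)
    exact ih fun l hl => h (ω :: l) (by simp [hl])

theorem Ex_nonneg (hp : ∀ ω, 0 ≤ p ω) {n : ℕ} {F : List Ω → ℝ}
    (h : ∀ l, l.length = n → 0 ≤ F l) : 0 ≤ Ex p n F := by
  have := Ex_mono (F := fun _ => 0) hp h
  rwa [Ex_zero_fun] at this

theorem Ex_snoc {n : ℕ} : ∀ (F : List Ω → ℝ),
    Ex p (n + 1) F = Ex p n (fun l => ∑ ω, p ω * F (l ++ [ω])) := by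
  induction n with
  | zero => intro F; rfl
  | succ n ih =>
    intro F
    rw [Ex_succ, Ex_succ]
    refine Finset.sum_congr rfl fun ω _ => ?_
    rw [ih]; rfl

theorem Ex_sq_le (hp : ∀ ω, 0 ≤ p ω) (hs : ∑ ω, p ω = 1) {n : ℕ} (F : List Ω → ℝ) :
    (Ex p n F) ^ 2 ≤ Ex p n (fun l => F l ^ 2) := by
  have h := Ex_nonneg (n := n) (F := fun l => (F l - Ex p n F) ^ 2) hp fun l _ => sq_nonneg _
  have e : Ex p n (fun l => (F l - Ex p n F) ^ 2)
      = Ex p n (fun l => F l ^ 2) - (Ex p n F) ^ 2 := by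
    have : (fun l => (F l - Ex p n F) ^ 2)
        = fun l => (F l ^ 2 + (-2 * Ex p n F) * F l) + (Ex p n F) ^ 2 := by
      funext l; ring
    rw [this, Ex_add, Ex_add, Ex_mul_left, Ex_const hs]; ring
  linarith

theorem Ex_concave (hp : ∀ ω, 0 ≤ p ω) (hs : ∑ ω, p ω = 1) {φ : ℝ → ℝ}
    (hφ : ConcaveOn ℝ (Set.Ici 0) φ) {n : ℕ} : ∀ {F : List Ω → ℝ},
    (∀ l, 0 ≤ F l) → Ex p n (fun l => φ (F l)) ≤ φ (Ex p n F) := by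
  induction n with
  | zero => intro F _; exact le_rfl
  | succ n ih =>
    intro F hF
    rw [Ex_succ, Ex_succ]
    calc ∑ ω, p ω * Ex p n (fun l => φ (F (ω :: l)))
        ≤ ∑ ω, p ω * φ (Ex p n (fun l => F (ω :: l))) :=
          Finset.sum_le_sum fun ω _ => mul_le_mul_of_nonneg_left (ih fun l => hF _) (hp ω)
      _ ≤ φ (∑ ω, p ω * Ex p n (fun l => F (ω :: l))) := by
          have := hφ.le_map_sum (t := Finset.univ) (w := p)
            (p := fun ω => Ex p n (fun l => F (ω :: l))) (fun ω _ => hp ω) hs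
            (fun ω _ => Ex_nonneg hp fun l _ => hF _)
          simpa [smul_eq_mul] using this

theorem Ex_hasSum {H : Type} {n : ℕ} : ∀ (Y : List Ω → H) (F : H → ℝ),
    HasSum (fun h => Ex p n (fun l => if Y l = h then 1 else 0) * F h)
      (Ex p n (fun l => F (Y l))) := by
  induction n with
  | zero =>
    intro Y F
    simp only [Ex_zero]
    have := hasSum_single (f := fun h => (if Y [] = h then (1:ℝ) else 0) * F h) (Y [])
      (fun b hb => by simp [Ne.symm hb])
    simpa using this
  | succ n ih =>
    intro Y F
    simp only [Ex_succ, Finset.sum_mul, mul_assoc]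
    exact hasSum_sum fun ω _ => (ih (fun l => Y (ω :: l)) F).mul_left (p ω)

theorem Ex_marg_mul {Ω' : Type} [Fintype Ω'] {p' : Ω' → ℝ} {n : ℕ} :
    ∀ (F : List Ω → ℝ) (G : List Ω' → ℝ),
    Ex (fun ω : Ω × Ω' => p ω.1 * p' ω.2) n (fun l => F (l.map Prod.fst) * G (l.map Prod.snd))
      = Ex p n F * Ex p' n G := by
  induction n with
  | zero => intro F G; rfl
  | succ n ih =>
    intro F G
    simp only [Ex_succ, List.map_cons]
    rw [Finset.sum_mul_sum, ← Finset.sum_product']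
    refine Finset.sum_congr rfl fun ω _ => ?_
    rw [ih (fun l => F (ω.1 :: l)) (fun l => G (ω.2 :: l))]
    ring

theorem Ex_marg_fst {Ω' : Type} [Fintype Ω'] {p' : Ω' → ℝ} (hs : ∑ ω, p' ω = 1) {n : ℕ}
    (F : List Ω → ℝ) :
    Ex (fun ω : Ω × Ω' => p ω.1 * p' ω.2) n (fun l => F (l.map Prod.fst)) = Ex p n F := by
  have := Ex_marg_mul (p := p) (p' := p') (n := n) F (fun _ => 1)
  simpa [Ex_const hs] using this

theorem Ex_marg_snd {Ω' : Type} [Fintype Ω'] {p' : Ω' → ℝ} (hs : ∑ ω, p ω = 1) {n : ℕ}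
    (F : List Ω' → ℝ) :
    Ex (fun ω : Ω × Ω' => p ω.1 * p' ω.2) n (fun l => F (l.map Prod.snd)) = Ex p' n F := by
  have := Ex_marg_mul (p := p) (p' := p') (n := n) (fun _ => 1) F
  simpa [Ex_const hs] using this

theorem Ex_finset {H : Type} {n : ℕ} (Y : List Ω → H) (T : Finset H)
    (hT : ∀ l, l.length = n → Y l ∈ T) (F : H → ℝ) :
    Ex p n (fun l => F (Y l))
      = ∑ h ∈ T, Ex p n (fun l => if Y l = h then 1 else 0) * F h := by
  simp only [← Ex_mul_right]
  rw [← Ex_sum]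
  refine Ex_congr fun l hl => ?_
  rw [Finset.sum_eq_single (Y l)]
  · simp
  · intro b _ hb; simp [Ne.symm hb]
  · intro h; exact absurd (hT l hl) h

theorem exists_range (n : ℕ) {H : Type} (Y : List Ω → H) :
    ∃ T : Finset H, ∀ l : List Ω, l.length = n → Y l ∈ T := by
  have := (List.finite_length_eq Ω n).image Y
  exact ⟨this.toFinset, fun l hl => by
    rw [Set.Finite.mem_toFinset]; exact ⟨l, hl, rfl⟩⟩

theorem Ex_indicator_pos (hp : ∀ ω, 0 < p ω) {n : ℕ} : ∀ (F : List Ω → ℝ) (_ : ∀ l, 0 ≤ F l)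
    (l : List Ω), l.length = n → 0 < F l → 0 < Ex p n F := by
  induction n with
  | zero => intro F _ l hl h; obtain rfl := List.length_eq_zero_iff.mp hl; exact h
  | succ n ih =>
    intro F hF l hl h
    match l, hl with
    | ω :: l, hl =>
      rw [Ex_succ]
      refine Finset.sum_pos' (fun i _ => mul_nonneg (hp i).le
        (Ex_nonneg (fun j => (hp j).le) fun _ _ => hF _)) ⟨ω, Finset.mem_univ _, ?_⟩
      exact mul_pos (hp ω) (ih _ (fun _ => hF _) l (by simpa using hl) h)

end ExBasic

section Walk
variable {Ω : Type} [Fintype Ω] (p : Ω → ℝ) {H : Type} [Group H] (val : Ω → H)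

/-- Position of the walk. -/
def Xw (l : List Ω) : H := (l.map val).prod

/-- Law of the walk at time `n`. -/
noncomputable def Pr (n : ℕ) (g : H) : ℝ := Ex p n (fun l => if Xw val l = g then 1 else 0)

noncomputable def stepμ (g : H) : ℝ := ∑ ω, p ω * (if val ω = g then 1 else 0)

/-- Entropy of the walk. -/
noncomputable def Ent (n : ℕ) : ℝ := Ex p n (fun l => - Real.log (Pr p val n (Xw val l)))

theorem convPow_eq (n : ℕ) (g : H) : convPow (stepμ p val) n g = Pr p val n g := by
  induction n generalizing g with
  | zero => simp [convPow, Pr, Ex_zero, Xw, eq_comm]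
  | succ n ih =>
    simp only [convPow, conv, ih]
    unfold Pr
    rw [(Ex_hasSum (p := p) (n := n) (Xw val) (fun h => stepμ p val (h⁻¹ * g))).tsum_eq, Ex_snoc]
    refine Ex_congr fun l _ => ?_
    unfold stepμ
    refine Finset.sum_congr rfl fun ω _ => ?_
    simp only [Xw, List.map_append, List.prod_append, List.map_cons, List.map_nil, List.prod_cons,
      List.prod_nil, mul_one, eq_inv_mul_iff_mul_eq]

theorem entropy_eq (n : ℕ) : entropy (convPow (stepμ p val) n) = Ent p val n := by
  unfold entropy Ent
  rw [← (Ex_hasSum (p := p) (n := n) (Xw val) (fun h => - Real.log (Pr p val n h))).tsum_eq]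
  refine tsum_congr fun g => ?_
  rw [convPow_eq, Real.negMulLog]
  change _ = Pr p val n g * _
  ring

theorem speed_eq (S : Set H) (n : ℕ) : speed S (stepμ p val) n
    = Ex p n (fun l => (wordLength S (Xw val l) : ℝ)) := by
  unfold speed
  rw [← (Ex_hasSum (p := p) (n := n) (Xw val) (fun h => (wordLength S h : ℝ))).tsum_eq]
  refine tsum_congr fun g => ?_
  rw [convPow_eq]; rfl

theorem assemble (hp : ∀ ω, 0 < p ω) (hs : ∑ ω, p ω = 1) (inv : Ω → Ω)
    (hinv : Function.Involutive inv) (hpi : ∀ ω, p (inv ω) = p ω)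
    (hvi : ∀ ω, val (inv ω) = (val ω)⁻¹) :
    ∃ (Γ : Type) (_ : Group Γ) (S : Set Γ) (μ : Γ → ℝ), IsGenSet S ∧ IsStepDist μ ∧
      ∀ n : ℕ, speed S μ n = Ex p n (fun l => (wordLength (Set.range val) (Xw val l) : ℝ)) ∧
        entropy (convPow μ n) = Ent p val n := by
  let K := Subgroup.closure (Set.range val)
  let val' : Ω → K := fun ω => ⟨val ω, Subgroup.subset_closure ⟨ω, rfl⟩⟩
  have hgen : Subgroup.closure (Set.range val') = ⊤ := by
    have : Set.range val' = ((↑) : K → H) ⁻¹' (Set.range val) := by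
      ext x; constructor
      · rintro ⟨ω, rfl⟩; exact ⟨ω, rfl⟩
      · rintro ⟨ω, h⟩; exact ⟨ω, Subtype.ext h⟩
    rw [this]; exact Subgroup.closure_closure_coe_preimage
  have hvi' : ∀ ω, val' (inv ω) = (val' ω)⁻¹ := fun ω => Subtype.ext (hvi ω)
  have hXc : ∀ l : List Ω, ((Xw val' l : K) : H) = Xw val l := by
    intro l
    induction l with
    | nil => rfl
    | cons a l ih => simp only [Xw, List.map_cons, List.prod_cons] at ih ⊢; rw [Subgroup.coe_mul, ih]
  have hsupp : Function.support (stepμ p val') = Set.range val' := by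
    ext g
    simp only [Function.mem_support, Set.mem_range]
    constructor
    · intro h
      obtain ⟨ω, -, h⟩ := Finset.exists_ne_zero_of_sum_ne_zero h
      by_contra hc
      exact h (by rw [if_neg fun h' => hc ⟨ω, h'⟩, mul_zero])
    · rintro ⟨ω, rfl⟩
      refine ne_of_gt ?_
      refine Finset.sum_pos' (fun i _ => mul_nonneg (hp i).le (by split_ifs <;> norm_num))
        ⟨ω, Finset.mem_univ _, by simpa using hp ω⟩
  refine ⟨K, inferInstance, Set.range val', stepμ p val', ⟨Set.finite_range _, ?_, hgen⟩,
    ⟨?_, ?_, ?_, ?_, ?_⟩, ?_⟩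
  · rintro _ ⟨ω, rfl⟩; exact ⟨inv ω, hvi' ω⟩
  · intro g; exact Finset.sum_nonneg fun i _ => mul_nonneg (hp i).le (by split_ifs <;> norm_num)
  · have := (Ex_hasSum (p := p) (n := 1) (Xw val') (fun _ => 1)).tsum_eq
    rw [Ex_const hs] at this
    rw [← this]
    refine tsum_congr fun g => ?_
    simp [stepμ, Ex_succ, Ex_zero, Xw]
  · intro g
    unfold stepμ
    rw [← Equiv.sum_comp (hinv.toPerm inv)]
    refine Finset.sum_congr rfl fun ω _ => ?_
    simp only [Function.Involutive.coe_toPerm, hpi, hvi', inv_inj]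
    congr
  · rw [hsupp]; exact Set.finite_range _
  · rw [hsupp]; exact hgen
  · intro n
    constructor
    · rw [speed_eq]
      refine Ex_congr fun l _ => ?_
      congr 1
      unfold wordLength
      congr 1
      ext N
      constructor
      · rintro ⟨L, hL, hm, hpr⟩
        refine ⟨L.map K.subtype, by simpa using hL, ?_, ?_⟩
        · intro x hx
          obtain ⟨y, hy, rfl⟩ := List.mem_map.mp hx
          obtain ⟨ω, rfl⟩ := hm y hy
          exact ⟨ω, rfl⟩
        · rw [← hXc, ← hpr]; exact (map_list_prod K.subtype L).symm
      · rintro ⟨L, hL, hm, hpr⟩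
        refine ⟨L.pmap (fun x hx => (⟨x, Subgroup.subset_closure hx⟩ : K)) hm, by simpa using hL,
          ?_, ?_⟩
        · intro x hx
          obtain ⟨y, hy, rfl⟩ := List.mem_pmap.mp hx
          obtain ⟨ω, rfl⟩ := hm y hy
          exact ⟨ω, rfl⟩
        · apply Subtype.ext
          rw [hXc, ← hpr]
          refine (map_list_prod K.subtype _).trans ?_
          rw [List.map_pmap]; simp
    · rw [entropy_eq]
      unfold Ent Pr
      refine Ex_congr fun l _ => ?_
      congr 3
      funext l'
      congr 1
      rw [← hXc, ← hXc]; exact propext (Subtype.ext_iff)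

end Walk

section WL
variable {H : Type} [Group H]

/-- `g` is a product of at most `N` elements of `S`. -/
def Reach (S : Set H) (g : H) (N : ℕ) : Prop :=
  ∃ l : List H, l.length ≤ N ∧ (∀ x ∈ l, x ∈ S) ∧ l.prod = g

theorem Reach.wordLength_le {S : Set H} {g : H} {N : ℕ} (h : Reach S g N) :
    wordLength S g ≤ N := by
  obtain ⟨l, hl, hm, hp⟩ := h
  refine le_trans (Nat.sInf_le ?_) hl
  exact ⟨l, rfl, hm, hp⟩

theorem Reach.one {S : Set H} : Reach S (1 : H) 0 := ⟨[], le_rfl, by simp, rfl⟩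
theorem Reach.mul {S : Set H} {g h : H} {M N : ℕ} (hg : Reach S g M) (hh : Reach S h N) :
    Reach S (g * h) (M + N) := by
  obtain ⟨l, hl, hm, rfl⟩ := hg
  obtain ⟨l', hl', hm', rfl⟩ := hh
  refine ⟨l ++ l', by simp; omega, ?_, by simp⟩
  intro x hx
  rcases List.mem_append.mp hx with h | h
  exacts [hm x h, hm' x h]
theorem Reach.mono {S : Set H} {g : H} {M N : ℕ} (hg : Reach S g M) (h : M ≤ N) :
    Reach S g N := by
  obtain ⟨l, hl, hm, rfl⟩ := hg
  exact ⟨l, hl.trans h, hm, rfl⟩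
theorem Reach.of_mem {S : Set H} {g : H} (h : g ∈ S) : Reach S g 1 :=
  ⟨[g], by simp, by simpa using h, by simp⟩

theorem wordLength_lower {S : Set H} (hS : ∀ s ∈ S, s⁻¹ ∈ S) (Φ : H → ℝ) (h1 : Φ 1 ≤ 0)
    (hΦ : ∀ g, ∀ s ∈ S, Φ (g * s) ≤ Φ g + 1) {g : H} (hg : g ∈ Subgroup.closure S) :
    Φ g ≤ wordLength S g := by
  have hne : {n | ∃ l : List H, l.length = n ∧ (∀ x ∈ l, x ∈ S) ∧ l.prod = g}.Nonempty := by
    have hg' : g ∈ Submonoid.closure (S ∪ S⁻¹) := by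
      rw [← Subgroup.closure_toSubmonoid]; exact hg
    obtain ⟨l, hl, hp⟩ := Submonoid.exists_list_of_mem_closure hg'
    refine ⟨l.length, l, rfl, fun x hx => ?_, hp⟩
    rcases hl x hx with h | h
    · exact h
    · simpa using hS _ h
  obtain ⟨l, hl, hm, hp⟩ := Nat.sInf_mem hne
  have key : ∀ l : List H, (∀ x ∈ l, x ∈ S) → Φ l.prod ≤ l.length := by
    intro l
    induction l using List.reverseRecOn with
    | nil => intro _; simpa using h1
    | append_singleton l a ih =>
      intro h
      have := hΦ l.prod a (h a (by simp))
      have := ih (fun x hx => h x (by simp [hx]))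
      simp only [List.prod_append, List.prod_cons, List.prod_nil, mul_one, List.length_append,
        List.length_cons, List.length_nil]
      push_cast; linarith
  have := key l hm
  rw [hp] at this
  unfold wordLength
  rw [← hl]; exact this

theorem Xw_mem_closure {Ω : Type} (val : Ω → H) (l : List Ω) :
    Xw val l ∈ Subgroup.closure (Set.range val) := by
  refine Subgroup.list_prod_mem _ fun x hx => ?_
  obtain ⟨ω, _, rfl⟩ := List.mem_map.mp hx
  exact Subgroup.subset_closure ⟨ω, rfl⟩

end WL
end SE

namespace SE

set_option linter.unusedSectionVars false
set_option linter.unusedVariables false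
set_option linter.unusedSimpArgs false

section Gibbs
open scoped Pointwise
variable {Ω : Type} [Fintype Ω] (p : Ω → ℝ) {H : Type} [Group H] (val : Ω → H)

theorem list_prod_mem_pow (T : Finset H) : ∀ l : List H, (∀ x ∈ l, x ∈ T) →
    l.prod ∈ T ^ l.length := by
  intro l
  induction l with
  | nil => intro _; simp
  | cons a l ih =>
    intro h
    rw [List.prod_cons, List.length_cons, pow_succ']
    exact Finset.mul_mem_mul (h a (by simp)) (ih fun x hx => h x (by simp [hx]))

theorem Pr_nonneg (hp : ∀ ω, 0 ≤ p ω) (n : ℕ) (g : H) : 0 ≤ Pr p val n g :=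
  Ex_nonneg hp fun l _ => by split_ifs <;> norm_num

theorem Pr_pos (hp : ∀ ω, 0 < p ω) {n : ℕ} {l : List Ω} (hl : l.length = n) :
    0 < Pr p val n (Xw val l) :=
  Ex_indicator_pos hp _ (fun l' => by split_ifs <;> norm_num) l hl (by simp)

theorem sum_weights_le (T : Finset H) (M : ℝ) (hM : (T.card : ℝ) ≤ M) (hM1 : 1 ≤ M)
    (R : Finset H) (hR : ∀ g ∈ R, ∃ N, Reach (T : Set H) g N) :
    ∑ g ∈ R, (1 / 2 : ℝ) * (1 / (2 * M)) ^ (wordLength (T : Set H) g) ≤ 1 := by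
  set wl := wordLength (T : Set H) with hwl
  have hmem : ∀ g ∈ R, wl g ∈ R.image wl := fun g hg => Finset.mem_image_of_mem _ hg
  rw [← Finset.sum_fiberwise_of_maps_to hmem]
  have hk : ∀ k ∈ R.image wl, ∑ g ∈ R with wl g = k, (1 / 2 : ℝ) * (1 / (2 * M)) ^ (wl g)
      ≤ (1 / 2) * (1 / 2) ^ k := by
    intro k _
    have h1 : ∑ g ∈ R with wl g = k, (1 / 2 : ℝ) * (1 / (2 * M)) ^ (wl g)
        = ((R.filter (fun g => wl g = k)).card : ℝ) * ((1 / 2) * (1 / (2 * M)) ^ k) := by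
      rw [← nsmul_eq_mul, ← Finset.sum_const]
      refine Finset.sum_congr rfl fun g hg => ?_
      rw [(Finset.mem_filter.mp hg).2]
    have h2 : (R.filter (fun g => wl g = k)) ⊆ T ^ k := by
      intro g hg
      obtain ⟨hgR, hgk⟩ := Finset.mem_filter.mp hg
      obtain ⟨N, l0, _, hm0, hp0⟩ := hR g hgR
      have hne : {n | ∃ l : List H, l.length = n ∧ (∀ x ∈ l, x ∈ (T : Set H)) ∧ l.prod = g}.Nonempty :=
        ⟨_, l0, rfl, hm0, hp0⟩
      obtain ⟨l, hl, hm, hp⟩ := Nat.sInf_mem hne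
      have := list_prod_mem_pow T l (by simpa using hm)
      rw [hp, hl] at this
      rw [← hgk]; exact this
    have h3 : ((R.filter (fun g => wl g = k)).card : ℝ) ≤ M ^ k := by
      have := (Finset.card_le_card h2).trans Finset.card_pow_le
      calc ((R.filter (fun g => wl g = k)).card : ℝ) ≤ ((T.card ^ k : ℕ) : ℝ) := by exact_mod_cast this
        _ = (T.card : ℝ) ^ k := by push_cast; rfl
        _ ≤ M ^ k := by gcongr
    rw [h1]
    calc _ ≤ M ^ k * ((1 / 2) * (1 / (2 * M)) ^ k) := by gcongr
      _ = (1 / 2) * (M * (1 / (2 * M))) ^ k := by rw [mul_pow]; ring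
      _ = (1 / 2) * (1 / 2) ^ k := by congr 2; field_simp
  refine (Finset.sum_le_sum hk).trans ?_
  rw [← Finset.mul_sum]
  have : ∑ k ∈ R.image wl, (1 / 2 : ℝ) ^ k ≤ 2 := by
    refine le_of_le_of_eq ?_ tsum_geometric_two
    exact Summable.sum_le_tsum _ (fun _ _ => by positivity) summable_geometric_two
  linarith

theorem Ent_le (hp : ∀ ω, 0 < p ω) (hs : ∑ ω, p ω = 1) {n : ℕ} (T : Finset H) (M : ℝ)
    (hM : (T.card : ℝ) ≤ M) (hM1 : 1 ≤ M) (N : List Ω → ℕ)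
    (hN : ∀ l, l.length = n → Reach (T : Set H) (Xw val l) (N l)) :
    Ent p val n ≤ Ex p n (fun l => (N l : ℝ)) * Real.log (2 * M) + Real.log 2 := by
  set wl := wordLength (T : Set H) with hwl
  let w : H → ℝ := fun g => (1 / 2 : ℝ) * (1 / (2 * M)) ^ (wl g)
  have hw : ∀ g, 0 < w g := fun g => by positivity
  have hlw : ∀ g, - Real.log (w g) = Real.log 2 + wl g * Real.log (2 * M) := by
    intro g
    simp only [w]
    rw [Real.log_mul (by norm_num) (by positivity), Real.log_pow, Real.log_div (by norm_num)
      (by norm_num), Real.log_div (by norm_num) (by positivity)]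
    simp; ring
  obtain ⟨R0, hR0⟩ := exists_range n (Xw val)
  let R := R0.filter (fun g => ∃ l, l.length = n ∧ Xw val l = g)
  have hR : ∀ l, l.length = n → Xw val l ∈ R := fun l hl =>
    Finset.mem_filter.mpr ⟨hR0 l hl, l, hl, rfl⟩
  have h1 : Ent p val n ≤ ∑ g ∈ R, (Pr p val n g * (- Real.log (w g)) + w g - Pr p val n g * 1) := by
    unfold Ent
    rw [Ex_finset (Xw val) R hR (fun g => - Real.log (Pr p val n g))]
    refine Finset.sum_le_sum fun g hg => ?_
    change Pr p val n g * _ ≤ _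
    obtain ⟨_, l, hl, rfl⟩ := Finset.mem_filter.mp hg
    have hP := Pr_pos p val hp hl
    set P := Pr p val n (Xw val l)
    have := Real.log_le_sub_one_of_pos (div_pos (hw (Xw val l)) hP)
    rw [Real.log_div (hw _).ne' hP.ne'] at this
    have h2 := mul_le_mul_of_nonneg_left this hP.le
    have h3 : P * (w (Xw val l) / P - 1) = w (Xw val l) - P := by field_simp
    rw [h3] at h2
    linarith
  rw [Finset.sum_sub_distrib, Finset.sum_add_distrib] at h1
  have e1 := Ex_finset (p := p) (Xw val) R hR (fun g => - Real.log (w g))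
  have e2 := Ex_finset (p := p) (Xw val) R hR (fun _ => 1)
  rw [Ex_const hs] at e2
  change _ = ∑ g ∈ R, Pr p val n g * _ at e1
  change _ = ∑ g ∈ R, Pr p val n g * _ at e2
  rw [← e1, ← e2] at h1
  have h4 : ∑ g ∈ R, w g ≤ 1 := sum_weights_le T M hM hM1 R fun g hg => by
    obtain ⟨_, l, hl, rfl⟩ := Finset.mem_filter.mp hg
    exact ⟨_, hN l hl⟩
  have h5 : Ex p n (fun l => - Real.log (w (Xw val l)))
      ≤ Ex p n (fun l => Real.log 2 + N l * Real.log (2 * M)) := by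
    refine Ex_mono (fun ω => (hp ω).le) fun l hl => ?_
    rw [hlw]
    have h6 : wl (Xw val l) ≤ N l := (hN l hl).wordLength_le
    have h7 : 0 ≤ Real.log (2 * M) := Real.log_nonneg (by linarith)
    gcongr
  rw [Ex_add, Ex_const hs, Ex_mul_right] at h5
  linarith

end Gibbs

section Prod
variable {Ω Ω' : Type} [Fintype Ω] [Fintype Ω'] (p : Ω → ℝ) (p' : Ω' → ℝ)
  {H H' : Type} [Group H] [Group H'] (val : Ω → H) (val' : Ω' → H')

theorem Xw_prod (l : List (Ω × Ω')) :
    Xw (fun ω : Ω × Ω' => ((val ω.1, val' ω.2) : H × H')) l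
      = (Xw val (l.map Prod.fst), Xw val' (l.map Prod.snd)) := by
  induction l with
  | nil => rfl
  | cons a l ih =>
    simp only [Xw, List.map_cons, List.prod_cons] at ih ⊢
    rw [ih]; rfl

theorem Pr_prod (n : ℕ) (g : H) (g' : H') :
    Pr (fun ω : Ω × Ω' => p ω.1 * p' ω.2) (fun ω : Ω × Ω' => ((val ω.1, val' ω.2) : H × H')) n
      (g, g') = Pr p val n g * Pr p' val' n g' := by
  unfold Pr
  rw [← Ex_marg_mul]
  refine Ex_congr fun l _ => ?_
  rw [Xw_prod]
  by_cases h1 : Xw val (l.map Prod.fst) = g <;> by_cases h2 : Xw val' (l.map Prod.snd) = g' <;>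
    simp [h1, h2, Prod.ext_iff]

theorem Ent_prod (hp : ∀ ω, 0 < p ω) (hp' : ∀ ω, 0 < p' ω) (hs : ∑ ω, p ω = 1)
    (hs' : ∑ ω, p' ω = 1) (n : ℕ) :
    Ent (fun ω : Ω × Ω' => p ω.1 * p' ω.2) (fun ω : Ω × Ω' => ((val ω.1, val' ω.2) : H × H')) n
      = Ent p val n + Ent p' val' n := by
  unfold Ent
  rw [← Ex_marg_fst (p := p) hs' (fun l => - Real.log (Pr p val n (Xw val l))),
    ← Ex_marg_snd (p' := p') hs (fun l => - Real.log (Pr p' val' n (Xw val' l))), ← Ex_add]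
  refine Ex_congr fun l hl => ?_
  rw [Xw_prod, Pr_prod, Real.log_mul (Pr_pos p val hp (by simpa using hl)).ne'
    (Pr_pos p' val' hp' (by simpa using hl)).ne']
  ring

end Prod
end SE

namespace SE

set_option linter.unusedSectionVars false
set_option linter.unusedVariables false
set_option linter.unusedSimpArgs false

abbrev AA := Fin 4 → Multiplicative (ZMod 2)

/-- Elements of the wreath product of `Q` by `Γ`. -/
@[ext] structure Lamp (Γ Q : Type) where
  q : Γ → Q
  g : Γ

section LampGroup
variable {Γ Q : Type} [Group Γ] [CommRing Q]

instance : Mul (Lamp Γ Q) := ⟨fun x y => ⟨fun h => x.q h + y.q (x.g⁻¹ * h), x.g * y.g⟩⟩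
instance : One (Lamp Γ Q) := ⟨⟨fun _ => 0, 1⟩⟩
instance : Inv (Lamp Γ Q) := ⟨fun x => ⟨fun h => - x.q (x.g * h), x.g⁻¹⟩⟩

@[simp] theorem Lamp.mul_q (x y : Lamp Γ Q) (h : Γ) : (x * y).q h = x.q h + y.q (x.g⁻¹ * h) := rfl
@[simp] theorem Lamp.mul_g (x y : Lamp Γ Q) : (x * y).g = x.g * y.g := rfl
@[simp] theorem Lamp.one_q (h : Γ) : (1 : Lamp Γ Q).q h = 0 := rfl
@[simp] theorem Lamp.one_g : (1 : Lamp Γ Q).g = 1 := rfl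
@[simp] theorem Lamp.inv_q (x : Lamp Γ Q) (h : Γ) : (x⁻¹).q h = - x.q (x.g * h) := rfl
@[simp] theorem Lamp.inv_g (x : Lamp Γ Q) : (x⁻¹).g = x.g⁻¹ := rfl

instance : Group (Lamp Γ Q) := Group.ofLeftAxioms
  (by intro x y z; ext h <;> simp [mul_assoc, add_assoc])
  (by intro x; ext h <;> simp)
  (by intro x; ext h <;> simp)

/-- Lamp element supported at the identity. -/
noncomputable def cL (γ : Q) : Lamp Γ Q := ⟨fun h => if h = 1 then γ else 0, 1⟩
/-- Base group element. -/
def gL (g : Γ) : Lamp Γ Q := ⟨fun _ => 0, g⟩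

@[simp] theorem cL_q (γ : Q) (h : Γ) : (cL γ : Lamp Γ Q).q h = if h = 1 then γ else 0 := rfl
@[simp] theorem cL_g (γ : Q) : (cL γ : Lamp Γ Q).g = 1 := rfl
@[simp] theorem gL_q (g h : Γ) : (gL g : Lamp Γ Q).q h = 0 := rfl
@[simp] theorem gL_g (g : Γ) : (gL g : Lamp Γ Q).g = g := rfl

theorem cL_add (γ δ : Q) : (cL (γ + δ) : Lamp Γ Q) = cL γ * cL δ := by
  ext h
  · by_cases hh : h = 1 <;> simp [hh]
  · simp
@[simp] theorem cL_zero : (cL 0 : Lamp Γ Q) = 1 := by ext h <;> simp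
theorem gL_mul (g h : Γ) : (gL (g * h) : Lamp Γ Q) = gL g * gL h := by ext x <;> simp
@[simp] theorem gL_one : (gL 1 : Lamp Γ Q) = 1 := by ext h <;> simp
theorem cL_neg (γ : Q) : (cL (-γ) : Lamp Γ Q) = (cL γ)⁻¹ := by
  rw [eq_inv_iff_mul_eq_one, ← cL_add]; simp
theorem gL_inv (g : Γ) : (gL g⁻¹ : Lamp Γ Q) = (gL g)⁻¹ := by
  rw [eq_inv_iff_mul_eq_one, ← gL_mul]; simp

end LampGroup

/-- The combinatorial data defining the group. -/
structure Sys where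
  ι : Type
  Γ : ι → Type
  grp : ∀ s, Group (Γ s)
  fin : ∀ s, Fintype (Γ s)
  b : ι → ℕ
  b_pos : ∀ s, 1 ≤ b s
  iso : ∀ s s', s ≠ s' → (b s : ℤ) ≤ |2 * (b s : ℤ) - 2 * (b s' : ℤ)|
  ha : ∀ s, AA →* Γ s
  hb : ∀ s, AA →* Γ s
  pA : ∀ s, Γ s →* AA
  pB : ∀ s, Γ s →* AA
  pAa : ∀ s α, pA s (ha s α) = α
  pAb : ∀ s α, pA s (hb s α) = 1
  pBa : ∀ s α, pB s (ha s α) = 1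
  pBb : ∀ s α, pB s (hb s α) = α
  gen : ∀ s, Subgroup.closure (Set.range (ha s) ∪ Set.range (hb s)) = ⊤

attribute [instance] Sys.grp Sys.fin

/-- Displacement. -/
def Sys.k (D : Sys) (s : D.ι) : ℤ := 2 * (D.b s : ℤ)

theorem Sys.k_pos (D : Sys) (s : D.ι) : 2 ≤ D.k s := by
  have := D.b_pos s; unfold Sys.k; omega

/-- The big ambient group. -/
@[ext] structure Hg (D : Sys) (Q : Type) where
  φ : ∀ s : D.ι, ℤ → Lamp (D.Γ s) Q
  z : ℤ

section HgGroup
variable {D : Sys} {Q : Type} [CommRing Q]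

instance : Mul (Hg D Q) := ⟨fun X Y => ⟨fun s x => X.φ s x * Y.φ s (x - X.z), X.z + Y.z⟩⟩
instance : One (Hg D Q) := ⟨⟨fun _ _ => 1, 0⟩⟩
instance : Inv (Hg D Q) := ⟨fun X => ⟨fun s x => (X.φ s (x + X.z))⁻¹, - X.z⟩⟩

@[simp] theorem Hg.mul_φ (X Y : Hg D Q) (s : D.ι) (x : ℤ) :
    (X * Y).φ s x = X.φ s x * Y.φ s (x - X.z) := rfl
@[simp] theorem Hg.mul_z (X Y : Hg D Q) : (X * Y).z = X.z + Y.z := rfl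
@[simp] theorem Hg.one_φ (s : D.ι) (x : ℤ) : (1 : Hg D Q).φ s x = 1 := rfl
@[simp] theorem Hg.one_z : (1 : Hg D Q).z = 0 := rfl
@[simp] theorem Hg.inv_φ (X : Hg D Q) (s : D.ι) (x : ℤ) :
    (X⁻¹).φ s x = (X.φ s (x + X.z))⁻¹ := rfl
@[simp] theorem Hg.inv_z (X : Hg D Q) : (X⁻¹).z = - X.z := rfl

theorem Hg.ext' {X Y : Hg D Q} (h : ∀ s x, X.φ s x = Y.φ s x) (hz : X.z = Y.z) : X = Y :=
  Hg.ext (funext fun s => funext fun x => h s x) hz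

instance : Group (Hg D Q) := Group.ofLeftAxioms
  (by
    intro X Y Z
    apply Hg.ext'
    · intro s x; simp [mul_assoc, sub_sub]
    · simp [add_assoc])
  (by intro X; apply Hg.ext' <;> simp)
  (by intro X; apply Hg.ext' <;> simp)

variable (D Q) in
/-- Translation. -/
def tt (e : ℤ) : Hg D Q := ⟨fun _ _ => 1, e⟩
variable (Q) in
def hA (D : Sys) (α : ℤ → AA) : Hg D Q := ⟨fun s x => gL (D.ha s (α (x - D.k s))), 0⟩
variable (Q) in
def hB (D : Sys) (α : ℤ → AA) : Hg D Q := ⟨fun s x => gL (D.hb s (α (x + D.k s))), 0⟩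
noncomputable def hC (D : Sys) (q : ℤ → Q) : Hg D Q := ⟨fun s x => cL (q x), 0⟩

@[simp] theorem tt_φ (e : ℤ) (s : D.ι) (x : ℤ) : (tt D Q e).φ s x = 1 := rfl
@[simp] theorem tt_z (e : ℤ) : (tt D Q e).z = e := rfl
@[simp] theorem hA_φ (α : ℤ → AA) (s : D.ι) (x : ℤ) :
    (hA Q D α).φ s x = gL (D.ha s (α (x - D.k s))) := rfl
@[simp] theorem hA_z (α : ℤ → AA) : (hA Q D α).z = 0 := rfl
@[simp] theorem hB_φ (α : ℤ → AA) (s : D.ι) (x : ℤ) :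
    (hB Q D α).φ s x = gL (D.hb s (α (x + D.k s))) := rfl
@[simp] theorem hB_z (α : ℤ → AA) : (hB Q D α).z = 0 := rfl
@[simp] theorem hC_φ (q : ℤ → Q) (s : D.ι) (x : ℤ) : (hC D q).φ s x = cL (q x) := rfl
@[simp] theorem hC_z (q : ℤ → Q) : (hC D q).z = 0 := rfl

theorem hA_mul (α β : ℤ → AA) : hA Q D (α * β) = hA Q D α * hA Q D β := by
  apply Hg.ext' <;> simp [gL_mul]
theorem hB_mul (α β : ℤ → AA) : hB Q D (α * β) = hB Q D α * hB Q D β := by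
  apply Hg.ext' <;> simp [gL_mul]
theorem hC_add (α β : ℤ → Q) : hC D (α + β) = hC D α * hC D β := by
  apply Hg.ext' <;> simp [cL_add]
theorem hA_one : hA Q D 1 = 1 := by apply Hg.ext' <;> simp
theorem hB_one : hB Q D 1 = 1 := by apply Hg.ext' <;> simp
theorem hC_zero : hC D (0 : ℤ → Q) = 1 := by apply Hg.ext' <;> simp
theorem hA_inv (α : ℤ → AA) : hA Q D α⁻¹ = (hA Q D α)⁻¹ := by
  rw [eq_inv_iff_mul_eq_one, ← hA_mul, inv_mul_cancel, hA_one]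
theorem hB_inv (α : ℤ → AA) : hB Q D α⁻¹ = (hB Q D α)⁻¹ := by
  rw [eq_inv_iff_mul_eq_one, ← hB_mul, inv_mul_cancel, hB_one]
theorem hC_neg (q : ℤ → Q) : hC D (-q) = (hC D q)⁻¹ := by
  rw [eq_inv_iff_mul_eq_one, ← hC_add, neg_add_cancel, hC_zero]
theorem tt_add (e f : ℤ) : tt D Q (e + f) = tt D Q e * tt D Q f := by
  apply Hg.ext' <;> simp
theorem tt_zero : tt D Q 0 = 1 := by apply Hg.ext' <;> simp
theorem tt_neg (e : ℤ) : tt D Q (-e) = (tt D Q e)⁻¹ := by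
  rw [eq_inv_iff_mul_eq_one, ← tt_add, neg_add_cancel, tt_zero]

end HgGroup

/-- Letters. -/
abbrev Om := Bool ⊕ (AA ⊕ (AA ⊕ (Bool × Bool)))

noncomputable def pr : Om → ℝ
  | Sum.inl _ => 1 / 8
  | Sum.inr (Sum.inl _) => 1 / 64
  | Sum.inr (Sum.inr (Sum.inl _)) => 1 / 64
  | Sum.inr (Sum.inr (Sum.inr _)) => 1 / 16

def xi (Q : Type) [CommRing Q] (e : Bool × Bool) : Q :=
  (if e.1 then 1 else 0) - (if e.2 then 1 else 0)

/-- Direction of a move letter. -/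
def dir (e : Bool) : ℤ := if e then 1 else -1

noncomputable def val (D : Sys) (Q : Type) [CommRing Q] : Om → Hg D Q
  | Sum.inl e => tt D Q (dir e)
  | Sum.inr (Sum.inl α) => hA Q D (Pi.mulSingle 0 α)
  | Sum.inr (Sum.inr (Sum.inl α)) => hB Q D (Pi.mulSingle 0 α)
  | Sum.inr (Sum.inr (Sum.inr e)) => hC D (Pi.single 0 (xi Q e))

/-- Averages over `AA`. -/
noncomputable def avg (F : AA → ℝ) : ℝ := (1 / 16) * ∑ α, F α

theorem card_AA : Fintype.card AA = 16 := by
  simp [Fintype.card_pi, ZMod.card]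

theorem avg_const (c : ℝ) : avg (fun _ => c) = c := by
  unfold avg; rw [Finset.sum_const, Finset.card_univ, card_AA]; norm_num; ring

theorem sum_Om (F : Om → ℝ) : ∑ ω, pr ω * F ω
    = (1 / 8) * (F (Sum.inl true) + F (Sum.inl false))
      + (1 / 4) * avg (fun α => F (Sum.inr (Sum.inl α)))
      + (1 / 4) * avg (fun α => F (Sum.inr (Sum.inr (Sum.inl α))))
      + (1 / 16) * ∑ e : Bool × Bool, F (Sum.inr (Sum.inr (Sum.inr e))) := by
  rw [Fintype.sum_sum_type, Fintype.sum_sum_type, Fintype.sum_sum_type]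
  simp only [pr, avg, ← Finset.mul_sum, Fintype.sum_bool]
  ring

theorem pr_pos : ∀ ω, 0 < pr ω
  | Sum.inl _ => by norm_num [pr]
  | Sum.inr (Sum.inl _) => by norm_num [pr]
  | Sum.inr (Sum.inr (Sum.inl _)) => by norm_num [pr]
  | Sum.inr (Sum.inr (Sum.inr _)) => by norm_num [pr]

theorem pr_nonneg (ω : Om) : 0 ≤ pr ω := (pr_pos ω).le

theorem pr_sum : ∑ ω, pr ω = 1 := by
  have := sum_Om (fun _ => 1)
  simp only [mul_one, avg_const] at this
  rw [this]; simp; norm_num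

/-- Inverse letters. -/
def invOm : Om → Om
  | Sum.inl e => Sum.inl (!e)
  | Sum.inr (Sum.inl α) => Sum.inr (Sum.inl α⁻¹)
  | Sum.inr (Sum.inr (Sum.inl α)) => Sum.inr (Sum.inr (Sum.inl α⁻¹))
  | Sum.inr (Sum.inr (Sum.inr e)) => Sum.inr (Sum.inr (Sum.inr (e.2, e.1)))

theorem invOm_inv : Function.Involutive invOm
  | Sum.inl e => by simp [invOm]
  | Sum.inr (Sum.inl α) => by simp [invOm]
  | Sum.inr (Sum.inr (Sum.inl α)) => by simp [invOm]
  | Sum.inr (Sum.inr (Sum.inr e)) => by simp [invOm]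

theorem pr_invOm : ∀ ω, pr (invOm ω) = pr ω
  | Sum.inl e => by simp [invOm, pr]
  | Sum.inr (Sum.inl α) => by simp [invOm, pr]
  | Sum.inr (Sum.inr (Sum.inl α)) => by simp [invOm, pr]
  | Sum.inr (Sum.inr (Sum.inr e)) => by simp [invOm, pr]

section
variable (D : Sys) (Q : Type) [CommRing Q]

theorem val_invOm : ∀ ω, val D Q (invOm ω) = (val D Q ω)⁻¹
  | Sum.inl e => by
    simp only [invOm, val]; rw [← tt_neg]; congr 1; cases e <;> rfl
  | Sum.inr (Sum.inl α) => by
    simp only [invOm, val]; rw [← hA_inv, Pi.mulSingle_inv]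
  | Sum.inr (Sum.inr (Sum.inl α)) => by
    simp only [invOm, val]; rw [← hB_inv, Pi.mulSingle_inv]
  | Sum.inr (Sum.inr (Sum.inr e)) => by
    simp only [invOm, val]; rw [← hC_neg, ← Pi.single_neg]; congr 2; simp [xi]

/-- The walk. -/
noncomputable abbrev XX (l : List Om) : Hg D Q := Xw (val D Q) l

theorem XX_nil : XX D Q [] = 1 := rfl
theorem XX_cons (ω : Om) (l : List Om) : XX D Q (ω :: l) = val D Q ω * XX D Q l := by
  simp [XX, Xw]

theorem XX_t (e : Bool) (l : List Om) (s : D.ι) (x : ℤ) :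
    (XX D Q (Sum.inl e :: l)).φ s x = (XX D Q l).φ s (x - dir e) := by
  rw [XX_cons]; simp [val]
theorem XX_a (α : AA) (l : List Om) (s : D.ι) (x : ℤ) :
    (XX D Q (Sum.inr (Sum.inl α) :: l)).φ s x
      = gL (D.ha s (if x = D.k s then α else 1)) * (XX D Q l).φ s x := by
  rw [XX_cons]; simp [val, Pi.mulSingle_apply, sub_eq_zero]
theorem XX_b (α : AA) (l : List Om) (s : D.ι) (x : ℤ) :
    (XX D Q (Sum.inr (Sum.inr (Sum.inl α)) :: l)).φ s x
      = gL (D.hb s (if x = - D.k s then α else 1)) * (XX D Q l).φ s x := by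
  rw [XX_cons]; simp [val, Pi.mulSingle_apply, add_eq_zero_iff_eq_neg]
theorem XX_c (e : Bool × Bool) (l : List Om) (s : D.ι) (x : ℤ) :
    (XX D Q (Sum.inr (Sum.inr (Sum.inr e)) :: l)).φ s x
      = cL (if x = 0 then xi Q e else 0) * (XX D Q l).φ s x := by
  rw [XX_cons]; simp [val, Pi.single_apply]

end
end SE

namespace SE

set_option linter.unusedSectionVars false
set_option linter.unusedVariables false
set_option linter.unusedSimpArgs false

section Sweep
variable {D : Sys} {Q : Type} [CommRing Q]

/-- A set of generators together with costs of lamp letters. -/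
structure Cost (S : Set (Hg D Q)) (w : Q → ℕ) : Prop where
  t1 : tt D Q 1 ∈ S
  t2 : tt D Q (-1) ∈ S
  a : ∀ α, hA Q D (Pi.mulSingle 0 α) ∈ S
  b : ∀ α, hB Q D (Pi.mulSingle 0 α) ∈ S
  c : ∀ γ, Reach S (hC D (Pi.single 0 γ)) (w γ)
  w0 : w 0 = 0
  wneg : ∀ γ, w (-γ) = w γ
  wadd : ∀ γ δ, w (γ + δ) ≤ w γ + w δ

variable {S : Set (Hg D Q)} {w : Q → ℕ}

theorem Cost.tt_nat (hS : Cost S w) (n : ℕ) : Reach S (tt D Q n) n ∧ Reach S (tt D Q (-n)) n := by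
  induction n with
  | zero => simp [tt_zero, Reach.one]
  | succ n ih =>
    constructor
    · have := ih.1.mul (Reach.of_mem hS.t1)
      rw [← tt_add] at this
      exact_mod_cast this
    · have := ih.2.mul (Reach.of_mem hS.t2)
      rw [← tt_add] at this
      convert this using 2
      push_cast; ring

theorem Cost.tt (hS : Cost S w) (e : ℤ) : Reach S (tt D Q e) e.natAbs := by
  rcases Int.natAbs_eq e with h | h
  · have := (hS.tt_nat e.natAbs).1
    rwa [← h] at this
  · have := (hS.tt_nat e.natAbs).2
    rwa [← h] at this

/-- Conjugating by a translation. -/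
theorem Cost.conj (hS : Cost S w) {g : Hg D Q} {N : ℕ} (u : ℤ) (h : Reach S g N) :
    Reach S (SE.tt D Q u * g * SE.tt D Q (-u)) (2 * u.natAbs + N) := by
  have h2 := hS.tt (-u)
  rw [Int.natAbs_neg] at h2
  exact (((hS.tt u).mul h).mul h2).mono (by omega)

theorem conj_hC (u : ℤ) (q : ℤ → Q) :
    SE.tt D Q u * hC D (fun x => q (x + u)) * SE.tt D Q (-u) = hC D q := by
  apply Hg.ext' <;> simp
theorem conj_hA (u : ℤ) (q : ℤ → AA) :
    SE.tt D Q u * hA Q D (fun x => q (x + u)) * SE.tt D Q (-u) = hA Q D q := by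
  apply Hg.ext'
  · intro s x; simp; congr 3; ring
  · simp
theorem conj_hB (u : ℤ) (q : ℤ → AA) :
    SE.tt D Q u * hB Q D (fun x => q (x + u)) * SE.tt D Q (-u) = hB Q D q := by
  apply Hg.ext'
  · intro s x; simp; congr 3; ring
  · simp

theorem Cost.sweepC (hS : Cost S w) (L : ℕ) : ∀ q : ℤ → Q, (∀ x : ℤ, ¬ (0 ≤ x ∧ x < L) → q x = 0) →
    Reach S (hC D q) (2 * L + ∑ x ∈ Finset.range L, w (q x)) := by
  induction L with
  | zero =>
    intro q hq
    have : q = 0 := funext fun x => hq x (by push_cast; omega)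
    rw [this, hC_zero]; simpa using Reach.one
  | succ L ih =>
    intro q hq
    have h1 := ih (fun x => if x = -1 then 0 else q (x + 1)) (fun x hx => by
      by_cases h : x = -1
      · simp [h]
      · simp only [h, if_false]; apply hq; push_cast; omega)
    have h2 := (hS.c (q 0)).mul (hS.conj 1 h1)
    have e : hC D q = hC D (Pi.single 0 (q 0)) * (SE.tt D Q 1 *
        hC D (fun x => if x = -1 then 0 else q (x + 1)) * SE.tt D Q (-1)) := by
      apply Hg.ext'
      · intro s x
        simp [Pi.single_apply]
        by_cases h : x = 0
        · subst h; simp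
        · rw [if_neg h, if_neg (by omega)]; simp
      · simp
    rw [e]
    refine h2.mono ?_
    rw [Finset.sum_range_succ']
    have : ∑ x ∈ Finset.range L, w (if (x : ℤ) = -1 then 0 else q (x + 1))
        = ∑ x ∈ Finset.range L, w (q ((x + 1 : ℕ) : ℤ)) := by
      refine Finset.sum_congr rfl fun x _ => ?_
      rw [if_neg (by omega)]; push_cast; rfl
    rw [this]
    simp; omega

theorem Cost.sweepA (hS : Cost S w) (L : ℕ) : ∀ q : ℤ → AA, (∀ x : ℤ, ¬ (0 ≤ x ∧ x < L) → q x = 1) →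
    Reach S (hA Q D q) (3 * L) := by
  induction L with
  | zero =>
    intro q hq
    have : q = 1 := funext fun x => hq x (by push_cast; omega)
    rw [this, hA_one]; simpa using Reach.one
  | succ L ih =>
    intro q hq
    have h1 := ih (fun x => if x = -1 then 1 else q (x + 1)) (fun x hx => by
      by_cases h : x = -1
      · simp [h]
      · simp only [h, if_false]; apply hq; push_cast; omega)
    have h2 := (Reach.of_mem (hS.a (q 0))).mul (hS.conj 1 h1)
    have e : hA Q D q = hA Q D (Pi.mulSingle 0 (q 0)) * (SE.tt D Q 1 *
        hA Q D (fun x => if x = -1 then 1 else q (x + 1)) * SE.tt D Q (-1)) := by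
      apply Hg.ext'
      · intro s x
        simp [Pi.mulSingle_apply]
        by_cases h : x - D.k s = 0
        · rw [if_pos h, if_pos (by omega), h]; simp
        · rw [if_neg h, if_neg (by omega)]; simp; congr 3; ring
      · simp
    rw [e]
    refine h2.mono ?_
    simp; omega

theorem Cost.sweepB (hS : Cost S w) (L : ℕ) : ∀ q : ℤ → AA, (∀ x : ℤ, ¬ (0 ≤ x ∧ x < L) → q x = 1) →
    Reach S (hB Q D q) (3 * L) := by
  induction L with
  | zero =>
    intro q hq
    have : q = 1 := funext fun x => hq x (by push_cast; omega)
    rw [this, hB_one]; simpa using Reach.one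
  | succ L ih =>
    intro q hq
    have h1 := ih (fun x => if x = -1 then 1 else q (x + 1)) (fun x hx => by
      by_cases h : x = -1
      · simp [h]
      · simp only [h, if_false]; apply hq; push_cast; omega)
    have h2 := (Reach.of_mem (hS.b (q 0))).mul (hS.conj 1 h1)
    have e : hB Q D q = hB Q D (Pi.mulSingle 0 (q 0)) * (SE.tt D Q 1 *
        hB Q D (fun x => if x = -1 then 1 else q (x + 1)) * SE.tt D Q (-1)) := by
      apply Hg.ext'
      · intro s x
        simp [Pi.mulSingle_apply]
        by_cases h : x + D.k s = 0
        · rw [if_pos h, if_pos (by omega), h]; simp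
        · rw [if_neg h, if_neg (by omega)]; simp; congr 3; ring
      · simp
    rw [e]
    refine h2.mono ?_
    simp; omega

theorem Cost.sweepC' (hS : Cost S w) (u : ℤ) (L : ℕ) (q : ℤ → Q)
    (hq : ∀ x : ℤ, ¬ (u ≤ x ∧ x < u + L) → q x = 0) :
    Reach S (hC D q) (2 * u.natAbs + (2 * L + ∑ x ∈ Finset.range L, w (q (x + u)))) := by
  have := hS.conj u (hS.sweepC L (fun x => q (x + u)) fun x hx => hq _ (by omega))
  rwa [conj_hC] at this
theorem Cost.sweepA' (hS : Cost S w) (u : ℤ) (L : ℕ) (q : ℤ → AA)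
    (hq : ∀ x : ℤ, ¬ (u ≤ x ∧ x < u + L) → q x = 1) :
    Reach S (hA Q D q) (2 * u.natAbs + 3 * L) := by
  have := hS.conj u (hS.sweepA L (fun x => q (x + u)) fun x hx => hq _ (by omega))
  rwa [conj_hA] at this
theorem Cost.sweepB' (hS : Cost S w) (u : ℤ) (L : ℕ) (q : ℤ → AA)
    (hq : ∀ x : ℤ, ¬ (u ≤ x ∧ x < u + L) → q x = 1) :
    Reach S (hB Q D q) (2 * u.natAbs + 3 * L) := by
  have := hS.conj u (hS.sweepB L (fun x => q (x + u)) fun x hx => hq _ (by omega))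
  rwa [conj_hB] at this

end Sweep

section Block
variable {D : Sys} {Q : Type} [CommRing Q]

/-- One instruction at a site. -/
abbrev Ins (Q : Type) := Q × AA × AA

/-- Effect of one instruction. -/
noncomputable def ins (s : D.ι) (i : Ins Q) : Lamp (D.Γ s) Q :=
  cL i.1 * gL (D.ha s i.2.1) * gL (D.hb s i.2.2)

/-- Effect of a program. -/
noncomputable def ev (s : D.ι) (P : List (Ins Q)) : Lamp (D.Γ s) Q := (P.map (ins s)).prod

/-- Simultaneous execution of instructions at all sites of a block. -/
noncomputable def rnd (s : D.ι) (r : ℤ → Ins Q) : Hg D Q :=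
  hC D (fun x => (r x).1) * hA Q D (fun y => (r (y + D.k s)).2.1)
    * hB Q D (fun y => (r (y - D.k s)).2.2)

noncomputable def blk (s : D.ι) (R : List (ℤ → Ins Q)) : Hg D Q := (R.map (rnd s)).prod

theorem rnd_z (s : D.ι) (r : ℤ → Ins Q) : (rnd s r).z = 0 := by simp [rnd]

theorem rnd_φ (s s' : D.ι) (r : ℤ → Ins Q) (x : ℤ) : (rnd s r).φ s' x
    = cL (r x).1 * gL (D.ha s' (r (x - D.k s' + D.k s)).2.1)
      * gL (D.hb s' (r (x + D.k s' - D.k s)).2.2) := by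
  simp [rnd]

theorem blk_cons (s : D.ι) (r : ℤ → Ins Q) (R : List (ℤ → Ins Q)) :
    blk s (r :: R) = rnd s r * blk s R := by simp [blk]

theorem blk_z (s : D.ι) (R : List (ℤ → Ins Q)) : (blk s R).z = 0 := by
  induction R with
  | nil => rfl
  | cons r R ih => rw [blk_cons]; simp [rnd_z, ih]

theorem blk_cons_φ (s s' : D.ι) (r : ℤ → Ins Q) (R : List (ℤ → Ins Q)) (x : ℤ) :
    (blk s (r :: R)).φ s' x = (rnd s r).φ s' x * (blk s R).φ s' x := by
  rw [blk_cons]; simp [rnd_z]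

theorem ev_cons (s : D.ι) (i : Ins Q) (P : List (Ins Q)) : ev s (i :: P) = ins s i * ev s P := by
  simp [ev]

theorem blk_same (s : D.ι) (R : List (ℤ → Ins Q)) (x : ℤ) :
    (blk s R).φ s x = ev s (R.map (fun r => r x)) := by
  induction R with
  | nil => rfl
  | cons r R ih =>
    rw [blk_cons_φ, ih, List.map_cons, ev_cons, rnd_φ]
    simp [ins]

theorem Lamp.tot_mul {Γ : Type} [Group Γ] [Fintype Γ] (x y : Lamp Γ Q) :
    ∑ h, (x * y).q h = ∑ h, x.q h + ∑ h, y.q h := by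
  simp only [Lamp.mul_q, Finset.sum_add_distrib]
  congr 1
  exact Equiv.sum_comp (Equiv.mulLeft x.g⁻¹) y.q

theorem tot_ins (s : D.ι) (i : Ins Q) : ∑ h, (ins s i).q h = i.1 := by
  unfold ins; rw [Lamp.tot_mul, Lamp.tot_mul]; simp

theorem tot_ev (s : D.ι) (P : List (Ins Q)) :
    ∑ h, (ev s P).q h = (P.map (fun i => i.1)).sum := by
  induction P with
  | nil => simp [ev]
  | cons i P ih => rw [ev_cons, Lamp.tot_mul, ih, tot_ins]; simp

theorem pA_ev (s : D.ι) (P : List (Ins Q)) :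
    D.pA s (ev s P).g = (P.map (fun i => i.2.1)).prod := by
  induction P with
  | nil => simp [ev]
  | cons i P ih => rw [ev_cons, Lamp.mul_g, map_mul, ih]; simp [ins, D.pAa, D.pAb]

theorem pB_ev (s : D.ι) (P : List (Ins Q)) :
    D.pB s (ev s P).g = (P.map (fun i => i.2.2)).prod := by
  induction P with
  | nil => simp [ev]
  | cons i P ih => rw [ev_cons, Lamp.mul_g, map_mul, ih]; simp [ins, D.pBa, D.pBb]

/-- The trivial instruction. -/
abbrev nop : Ins Q := (0, 1, 1)

theorem blk_other (s s' : D.ι) (hss : s ≠ s') (R : List (ℤ → Ins Q))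
    (hR : ∀ r ∈ R, ∀ x, ¬ (0 ≤ x ∧ x < (D.b s : ℤ)) → r x = nop)
    (hT : ∀ x, ∑ h, (ev s (R.map (fun r => r x))).q h = 0)
    (hTA : ∀ x, D.pA s (ev s (R.map (fun r => r x))).g = 1)
    (hTB : ∀ x, D.pB s (ev s (R.map (fun r => r x))).g = 1) (x : ℤ) :
    (blk s R).φ s' x = 1 := by
  have hiso := D.iso s s' hss
  rw [← Sys.k, ← Sys.k] at hiso
  set d := D.k s - D.k s' with hd
  have hd' : (D.b s : ℤ) ≤ d ∨ d ≤ -(D.b s : ℤ) := by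
    rcases abs_cases d with ⟨h, _⟩ | ⟨h, _⟩ <;> rw [h] at hiso
    · left; omega
    · right; omega
  have hb := D.b_pos s
  have e1 : x - D.k s' + D.k s = x + d := by omega
  have e2 : x + D.k s' - D.k s = x - d := by omega
  by_cases hx : 0 ≤ x ∧ x < (D.b s : ℤ)
  · have key : ∀ R : List (ℤ → Ins Q),
        (∀ r ∈ R, ∀ x, ¬ (0 ≤ x ∧ x < (D.b s : ℤ)) → r x = nop) →
        (blk s R).φ s' x = cL ((R.map (fun r => (r x).1)).sum) := by
      intro R
      induction R with
      | nil => intro _; simp [blk]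
      | cons r R ih =>
        intro h
        rw [blk_cons_φ, ih fun r' hr' => h r' (by simp [hr']), rnd_φ, e1, e2,
          h r (by simp) (x + d) (by omega), h r (by simp) (x - d) (by omega)]
        simp [cL_add]
    rw [key R hR]
    have := hT x
    rw [tot_ev, List.map_map] at this
    rw [show (fun r : ℤ → Ins Q => (r x).1) = (fun i : Ins Q => i.1) ∘ (fun r => r x) from rfl,
      this, cL_zero]
  · by_cases hx2 : 0 ≤ x + d ∧ x + d < (D.b s : ℤ)
    · have key : ∀ R : List (ℤ → Ins Q),
          (∀ r ∈ R, ∀ x, ¬ (0 ≤ x ∧ x < (D.b s : ℤ)) → r x = nop) →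
          (blk s R).φ s' x = gL (D.ha s' (R.map (fun r => (r (x + d)).2.1)).prod) := by
        intro R
        induction R with
        | nil => intro _; simp [blk]
        | cons r R ih =>
          intro h
          rw [blk_cons_φ, ih fun r' hr' => h r' (by simp [hr']), rnd_φ, e1, e2,
            h r (by simp) x (by omega), h r (by simp) (x - d) (by omega)]
          simp [gL_mul]
      rw [key R hR]
      have := hTA (x + d)
      rw [pA_ev, List.map_map] at this
      rw [show (fun r : ℤ → Ins Q => (r (x + d)).2.1)
        = (fun i : Ins Q => i.2.1) ∘ (fun r => r (x + d)) from rfl, this]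
      simp
    · have key : ∀ R : List (ℤ → Ins Q),
          (∀ r ∈ R, ∀ x, ¬ (0 ≤ x ∧ x < (D.b s : ℤ)) → r x = nop) →
          (blk s R).φ s' x = gL (D.hb s' (R.map (fun r => (r (x - d)).2.2)).prod) := by
        intro R
        induction R with
        | nil => intro _; simp [blk]
        | cons r R ih =>
          intro h
          rw [blk_cons_φ, ih fun r' hr' => h r' (by simp [hr']), rnd_φ, e1, e2,
            h r (by simp) x (by omega), h r (by simp) (x + d) (by omega)]
          simp [gL_mul]
      rw [key R hR]
      have := hTB (x - d)
      rw [pB_ev, List.map_map] at this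
      rw [show (fun r : ℤ → Ins Q => (r (x - d)).2.2)
        = (fun i : Ins Q => i.2.2) ∘ (fun r => r (x - d)) from rfl, this]
      simp

/-- Element acting only on coordinate `s`. -/
noncomputable def el (s : D.ι) (T : ℤ → Lamp (D.Γ s) Q) : Hg D Q := ⟨Pi.mulSingle s T, 0⟩

theorem el_same (s : D.ι) (T : ℤ → Lamp (D.Γ s) Q) (x : ℤ) : (el s T).φ s x = T x := by
  simp [el]
theorem el_other {s s' : D.ι} (h : s' ≠ s) (T : ℤ → Lamp (D.Γ s) Q) (x : ℤ) :
    (el s T).φ s' x = 1 := by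
  simp [el, Pi.mulSingle_eq_of_ne h]
@[simp] theorem el_z (s : D.ι) (T : ℤ → Lamp (D.Γ s) Q) : (el s T).z = 0 := rfl

variable {S : Set (Hg D Q)} {w : Q → ℕ}

theorem Cost.rnd (hS : Cost S w) (s : D.ι) (r : ℤ → Ins Q)
    (hr : ∀ x, ¬ (0 ≤ x ∧ x < (D.b s : ℤ)) → r x = nop) :
    Reach S (rnd s r) (16 * D.b s + ∑ x ∈ Finset.range (D.b s), w (r x).1) := by
  have h1 := hS.sweepC (D.b s) (fun x => (r x).1) (fun x hx => by rw [hr x hx])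
  have h2 := hS.sweepA' (-D.k s) (D.b s) (fun y => (r (y + D.k s)).2.1)
    (fun x hx => by rw [hr _ (by omega)])
  have h3 := hS.sweepB' (D.k s) (D.b s) (fun y => (r (y - D.k s)).2.2)
    (fun x hx => by rw [hr _ (by omega)])
  refine ((h1.mul h2).mul h3).mono ?_
  have : (D.k s).natAbs = 2 * D.b s := by unfold Sys.k; omega
  rw [Int.natAbs_neg, this]; omega

theorem Cost.blk (hS : Cost S w) (s : D.ι) : ∀ (R : List (ℤ → Ins Q))
    (hR : ∀ r ∈ R, ∀ x, ¬ (0 ≤ x ∧ x < (D.b s : ℤ)) → r x = nop),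
    Reach S (blk s R) (16 * D.b s * R.length
      + ∑ x ∈ Finset.range (D.b s), (R.map (fun r => w (r x).1)).sum) := by
  intro R
  induction R with
  | nil => intro _; simpa [SE.blk] using Reach.one
  | cons r R ih =>
    intro h
    rw [blk_cons]
    refine ((hS.rnd s r (h r (by simp))).mul (ih fun r' hr' => h r' (by simp [hr']))).mono ?_
    simp only [List.length_cons, List.map_cons, List.sum_cons, Finset.sum_add_distrib]
    exact le_of_eq (by ring)

/-- `lam` can be programmed with `p` instructions and lamp cost `W`. -/
def Prog (w : Q → ℕ) (s : D.ι) (lam : Lamp (D.Γ s) Q) (p W : ℕ) : Prop :=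
  ∃ P : List (Ins Q), P.length = p ∧ ev s P = lam ∧ (P.map (fun i => w i.1)).sum ≤ W

theorem ev_append (s : D.ι) (P P' : List (Ins Q)) : ev s (P ++ P') = ev s P * ev s P' := by
  simp [ev]

theorem Prog.mono (w0 : w 0 = 0) {s : D.ι} {lam : Lamp (D.Γ s) Q} {p W p' W' : ℕ}
    (h : Prog w s lam p W) (hp : p ≤ p') (hW : W ≤ W') : Prog w s lam p' W' := by
  obtain ⟨P, h1, h2, h3⟩ := h
  have e : ∀ n, ev (D := D) s (List.replicate n (nop : Ins Q)) = 1 := by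
    intro n; induction n with
    | zero => rfl
    | succ n ih => rw [List.replicate_succ, ev_cons, ih]; simp [ins]
  refine ⟨P ++ List.replicate (p' - p) nop, by simp; omega, ?_, ?_⟩
  · rw [ev_append, e, h2, mul_one]
  · simp [w0]; omega

theorem Cost.block (hS : Cost S w) (s : D.ι) (T : ℤ → Lamp (D.Γ s) Q)
    (hT0 : ∀ x, ¬ (0 ≤ x ∧ x < (D.b s : ℤ)) → T x = 1)
    (hT : ∀ x, ∑ h, (T x).q h = 0) (hA : ∀ x, D.pA s (T x).g = 1) (hB : ∀ x, D.pB s (T x).g = 1)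
    (p : ℕ) (W : ℤ → ℕ) (hP : ∀ x, 0 ≤ x → x < (D.b s : ℤ) → Prog w s (T x) p (W x)) :
    Reach S (el s T) (16 * D.b s * p + ∑ x ∈ Finset.range (D.b s), W x) := by
  have hex : ∀ x : ℤ, ∃ P : List (Ins Q), P.length = p ∧ ev s P = T x ∧
      (0 ≤ x ∧ x < (D.b s : ℤ) → (P.map (fun i => w i.1)).sum ≤ W x) ∧
      (¬ (0 ≤ x ∧ x < (D.b s : ℤ)) → P = List.replicate p nop) := by
    intro x
    by_cases hx : 0 ≤ x ∧ x < (D.b s : ℤ)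
    · obtain ⟨P, h1, h2, h3⟩ := hP x hx.1 hx.2
      exact ⟨P, h1, h2, fun _ => h3, fun h => absurd hx h⟩
    · refine ⟨List.replicate p nop, by simp, ?_, fun h => absurd h hx, fun _ => rfl⟩
      rw [hT0 x hx]
      have : ∀ n, ev (D := D) s (List.replicate n (nop : Ins Q)) = 1 := by
        intro n; induction n with
        | zero => rfl
        | succ n ih => rw [List.replicate_succ, ev_cons, ih]; simp [ins]
      exact this p
  choose P hlen hev hw hnop using hex
  let R : List (ℤ → Ins Q) := (List.range p).map (fun j x => (P x).getD j nop)
  have hmap : ∀ x, R.map (fun r => r x) = P x := by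
    intro x
    apply List.ext_getElem
    · simp [R, hlen]
    · intro i h1 h2
      simp only [R, List.getElem_map, List.getElem_range]
      exact List.getD_eq_getElem _ _ h2
  have hRn : ∀ r ∈ R, ∀ x, ¬ (0 ≤ x ∧ x < (D.b s : ℤ)) → r x = nop := by
    intro r hr x hx
    have : r x ∈ R.map (fun r => r x) := List.mem_map.mpr ⟨r, hr, rfl⟩
    rw [hmap, hnop x hx] at this
    exact (List.mem_replicate.mp this).2
  have e : el s T = SE.blk s R := by
    apply Hg.ext'
    · intro s' x
      by_cases h : s' = s
      · subst h; rw [el_same, blk_same, hmap, hev]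
      · rw [el_other h, blk_other s s' (Ne.symm h) R hRn] <;> intro x <;> rw [hmap, hev]
        exacts [hT x, hA x, hB x]
    · rw [blk_z]; rfl
  rw [e]
  refine (hS.blk s R hRn).mono ?_
  have : R.length = p := by simp [R]
  rw [this]
  gcongr with x hx
  have h2 := hw x ⟨by positivity, by exact_mod_cast Finset.mem_range.mp hx⟩
  rw [← hmap x, List.map_map] at h2
  exact h2

theorem conj_el (s : D.ι) (u : ℤ) (T : ℤ → Lamp (D.Γ s) Q) :
    SE.tt D Q u * el s (fun x => T (x + u)) * SE.tt D Q (-u) = el s T := by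
  apply Hg.ext'
  · intro s' x
    by_cases h : s' = s
    · subst h; simp [el_same]
    · simp [el_other h]
  · simp

theorem Cost.chain (hS : Cost S w) (s : D.ι) (b : ℕ) (N : ℕ) : ∀ (T : ℤ → Lamp (D.Γ s) Q) (c : ℕ → ℕ)
    (hT : ∀ x, ¬ (0 ≤ x ∧ x < (N : ℤ) * b) → T x = 1)
    (hc : ∀ j < N, Reach S (el s (fun x => if 0 ≤ x ∧ x < (b : ℤ) then T (x + j * b) else 1)) (c j)),
    Reach S (el s T) (2 * (N * b) + ∑ j ∈ Finset.range N, c j) := by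
  induction N with
  | zero =>
    intro T c hT hc
    have : el s T = 1 := by
      apply Hg.ext'
      · intro s' x
        by_cases h : s' = s
        · subst h; rw [el_same, hT x (by push_cast; omega)]; rfl
        · rw [el_other h]; rfl
      · rfl
    rw [this]; simpa using Reach.one
  | succ N ih =>
    intro T c hT hc
    have hNb : ((N + 1 : ℕ) : ℤ) * b = N * b + b := by push_cast; ring
    have h1 := ih (fun x => if 0 ≤ x then T (x + b) else 1) (fun j => c (j + 1))
      (fun x hx => by
        split_ifs with h0
        · exact hT _ (by rw [hNb]; omega)
        · rfl)
      (fun j hj => by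
        have := hc (j + 1) (by omega)
        convert this using 3
        rename_i x
        have hjb : ((j + 1 : ℕ) : ℤ) * b = j * b + b := by push_cast; ring
        by_cases hx : 0 ≤ x ∧ x < (b : ℤ)
        · have : (0 : ℤ) ≤ j * b := by positivity
          rw [if_pos hx, if_pos hx, if_pos (by omega), hjb]; congr 1; ring
        · rw [if_neg hx, if_neg hx])
    have h2 := (hc 0 (by omega)).mul (hS.conj b h1)
    have e : el s T = el s (fun x => if 0 ≤ x ∧ x < (b : ℤ) then T (x + (0 : ℕ) * b) else 1) *
        (SE.tt D Q b * el s (fun x => if 0 ≤ x then T (x + b) else 1) * SE.tt D Q (-b)) := by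
      apply Hg.ext'
      · intro s' x
        by_cases h : s' = s
        · subst h
          simp only [Hg.mul_φ, el_same, el_z, tt_φ, tt_z, one_mul, mul_one, Hg.mul_z, sub_zero]
          by_cases hx : 0 ≤ x ∧ x < (b : ℤ)
          · rw [if_pos hx, if_neg (by omega)]; simp
          · rw [if_neg hx]
            by_cases hx2 : 0 ≤ x - b
            · rw [if_pos hx2]; simp
            · rw [if_neg hx2, hT x (by omega)]; simp
        · simp [el_other h]
      · simp
    rw [e]
    refine h2.mono ?_
    rw [Finset.sum_range_succ' c N]
    simp only [Int.natAbs_natCast]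
    have : (N + 1) * b = N * b + b := by ring
    rw [this]; omega

end Block
end SE

namespace SE

set_option linter.unusedSectionVars false
set_option linter.unusedVariables false
set_option linter.unusedSimpArgs false

section Paths
variable {D : Sys} {Q : Type} [CommRing Q]

def stp (s : D.ι) (σ : AA × AA) : D.Γ s := D.ha s σ.1 * D.hb s σ.2
def en (s : D.ι) (u : List (AA × AA)) : D.Γ s := (u.map (stp s)).prod
def Vis (s : D.ι) (u : List (AA × AA)) (g : D.Γ s) : Prop := ∃ u1 u2, u = u1 ++ u2 ∧ en s u1 = g

theorem en_nil (s : D.ι) : en s [] = 1 := rfl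
theorem en_cons (s : D.ι) (σ : AA × AA) (u : List (AA × AA)) : en s (σ :: u) = stp s σ * en s u := by
  simp [en]
theorem en_append (s : D.ι) (u v : List (AA × AA)) : en s (u ++ v) = en s u * en s v := by
  simp [en]
theorem Vis.one (s : D.ι) (u : List (AA × AA)) : Vis s u 1 := ⟨[], u, rfl, rfl⟩
theorem Vis.en (s : D.ι) (u : List (AA × AA)) : Vis s u (en s u) := ⟨u, [], by simp, rfl⟩
theorem Vis.left {s : D.ι} {u : List (AA × AA)} {g : D.Γ s} (h : Vis s u g) (v : List (AA × AA)) :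
    Vis s (u ++ v) g := by
  obtain ⟨u1, u2, rfl, rfl⟩ := h
  exact ⟨u1, u2 ++ v, by simp, rfl⟩
theorem Vis.right {s : D.ι} {v : List (AA × AA)} {g : D.Γ s} (u : List (AA × AA)) (h : Vis s v g) :
    Vis s (u ++ v) (SE.en s u * g) := by
  obtain ⟨u1, u2, rfl, rfl⟩ := h
  exact ⟨u ++ u1, u2, by simp, en_append _ _ _⟩
theorem Vis_cons {s : D.ι} {σ : AA × AA} {u : List (AA × AA)} {g : D.Γ s} (h : Vis s (σ :: u) g) :
    g = 1 ∨ Vis s u ((stp s σ)⁻¹ * g) := by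
  obtain ⟨u1, u2, h1, rfl⟩ := h
  cases u1 with
  | nil => left; rfl
  | cons a u1 =>
    right
    simp only [List.cons_append, List.cons.injEq] at h1
    obtain ⟨rfl, rfl⟩ := h1
    exact ⟨u1, u2, rfl, by rw [en_cons]; simp⟩
theorem Vis_nil {s : D.ι} {g : D.Γ s} (h : Vis s [] g) : g = 1 := by
  obtain ⟨u1, u2, h1, rfl⟩ := h
  have : u1 = [] := by
    cases u1 with
    | nil => rfl
    | cons a u => simp at h1
  rw [this]; rfl

def PathCov (s : D.ι) (lam : Lamp (D.Γ s) Q) (p : ℕ) : Prop :=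
  ∃ u : List (AA × AA), u.length ≤ p ∧ (∀ h, lam.q h ≠ 0 → Vis s u h) ∧ en s u = lam.g

theorem PathCov.mono {s : D.ι} {lam : Lamp (D.Γ s) Q} {p p' : ℕ} (h : PathCov s lam p)
    (hp : p ≤ p') : PathCov s lam p' := by
  obtain ⟨u, h1, h2⟩ := h
  exact ⟨u, h1.trans hp, h2⟩

theorem prog_of_path (w : Q → ℕ) (w0 : w 0 = 0) (s : D.ι) : ∀ (u : List (AA × AA))
    (lam : Lamp (D.Γ s) Q), (∀ h, lam.q h ≠ 0 → Vis s u h) → en s u = lam.g →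
    Prog w s lam (u.length + 1) (∑ h, w (lam.q h)) := by
  intro u
  induction u with
  | nil =>
    intro lam h1 h2
    refine ⟨[(lam.q 1, 1, 1)], rfl, ?_, ?_⟩
    · rw [ev_cons]
      simp only [ev, ins, List.map_nil, List.prod_nil, mul_one, map_one, gL_one]
      ext h
      · by_cases hh : h = 1
        · simp [hh]
        · simp only [cL_q, hh, if_false]
          by_contra hc
          exact hh (Vis_nil (h1 h (Ne.symm hc)))
      · simp; exact h2
    · simp only [List.map_cons, List.map_nil, List.sum_cons, List.sum_nil, add_zero]
      exact Finset.single_le_sum (f := fun h => w (lam.q h)) (fun _ _ => Nat.zero_le _)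
        (Finset.mem_univ 1)
  | cons σ u ih =>
    intro lam h1 h2
    set g := stp s σ with hg
    let F : D.Γ s → Q := fun h => if h = 1 then 0 else lam.q h
    let lam' : Lamp (D.Γ s) Q := ⟨fun h => F (g * h), g⁻¹ * lam.g⟩
    obtain ⟨P, hP1, hP2, hP3⟩ := ih lam'
      (fun h hh => by
        have h3 : g * h ≠ 1 := by intro hc; simp [lam', F, hc] at hh
        have h4 : lam.q (g * h) ≠ 0 := by simpa [lam', F, h3] using hh
        have := Vis_cons (h1 _ h4)
        rcases this with h5 | h5
        · exact absurd h5 h3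
        · simpa [← hg] using h5)
      (by simp only [lam']; rw [← h2, en_cons]; simp [← hg])
    refine ⟨(lam.q 1, σ.1, σ.2) :: P, by simp [hP1], ?_, ?_⟩
    · rw [ev_cons, hP2]
      ext h
      · simp only [ins, Lamp.mul_q, Lamp.mul_g, cL_q, gL_q, cL_g, gL_g, add_zero, one_mul, lam', F]
        have : g * ((D.ha s σ.1 * D.hb s σ.2)⁻¹ * h) = h := by
          rw [hg]; simp [stp, mul_assoc]
        rw [this]
        by_cases hh : h = 1 <;> simp [hh]
      · simp only [ins, Lamp.mul_g, cL_g, gL_g, one_mul, lam']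
        rw [hg]; simp [stp, mul_assoc]
    · simp only [List.map_cons, List.sum_cons]
      have e1 : ∑ h, w (lam'.q h) = ∑ h, w (F h) :=
        Equiv.sum_comp (Equiv.mulLeft g) (fun h => w (F h))
      have e2 : ∑ h, w (lam.q h) = w (lam.q 1) + ∑ h, w (F h) := by
        rw [← Finset.add_sum_erase _ _ (Finset.mem_univ (1 : D.Γ s)),
          ← Finset.add_sum_erase _ (fun h => w (F h)) (Finset.mem_univ (1 : D.Γ s))]
        simp only [F, if_true, w0, zero_add]
        congr 1
        refine Finset.sum_congr rfl fun h hh => ?_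
        rw [if_neg (Finset.ne_of_mem_erase hh)]
      rw [e2, ← e1]; omega

theorem PathCov.prog {w : Q → ℕ} (w0 : w 0 = 0) {s : D.ι} {lam : Lamp (D.Γ s) Q} {p : ℕ}
    (h : PathCov s lam p) : Prog w s lam (p + 1) (∑ h, w (lam.q h)) := by
  obtain ⟨u, h1, h2, h3⟩ := h
  exact (prog_of_path w w0 s u lam h2 h3).mono w0 (by omega) le_rfl

theorem PathCov.card {s : D.ι} {lam : Lamp (D.Γ s) Q} {p : ℕ} (h : PathCov s lam p) :
    (Finset.univ.filter (fun h => lam.q h ≠ 0)).card ≤ p + 1 := by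
  obtain ⟨u, h1, h2, h3⟩ := h
  have : Finset.univ.filter (fun h => lam.q h ≠ 0)
      ⊆ (Finset.range (u.length + 1)).image (fun i => en s (u.take i)) := by
    intro h hh
    obtain ⟨u1, u2, rfl, rfl⟩ := h2 h (Finset.mem_filter.mp hh).2
    exact Finset.mem_image.mpr ⟨u1.length, by simp, by simp⟩
  refine (Finset.card_le_card this).trans (Finset.card_image_le.trans ?_)
  simp; omega

theorem PathCov.mul_gL {s : D.ι} {lam : Lamp (D.Γ s) Q} {p : ℕ} (h : PathCov s lam p)
    (σ : AA × AA) : PathCov s (lam * gL (stp s σ)) (p + 1) := by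
  obtain ⟨u, h1, h2, h3⟩ := h
  refine ⟨u ++ [σ], by simp; omega, ?_, ?_⟩
  · intro h hh
    exact (h2 h (by simpa using hh)).left _
  · rw [en_append, h3]; simp [en]

theorem PathCov.mul_cL {s : D.ι} {lam : Lamp (D.Γ s) Q} {p : ℕ} (h : PathCov s lam p)
    (γ : Q) : PathCov s (lam * cL γ) p := by
  obtain ⟨u, h1, h2, h3⟩ := h
  refine ⟨u, h1, ?_, by simpa using h3⟩
  intro h hh
  by_cases hq : lam.q h = 0
  · have : lam.g⁻¹ * h = 1 := by
      by_contra hc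
      simp [hq, hc] at hh
    have : h = en s u := by rw [h3]; exact (inv_mul_eq_one.mp this).symm
    rw [this]; exact Vis.en _ _
  · exact h2 h hq

theorem mem_of_closed {s : D.ι} (P : D.Γ s → Prop) (h1 : P 1)
    (ha : ∀ g α, P g → P (g * D.ha s α)) (hb : ∀ g α, P g → P (g * D.hb s α)) (g : D.Γ s) : P g := by
  have hg : g ∈ Submonoid.closure (Set.range (D.ha s) ∪ Set.range (D.hb s)
      ∪ (Set.range (D.ha s) ∪ Set.range (D.hb s))⁻¹) := by
    rw [← Subgroup.closure_toSubmonoid, D.gen s]; trivial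
  obtain ⟨l, hl, rfl⟩ := Submonoid.exists_list_of_mem_closure hg
  clear hg
  induction l using List.reverseRecOn with
  | nil => simpa using h1
  | append_singleton l a ih =>
    rw [List.prod_append]
    have h3 := ih fun y hy => hl y (by simp [hy])
    simp only [List.prod_cons, List.prod_nil, mul_one]
    rcases hl a (by simp) with h | h
    · rcases h with ⟨α, rfl⟩ | ⟨α, rfl⟩
      · exact ha _ _ h3
      · exact hb _ _ h3
    · rcases h with ⟨α, hα⟩ | ⟨α, hα⟩
      · have : a = D.ha s α⁻¹ := by rw [map_inv, hα, inv_inv]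
        rw [this]; exact ha _ _ h3
      · have : a = D.hb s α⁻¹ := by rw [map_inv, hα, inv_inv]
        rw [this]; exact hb _ _ h3

theorem tour (s : D.ι) : ∀ m ≤ Fintype.card (D.Γ s), ∃ u : List (AA × AA), u.length ≤ 2 * m ∧
    en s u = 1 ∧ m ≤ (Finset.univ.filter (fun g => Vis s u g)).card := by
  intro m
  induction m with
  | zero => intro _; exact ⟨[], by simp, rfl, by simp⟩
  | succ m ih =>
    intro hm
    obtain ⟨u, h1, h2, h3⟩ := ih (by omega)
    by_cases hall : ∀ g, Vis s u g
    · refine ⟨u, by omega, h2, ?_⟩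
      rw [Finset.filter_true_of_mem (fun g _ => hall g)]
      simpa using hm
    · have : ∃ v σ τ, Vis s u v ∧ ¬ Vis s u (v * stp s σ) ∧ stp s σ * stp s τ = 1 := by
        by_contra hc
        push Not at hc
        apply hall
        apply mem_of_closed
        · exact Vis.one _ _
        · intro g α hg
          by_contra h
          have := hc g (α, 1) (α⁻¹, 1) hg (by simpa [stp] using h)
          simp [stp] at this
        · intro g α hg
          by_contra h
          have := hc g (1, α) (1, α⁻¹) hg (by simpa [stp] using h)
          simp [stp] at this
      obtain ⟨v, σ, τ, hv, hn, hst⟩ := this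
      obtain ⟨u1, u2, rfl, rfl⟩ := hv
      have hst2 : en s [σ, τ] = 1 := by simp [en, hst]
      refine ⟨u1 ++ ([σ, τ] ++ u2), ?_, ?_, ?_⟩
      · simp at h1 ⊢; omega
      · rw [en_append, en_append, hst2, one_mul, ← en_append, h2]
      · have hsub : insert (en s u1 * stp s σ) (Finset.univ.filter (fun g => Vis s (u1 ++ u2) g))
            ⊆ Finset.univ.filter (fun g => Vis s (u1 ++ ([σ, τ] ++ u2)) g) := by
          intro g hg
          rw [Finset.mem_filter]
          refine ⟨Finset.mem_univ _, ?_⟩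
          rcases Finset.mem_insert.mp hg with rfl | hg
          · refine Vis.right u1 ⟨[σ], τ :: u2, rfl, by simp [en]⟩
          · obtain ⟨w1, w2, hw, rfl⟩ := (Finset.mem_filter.mp hg).2
            rcases List.append_eq_append_iff.mp hw with ⟨a, ha1, ha2⟩ | ⟨a, ha1, ha2⟩
            · subst ha1
              refine ⟨u1 ++ ([σ, τ] ++ a), w2, by simp [ha2], ?_⟩
              rw [en_append, en_append, hst2, one_mul, ← en_append]
            · subst ha1
              exact ⟨w1, a ++ ([σ, τ] ++ u2), by simp, rfl⟩
        have := Finset.card_le_card hsub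
        rw [Finset.card_insert_of_notMem (by simpa using hn)] at this
        omega

theorem PathCov.sat (s : D.ι) (lam : Lamp (D.Γ s) Q) : PathCov s lam (4 * Fintype.card (D.Γ s)) := by
  obtain ⟨u, h1, h2, h3⟩ := tour s _ le_rfl
  have hall : ∀ g, Vis s u g := by
    have : Finset.univ.filter (fun g => Vis s u g) = Finset.univ :=
      Finset.eq_univ_of_card _ (le_antisymm (Finset.card_le_univ _) h3)
    intro g
    have := this ▸ Finset.mem_univ g
    exact (Finset.mem_filter.mp this).2
  obtain ⟨u1, u2, hu, hg⟩ := hall lam.g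
  refine ⟨u ++ u1, ?_, fun h _ => (hall h).left _, by rw [en_append, h2, one_mul, hg]⟩
  have : u1.length ≤ u.length := by rw [hu]; simp
  simp; omega

/-- Covering by a subgroup and a path. -/
def CovG (s : D.ι) (f : AA →* D.Γ s) (lam : Lamp (D.Γ s) Q) (p : ℕ) : Prop :=
  ∃ (a0 : AA) (u : List (AA × AA)), u.length ≤ p ∧
    (∀ h, lam.q h ≠ 0 → (∃ α, h = f α) ∨ Vis s u ((f a0)⁻¹ * h)) ∧ lam.g = f a0 * en s u

theorem CovG.mono {s : D.ι} {f : AA →* D.Γ s} {lam : Lamp (D.Γ s) Q} {p p' : ℕ}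
    (h : CovG s f lam p) (hp : p ≤ p') : CovG s f lam p' := by
  obtain ⟨a, u, h1, h2⟩ := h
  exact ⟨a, u, h1.trans hp, h2⟩

theorem PathCov.covG {s : D.ι} (f : AA →* D.Γ s) {lam : Lamp (D.Γ s) Q} {p : ℕ}
    (h : PathCov s lam p) : CovG s f lam p := by
  obtain ⟨u, h1, h2, h3⟩ := h
  exact ⟨1, u, h1, fun h hh => Or.inr (by simpa using h2 h hh), by simp [h3]⟩

theorem CovG.gL {s : D.ι} {f : AA →* D.Γ s} {lam : Lamp (D.Γ s) Q} {p : ℕ}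
    (h : CovG s f lam p) (α : AA) : CovG s f (SE.gL (f α) * lam) p := by
  obtain ⟨a, u, h1, h2, h3⟩ := h
  refine ⟨α * a, u, h1, ?_, by simp [h3, mul_assoc]⟩
  intro h hh
  rcases h2 _ (by simpa using hh) with ⟨β, hβ⟩ | hv
  · left; exact ⟨α * β, by rw [map_mul, ← hβ]; simp⟩
  · right; simpa [mul_assoc] using hv

theorem CovG.cL {s : D.ι} {f : AA →* D.Γ s} {lam : Lamp (D.Γ s) Q} {p : ℕ}
    (h : CovG s f lam p) (γ : Q) : CovG s f (SE.cL γ * lam) p := by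
  obtain ⟨a, u, h1, h2, h3⟩ := h
  refine ⟨a, u, h1, ?_, by simp [h3]⟩
  intro h hh
  by_cases h0 : h = 1
  · left; exact ⟨1, by simp [h0]⟩
  · exact h2 h (by simpa [h0] using hh)

theorem CovG.path {s : D.ι} {f : AA →* D.Γ s} (c : AA → AA × AA) (hc : ∀ α, stp s (c α) = f α)
    {lam : Lamp (D.Γ s) Q} {p : ℕ}
    (h : CovG s f lam p) : PathCov s lam (p + 33) := by
  obtain ⟨a, u, h1, h2, h3⟩ := h
  have hloop : ∀ L : List AA, ∃ v : List (AA × AA), v.length = 2 * L.length ∧ en s v = 1 ∧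
      ∀ α ∈ L, Vis s v (f α) := by
    intro L
    induction L with
    | nil => exact ⟨[], rfl, rfl, by simp⟩
    | cons β L ih =>
      obtain ⟨v, hv1, hv2, hv3⟩ := ih
      have he : en s [c β, c β⁻¹] = 1 := by simp [en, hc]
      refine ⟨[c β, c β⁻¹] ++ v, by simp [hv1]; ring, by rw [en_append, he, hv2, one_mul], ?_⟩
      intro α hα
      rcases List.mem_cons.mp hα with rfl | hα
      · exact ⟨[c α], c α⁻¹ :: v, rfl, by simp [en, hc]⟩
      · have := Vis.right [c β, c β⁻¹] (hv3 α hα)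
        rwa [he, one_mul] at this
  obtain ⟨v, hv1, hv2, hv3⟩ := hloop Finset.univ.toList
  have hlen : v.length = 32 := by
    rw [hv1, Finset.length_toList, Finset.card_univ, card_AA]
  refine ⟨v ++ (c a :: u), by simp; omega, ?_, ?_⟩
  · intro h hh
    rcases h2 h hh with ⟨α, rfl⟩ | hv
    · exact (hv3 α (by simp)).left _
    · have := Vis.right v (Vis.right [c a] hv)
      rw [hv2, one_mul] at this
      simpa [en, hc] using this
  · rw [en_append, hv2, one_mul, en_cons, hc, h3]

theorem CovG.pathA {s : D.ι} {lam : Lamp (D.Γ s) Q} {p : ℕ}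
    (h : CovG s (D.ha s) lam p) : PathCov s lam (p + 33) :=
  h.path (fun α => (α, 1)) (by simp [stp])
theorem CovG.pathB {s : D.ι} {lam : Lamp (D.Γ s) Q} {p : ℕ}
    (h : CovG s (D.hb s) lam p) : PathCov s lam (p + 33) :=
  h.path (fun α => (1, α)) (by simp [stp])

theorem covG_one (s : D.ι) (f : AA →* D.Γ s) : CovG s f (1 : Lamp (D.Γ s) Q) 0 :=
  ⟨1, [], le_rfl, by simp, by simp [en]⟩

end Paths
end SE

namespace SE

set_option linter.unusedSectionVars false
set_option linter.unusedVariables false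
set_option linter.unusedSimpArgs false

/-- Maximal position of the walker. -/
def hiW : List Om → ℤ
  | [] => 0
  | Sum.inl e :: l => max 0 (dir e + hiW l)
  | Sum.inr _ :: l => hiW l
/-- Minimal position of the walker. -/
def loW : List Om → ℤ
  | [] => 0
  | Sum.inl e :: l => min 0 (dir e + loW l)
  | Sum.inr _ :: l => loW l

theorem dir_cases (e : Bool) : dir e = 1 ∨ dir e = -1 := by cases e <;> simp [dir]

theorem hiW_nonneg : ∀ l, 0 ≤ hiW l
  | [] => le_rfl
  | Sum.inl e :: l => le_max_left _ _
  | Sum.inr _ :: l => hiW_nonneg l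
theorem loW_nonpos : ∀ l, loW l ≤ 0
  | [] => le_rfl
  | Sum.inl e :: l => min_le_left _ _
  | Sum.inr _ :: l => loW_nonpos l

/-- Range. -/
def Dl (l : List Om) : ℕ := (hiW l - loW l).toNat

theorem Dl_eq (l : List Om) : (Dl l : ℤ) = hiW l - loW l := by
  unfold Dl; have := hiW_nonneg l; have := loW_nonpos l; omega

theorem Dl_le : ∀ l, Dl l ≤ l.length
  | [] => by simp [Dl, hiW, loW]
  | Sum.inl e :: l => by
    have := Dl_le l
    have h1 := Dl_eq l
    have h2 := Dl_eq (Sum.inl e :: l)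
    have h3 := hiW_nonneg l
    have h4 := loW_nonpos l
    simp only [hiW, loW] at h2
    rcases dir_cases e with h | h <;> rw [h] at h2 <;> simp only [List.length_cons] <;> omega
  | Sum.inr _ :: l => by
    have := Dl_le l
    simp only [List.length_cons]
    have : Dl (Sum.inr ‹_› :: l) = Dl l := rfl
    omega

section Det
variable {D : Sys} {Q : Type} [CommRing Q]

variable (Q) in
/-- Accumulated lamp increments. -/
noncomputable def q0 : List Om → ℤ → Q
  | [], _ => 0
  | Sum.inl e :: l, x => q0 l (x - dir e)
  | Sum.inr (Sum.inl _) :: l, x => q0 l x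
  | Sum.inr (Sum.inr (Sum.inl _)) :: l, x => q0 l x
  | Sum.inr (Sum.inr (Sum.inr e)) :: l, x => (if x = 0 then xi Q e else 0) + q0 l x
noncomputable def al0 : List Om → ℤ → AA
  | [], _ => 1
  | Sum.inl e :: l, x => al0 l (x - dir e)
  | Sum.inr (Sum.inl α) :: l, x => (if x = 0 then α else 1) * al0 l x
  | Sum.inr (Sum.inr _) :: l, x => al0 l x
noncomputable def be0 : List Om → ℤ → AA
  | [], _ => 1
  | Sum.inl e :: l, x => be0 l (x - dir e)
  | Sum.inr (Sum.inl _) :: l, x => be0 l x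
  | Sum.inr (Sum.inr (Sum.inl α)) :: l, x => (if x = 0 then α else 1) * be0 l x
  | Sum.inr (Sum.inr (Sum.inr _)) :: l, x => be0 l x

theorem q0_out : ∀ (l : List Om) (x : ℤ), ¬ (loW l ≤ x ∧ x ≤ hiW l) → q0 Q l x = 0
  | [], x, _ => rfl
  | Sum.inl e :: l, x, h => by
    simp only [hiW, loW] at h
    exact q0_out l _ (by omega)
  | Sum.inr (Sum.inl _) :: l, x, h => q0_out l x h
  | Sum.inr (Sum.inr (Sum.inl _)) :: l, x, h => q0_out l x h
  | Sum.inr (Sum.inr (Sum.inr e)) :: l, x, h => by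
    have h1 := hiW_nonneg l
    have h2 := loW_nonpos l
    simp only [hiW, loW] at h
    simp only [q0]
    rw [q0_out l x h, if_neg (by omega), add_zero]
theorem al0_out : ∀ (l : List Om) (x : ℤ), ¬ (loW l ≤ x ∧ x ≤ hiW l) → al0 l x = 1
  | [], x, _ => rfl
  | Sum.inl e :: l, x, h => by
    simp only [hiW, loW] at h
    exact al0_out l _ (by omega)
  | Sum.inr (Sum.inl α) :: l, x, h => by
    have h1 := hiW_nonneg l
    have h2 := loW_nonpos l
    simp only [hiW, loW] at h
    simp only [al0]
    rw [al0_out l x h, if_neg (by omega), mul_one]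
  | Sum.inr (Sum.inr _) :: l, x, h => al0_out l x h
theorem be0_out : ∀ (l : List Om) (x : ℤ), ¬ (loW l ≤ x ∧ x ≤ hiW l) → be0 l x = 1
  | [], x, _ => rfl
  | Sum.inl e :: l, x, h => by
    simp only [hiW, loW] at h
    exact be0_out l _ (by omega)
  | Sum.inr (Sum.inl α) :: l, x, h => be0_out l x h
  | Sum.inr (Sum.inr (Sum.inl α)) :: l, x, h => by
    have h1 := hiW_nonneg l
    have h2 := loW_nonpos l
    simp only [hiW, loW] at h
    simp only [be0]
    rw [be0_out l x h, if_neg (by omega), mul_one]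
  | Sum.inr (Sum.inr (Sum.inr _)) :: l, x, h => be0_out l x h

theorem XX_z_mem : ∀ l, loW l ≤ (XX D Q l).z ∧ (XX D Q l).z ≤ hiW l
  | [] => by rw [XX_nil]; simp [loW, hiW]
  | Sum.inl e :: l => by
    have := XX_z_mem l
    rw [XX_cons]; simp only [val, Hg.mul_z, tt_z, loW, hiW]; omega
  | Sum.inr (Sum.inl α) :: l => by
    have := XX_z_mem l
    rw [XX_cons]; simp only [val, Hg.mul_z, hA_z, loW, hiW]; omega
  | Sum.inr (Sum.inr (Sum.inl α)) :: l => by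
    have := XX_z_mem l
    rw [XX_cons]; simp only [val, Hg.mul_z, hB_z, loW, hiW]; omega
  | Sum.inr (Sum.inr (Sum.inr e)) :: l => by
    have := XX_z_mem l
    rw [XX_cons]; simp only [val, Hg.mul_z, hC_z, loW, hiW]; omega

theorem XX_tot (s : D.ι) : ∀ (l : List Om) (x : ℤ), ∑ h, ((XX D Q l).φ s x).q h = q0 Q l x
  | [], x => by rw [XX_nil]; simp [q0]
  | Sum.inl e :: l, x => by rw [XX_t, XX_tot]; rfl
  | Sum.inr (Sum.inl α) :: l, x => by rw [XX_a, Lamp.tot_mul, XX_tot]; simp [q0]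
  | Sum.inr (Sum.inr (Sum.inl α)) :: l, x => by rw [XX_b, Lamp.tot_mul, XX_tot]; simp [q0]
  | Sum.inr (Sum.inr (Sum.inr e)) :: l, x => by rw [XX_c, Lamp.tot_mul, XX_tot]; simp [q0]

theorem XX_pA (s : D.ι) : ∀ (l : List Om) (x : ℤ), D.pA s ((XX D Q l).φ s x).g = al0 l (x - D.k s)
  | [], x => by rw [XX_nil]; simp [al0]
  | Sum.inl e :: l, x => by rw [XX_t, XX_pA]; simp only [al0]; congr 1; ring
  | Sum.inr (Sum.inl α) :: l, x => by
    rw [XX_a, Lamp.mul_g, map_mul, XX_pA]; simp [al0, D.pAa, sub_eq_zero]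
  | Sum.inr (Sum.inr (Sum.inl α)) :: l, x => by
    rw [XX_b, Lamp.mul_g, map_mul, XX_pA]; simp [al0, D.pAb]
  | Sum.inr (Sum.inr (Sum.inr e)) :: l, x => by
    rw [XX_c, Lamp.mul_g, map_mul, XX_pA]; simp [al0]

theorem XX_pB (s : D.ι) : ∀ (l : List Om) (x : ℤ), D.pB s ((XX D Q l).φ s x).g = be0 l (x + D.k s)
  | [], x => by rw [XX_nil]; simp [be0]
  | Sum.inl e :: l, x => by rw [XX_t, XX_pB]; simp only [be0]; congr 1; ring
  | Sum.inr (Sum.inl α) :: l, x => by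
    rw [XX_a, Lamp.mul_g, map_mul, XX_pB]; simp [be0, D.pBa]
  | Sum.inr (Sum.inr (Sum.inl α)) :: l, x => by
    rw [XX_b, Lamp.mul_g, map_mul, XX_pB]; simp [be0, D.pBb, add_eq_zero_iff_eq_neg]
  | Sum.inr (Sum.inr (Sum.inr e)) :: l, x => by
    rw [XX_c, Lamp.mul_g, map_mul, XX_pB]; simp [be0]

theorem XX_out (s : D.ι) : ∀ (l : List Om) (x : ℤ),
    ¬ (loW l - D.k s ≤ x ∧ x ≤ hiW l + D.k s) → (XX D Q l).φ s x = 1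
  | [], x, _ => by rw [XX_nil]; rfl
  | Sum.inl e :: l, x, h => by
    simp only [hiW, loW] at h
    rw [XX_t, XX_out s l _ (by omega)]
  | Sum.inr (Sum.inl α) :: l, x, h => by
    have h1 := hiW_nonneg l
    have h2 := loW_nonpos l
    have := D.k_pos s
    simp only [hiW, loW] at h
    rw [XX_a, XX_out s l _ h, if_neg (by omega)]; simp
  | Sum.inr (Sum.inr (Sum.inl α)) :: l, x, h => by
    have h1 := hiW_nonneg l
    have h2 := loW_nonpos l
    have := D.k_pos s
    simp only [hiW, loW] at h
    rw [XX_b, XX_out s l _ h, if_neg (by omega)]; simp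
  | Sum.inr (Sum.inr (Sum.inr e)) :: l, x, h => by
    have h1 := hiW_nonneg l
    have h2 := loW_nonpos l
    have := D.k_pos s
    simp only [hiW, loW] at h
    rw [XX_c, XX_out s l _ h, if_neg (by omega)]; simp

theorem XX_q_out (s : D.ι) : ∀ (l : List Om) (x : ℤ) (h : D.Γ s),
    ¬ (loW l ≤ x ∧ x ≤ hiW l) → ((XX D Q l).φ s x).q h = 0
  | [], x, _, _ => by rw [XX_nil]; rfl
  | Sum.inl e :: l, x, g, h => by
    simp only [hiW, loW] at h
    rw [XX_t, XX_q_out s l _ _ (by omega)]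
  | Sum.inr (Sum.inl α) :: l, x, g, h => by
    rw [XX_a]; simp; exact XX_q_out s l x _ h
  | Sum.inr (Sum.inr (Sum.inl α)) :: l, x, g, h => by
    rw [XX_b]; simp; exact XX_q_out s l x _ h
  | Sum.inr (Sum.inr (Sum.inr e)) :: l, x, g, h => by
    have h1 := hiW_nonneg l
    have h2 := loW_nonpos l
    simp only [hiW, loW] at h
    rw [XX_c, if_neg (by omega)]; simp; exact XX_q_out s l x _ h

theorem XX_inactive (s : D.ι) : ∀ (l : List Om) (x : ℤ), hiW l - loW l < D.k s →
    (XX D Q l).φ s x = cL (q0 Q l x) * gL (D.ha s (al0 l (x - D.k s)))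
      * gL (D.hb s (be0 l (x + D.k s)))
  | [], x, _ => by rw [XX_nil]; simp [q0, al0, be0]
  | Sum.inl e :: l, x, h => by
    simp only [hiW, loW] at h
    have h1 := hiW_nonneg l
    have h2 := loW_nonpos l
    rw [XX_t, XX_inactive s l _ (by rcases dir_cases e with h | h <;> omega)]
    simp only [q0, al0, be0]
    rw [show x - dir e - D.k s = x - D.k s - dir e by ring,
      show x - dir e + D.k s = x + D.k s - dir e by ring]
  | Sum.inr (Sum.inl α) :: l, x, h => by
    simp only [hiW, loW] at h
    have h1 := hiW_nonneg l
    have h2 := loW_nonpos l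
    rw [XX_a, XX_inactive s l _ h]
    simp only [q0, al0, be0, sub_eq_zero]
    by_cases hx : x = D.k s
    · rw [if_pos hx, q0_out l x (by omega), be0_out l (x + D.k s) (by omega)]
      simp [gL_mul]
    · simp [hx]
  | Sum.inr (Sum.inr (Sum.inl α)) :: l, x, h => by
    simp only [hiW, loW] at h
    have h1 := hiW_nonneg l
    have h2 := loW_nonpos l
    rw [XX_b, XX_inactive s l _ h]
    simp only [q0, al0, be0, add_eq_zero_iff_eq_neg]
    by_cases hx : x = - D.k s
    · rw [if_pos hx, q0_out l x (by omega), al0_out l (x - D.k s) (by omega)]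
      simp [gL_mul]
    · simp [hx]
  | Sum.inr (Sum.inr (Sum.inr e)) :: l, x, h => by
    simp only [hiW, loW] at h
    rw [XX_c, XX_inactive s l _ h]
    simp only [q0, al0, be0, cL_add, mul_assoc]

/-- Next boundary reached: `some false` for the left one, `some true` for the right one. -/
def nx (k : ℤ) : ℤ → List Om → Option Bool
  | u, [] => if 0 ≤ u then some false else if u ≤ -k then some true else none
  | u, Sum.inl e :: l => if 0 ≤ u then some false else if u ≤ -k then some true else nx k (u - dir e) l
  | u, Sum.inr _ :: l => nx k u l

theorem nx_lo (k : ℤ) : ∀ (u : ℤ) (l : List Om), 0 ≤ u → nx k u l = some false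
  | u, [], h => by simp [nx, h]
  | u, Sum.inl e :: l, h => by simp [nx, h]
  | u, Sum.inr _ :: l, h => nx_lo k u l h
theorem nx_hi (k : ℤ) (hk : 0 < k) : ∀ (u : ℤ) (l : List Om), u ≤ -k → nx k u l = some true
  | u, [], h => by simp [nx, h]; omega
  | u, Sum.inl e :: l, h => by simp [nx, h]; omega
  | u, Sum.inr _ :: l, h => nx_hi k hk u l h

def alt (k : ℤ) : ℤ → List Om → ℕ
  | u, [] => 0
  | u, Sum.inl e :: l => alt k (u - dir e) l +
      if nx k u (Sum.inl e :: l) ≠ nx k (u - dir e) l ∧ nx k (u - dir e) l ≠ none then 1 else 0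
  | u, Sum.inr _ :: l => alt k u l

def Alt (k : ℤ) : List Om → ℕ
  | [] => 0
  | Sum.inl e :: l => Alt k l + ((if e = true ∧ nx k (-1) l = some true then 1 else 0)
      + (if e = false ∧ nx k (1 - k) l = some false then 1 else 0))
  | Sum.inr _ :: l => Alt k l

theorem alt_sum (k : ℤ) (hk : 0 < k) : ∀ (l : List Om) (U : Finset ℤ), ∑ u ∈ U, alt k u l ≤ Alt k l
  | [], U => by simp [alt, Alt]
  | Sum.inr _ :: l, U => alt_sum k hk l U
  | Sum.inl e :: l, U => by
    simp only [alt, Alt, Finset.sum_add_distrib]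
    refine add_le_add ?_ ?_
    · have := alt_sum k hk l (U.image (fun u => u - dir e))
      rwa [Finset.sum_image (fun a _ b _ h => by simpa using h)] at this
    · have key : ∀ u : ℤ, (if nx k u (Sum.inl e :: l) ≠ nx k (u - dir e) l ∧
          nx k (u - dir e) l ≠ none then 1 else 0) ≤
          (if u = 0 then (if e = true ∧ nx k (-1) l = some true then 1 else 0) else 0)
          + (if u = -k then (if e = false ∧ nx k (1 - k) l = some false then 1 else 0) else 0) := by
        intro u
        by_cases h : nx k u (Sum.inl e :: l) ≠ nx k (u - dir e) l ∧ nx k (u - dir e) l ≠ none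
        · rw [if_pos h]
          obtain ⟨h1, h2⟩ := h
          by_cases hu : 0 ≤ u
          · rw [nx_lo k u _ hu] at h1
            have hv : ¬ 0 ≤ u - dir e := fun h => h1 (nx_lo k _ _ h).symm
            have he : dir e = 1 := by rcases dir_cases e with h | h <;> omega
            have hu0 : u = 0 := by omega
            have he' : e = true := by cases e <;> simp [dir] at he ⊢
            subst hu0
            rw [he] at h1 h2
            have : nx k (-1) l = some true := by
              simp at h1 h2
              cases h : nx k (-1) l with
              | none => exact absurd h h2
              | some b => cases b <;> simp_all
            simp [he', this]
          · by_cases hu2 : u ≤ -k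
            · rw [nx_hi k hk u _ hu2] at h1
              have hv : ¬ u - dir e ≤ -k := fun h => h1 (nx_hi k hk _ _ h).symm
              have he : dir e = -1 := by rcases dir_cases e with h | h <;> omega
              have hu0 : u = -k := by omega
              have he' : e = false := by cases e <;> simp [dir] at he ⊢
              subst hu0
              rw [he] at h1 h2
              have : nx k (1 - k) l = some false := by
                rw [show -k - -1 = 1 - k by ring] at h1 h2
                cases h : nx k (1 - k) l with
                | none => exact absurd h h2
                | some b => cases b <;> simp_all
              simp [he', this]
            · exact absurd (by simp [nx, hu, hu2]) h1
        · rw [if_neg h]; exact Nat.zero_le _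
      refine (Finset.sum_le_sum fun u _ => key u).trans ?_
      rw [Finset.sum_add_distrib, Finset.sum_ite_eq', Finset.sum_ite_eq']
      gcongr <;> split_ifs <;> simp

theorem cov_main (s : D.ι) : ∀ (l : List Om) (u x : ℤ), u ≤ x → x ≤ u + D.k s →
    (nx (D.k s) u l ≠ some true → CovG s (D.ha s) ((XX D Q l).φ s x) (33 * alt (D.k s) u l)) ∧
    (nx (D.k s) u l ≠ some false → CovG s (D.hb s) ((XX D Q l).φ s x) (33 * alt (D.k s) u l))
  | [], u, x, h1, h2 => by
    rw [XX_nil]; exact ⟨fun _ => covG_one _ _, fun _ => covG_one _ _⟩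
  | Sum.inl e :: l, u, x, h1, h2 => by
    rw [XX_t]
    have hk := D.k_pos s
    obtain ⟨ihA, ihB⟩ := cov_main s l (u - dir e) (x - dir e) (by omega) (by omega)
    set k := D.k s
    have hnn : nx k u (Sum.inl e :: l) = none → nx k (u - dir e) l = none := by
      intro h; simp only [nx] at h; split_ifs at h; exact h
    constructor
    · intro h
      by_cases ht : nx k (u - dir e) l = some true
      · have hc := (ihB (by simp [ht])).pathB.covG (D.ha s)
        refine hc.mono ?_
        simp only [alt]
        rw [if_pos ⟨by rw [ht]; exact h, by simp [ht]⟩]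
        omega
      · exact (ihA ht).mono (by simp only [alt]; omega)
    · intro h
      by_cases ht : nx k (u - dir e) l = some false
      · have hc := (ihA (by simp [ht])).pathA.covG (D.hb s)
        refine hc.mono ?_
        simp only [alt]
        rw [if_pos ⟨by rw [ht]; exact h, by simp [ht]⟩]
        omega
      · exact (ihB ht).mono (by simp only [alt]; omega)
  | Sum.inr (Sum.inl α) :: l, u, x, h1, h2 => by
    obtain ⟨ihA, ihB⟩ := cov_main s l u x h1 h2
    rw [XX_a]
    refine ⟨fun h => (ihA h).gL _, fun h => ?_⟩
    have : x ≠ D.k s := by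
      intro hx
      exact h (nx_lo _ u _ (by omega))
    rw [if_neg this, map_one, gL_one, one_mul]; exact ihB h
  | Sum.inr (Sum.inr (Sum.inl α)) :: l, u, x, h1, h2 => by
    obtain ⟨ihA, ihB⟩ := cov_main s l u x h1 h2
    rw [XX_b]
    refine ⟨fun h => ?_, fun h => (ihB h).gL _⟩
    have : x ≠ - D.k s := by
      intro hx
      have hk := D.k_pos s
      exact h (nx_hi _ (by omega) u _ (by omega))
    rw [if_neg this, map_one, gL_one, one_mul]; exact ihA h
  | Sum.inr (Sum.inr (Sum.inr e)) :: l, u, x, h1, h2 => by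
    obtain ⟨ihA, ihB⟩ := cov_main s l u x h1 h2
    rw [XX_c]
    exact ⟨fun h => (ihA h).cL _, fun h => (ihB h).cL _⟩

theorem pathCov_alt (s : D.ι) (l : List Om) (u x : ℤ) (h1 : u ≤ x) (h2 : x ≤ u + D.k s) :
    PathCov s ((XX D Q l).φ s x) (33 * alt (D.k s) u l + 33) := by
  obtain ⟨hA, hB⟩ := cov_main (Q := Q) s l u x h1 h2
  by_cases h : nx (D.k s) u l = some true
  · exact (hB (by simp [h])).pathB
  · exact (hA h).pathA

end Det
end SE

namespace SE

set_option linter.unusedSectionVars false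
set_option linter.unusedVariables false
set_option linter.unusedSimpArgs false

section ReachX
variable {D : Sys} {Q : Type} [CommRing Q]

/-- Commutator correction at coordinate `s`. -/
noncomputable def kap (s : D.ι) (l : List Om) (x : ℤ) : Lamp (D.Γ s) Q :=
  (XX D Q l).φ s x * (cL (q0 Q l x) * gL (D.ha s (al0 l (x - D.k s)))
      * gL (D.hb s (be0 l (x + D.k s))))⁻¹

theorem kap_eq (s : D.ι) (l : List Om) (x : ℤ) : (kap s l x : Lamp (D.Γ s) Q) =
    (XX D Q l).φ s x * gL (stp s (1, (be0 l (x + D.k s))⁻¹)) * gL (stp s ((al0 l (x - D.k s))⁻¹, 1))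
      * cL (-(q0 Q l x)) := by
  simp only [kap, mul_inv_rev, stp, map_one, one_mul, mul_one, map_inv, gL_inv, cL_neg, mul_assoc]

theorem kap_out (s : D.ι) (l : List Om) (x : ℤ) (h : ¬ (loW l - D.k s ≤ x ∧ x ≤ hiW l + D.k s)) :
    (kap s l x : Lamp (D.Γ s) Q) = 1 := by
  have hk := D.k_pos s
  rw [kap, XX_out s l x h, q0_out l x (by omega), al0_out l _ (by omega), be0_out l _ (by omega)]
  simp

theorem kap_inactive (s : D.ι) (l : List Om) (x : ℤ) (h : hiW l - loW l < D.k s) :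
    (kap s l x : Lamp (D.Γ s) Q) = 1 := by
  rw [kap, XX_inactive s l x h, mul_inv_cancel]

theorem kap_tot (s : D.ι) (l : List Om) (x : ℤ) : ∑ h, (kap s l x : Lamp (D.Γ s) Q).q h = 0 := by
  rw [kap_eq, Lamp.tot_mul, Lamp.tot_mul, Lamp.tot_mul, XX_tot]; simp

theorem kap_pA (s : D.ι) (l : List Om) (x : ℤ) : D.pA s (kap s l x : Lamp (D.Γ s) Q).g = 1 := by
  rw [kap_eq]; simp [XX_pA, stp, D.pAa, D.pAb]
theorem kap_pB (s : D.ι) (l : List Om) (x : ℤ) : D.pB s (kap s l x : Lamp (D.Γ s) Q).g = 1 := by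
  rw [kap_eq]; simp [XX_pB, stp, D.pBa, D.pBb]

theorem kap_path {s : D.ι} {l : List Om} {x : ℤ} {p : ℕ} (h : PathCov s ((XX D Q l).φ s x) p) :
    PathCov s (kap s l x : Lamp (D.Γ s) Q) (p + 2) := by
  rw [kap_eq]; exact ((h.mul_gL _).mul_gL _).mul_cL _

variable {S : Set (Hg D Q)} {w : Q → ℕ}

theorem Cost.wsum (hS : Cost S w) {α : Type} (T : Finset α) (f : α → Q) :
    w (∑ i ∈ T, f i) ≤ ∑ i ∈ T, w (f i) := by
  induction T using Finset.induction_on with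
  | empty => simp [hS.w0]
  | insert a T ha ih =>
    rw [Finset.sum_insert ha, Finset.sum_insert ha]
    exact (hS.wadd _ _).trans (by omega)

theorem Cost.kap_w (hS : Cost S w) (s : D.ι) (l : List Om) (x : ℤ) :
    ∑ h, w ((kap s l x : Lamp (D.Γ s) Q).q h) ≤ 2 * ∑ h, w (((XX D Q l).φ s x).q h) := by
  have h1 : w (q0 Q l x) ≤ ∑ h, w (((XX D Q l).φ s x).q h) := by
    rw [← XX_tot s]; exact hS.wsum _ _
  set g0 := (D.hb s (be0 l (x + D.k s)))⁻¹ with hg0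
  set g1 := (D.ha s (al0 l (x - D.k s)))⁻¹ with hg1
  have h2 : ∀ h, w ((kap s l x : Lamp (D.Γ s) Q).q h) ≤ w (((XX D Q l).φ s x).q h)
      + if h = ((XX D Q l).φ s x).g * g0 * g1 then w (q0 Q l x) else 0 := by
    intro h
    rw [kap_eq]
    simp only [Lamp.mul_q, gL_q, add_zero, cL_q, Lamp.mul_g, gL_g, stp, map_one, one_mul, mul_one,
      map_inv, ← hg0, ← hg1]
    refine (hS.wadd _ _).trans (add_le_add le_rfl ?_)
    rw [inv_mul_eq_one]
    by_cases hh : h = ((XX D Q l).φ s x).g * g0 * g1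
    · rw [if_pos hh.symm, if_pos hh, hS.wneg]
    · rw [if_neg (fun h => hh h.symm), hS.w0]; exact Nat.zero_le _
  refine (Finset.sum_le_sum fun h _ => h2 h).trans ?_
  rw [Finset.sum_add_distrib, Finset.sum_ite_eq' Finset.univ]
  simp; omega

/-- Lamp weight in coordinate `s`. -/
noncomputable def Wt (w : Q → ℕ) (s : D.ι) (l : List Om) : ℕ :=
  ∑ x ∈ Finset.Icc (loW l) (hiW l), ∑ h, w (((XX D Q l).φ s x).q h)

theorem Cost.Wt_sum (hS : Cost S w) (s : D.ι) (l : List Om) (U : Finset ℤ) :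
    ∑ x ∈ U, ∑ h, w ((kap s l x : Lamp (D.Γ s) Q).q h) ≤ 2 * Wt (Q := Q) w s l := by
  refine (Finset.sum_le_sum fun x _ => hS.kap_w s l x).trans ?_
  rw [← Finset.mul_sum]
  refine Nat.mul_le_mul_left _ ?_
  unfold Wt
  rw [← Finset.sum_filter_add_sum_filter_not U (fun x => x ∈ Finset.Icc (loW l) (hiW l))]
  have : ∑ x ∈ U.filter (fun x => ¬ x ∈ Finset.Icc (loW l) (hiW l)),
      ∑ h, w (((XX D Q l).φ s x).q h) = 0 := by
    refine Finset.sum_eq_zero fun x hx => Finset.sum_eq_zero fun h _ => ?_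
    rw [XX_q_out s l x h (by simpa using (Finset.mem_filter.mp hx).2), hS.w0]
  rw [this, add_zero]
  exact Finset.sum_le_sum_of_subset (fun x hx => (Finset.mem_filter.mp hx).2)

theorem Cost.kap_reach (hS : Cost S w) (s : D.ι) (l : List Om) (hact : D.k s ≤ Dl l)
    (N : ℕ) (hN : N = (Dl l + 4 * D.b s) / D.b s + 1) (p : ℕ → ℕ)
    (hp : ∀ j < N, ∀ x : ℤ, loW l - D.k s + j * D.b s ≤ x → x < loW l - D.k s + j * D.b s + D.b s →
      PathCov s ((XX D Q l).φ s x) (p j)) :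
    Reach S (el s (kap s l)) (12 * Dl l + 2 * Wt (Q := Q) w s l
      + 16 * D.b s * ∑ j ∈ Finset.range N, (p j + 3)) := by
  have hb := D.b_pos s
  have hk : D.k s = 2 * (D.b s : ℤ) := rfl
  have hD := Dl_eq l
  have h1 := hiW_nonneg l
  have h2 := loW_nonpos l
  have hNb1 : Dl l + 4 * D.b s < N * D.b s := by
    rw [hN]
    have := Nat.lt_div_mul_add (a := Dl l + 4 * D.b s) (b := D.b s) hb
    rw [add_mul, one_mul]; omega
  have hNb2 : N * D.b s ≤ Dl l + 5 * D.b s := by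
    rw [hN, add_mul, one_mul]
    have := Nat.div_mul_le_self (Dl l + 4 * D.b s) (D.b s)
    omega
  set x0 := loW l - D.k s with hx0
  have hbl : ∀ j < N, Reach S (el s (fun x => if 0 ≤ x ∧ x < (D.b s : ℤ)
      then kap (Q := Q) s l (x + j * D.b s + x0) else 1))
      (16 * D.b s * (p j + 3) + ∑ x ∈ Finset.range (D.b s),
        ∑ h, w ((kap s l (x + j * D.b s + x0) : Lamp (D.Γ s) Q).q h)) := by
    intro j hj
    refine hS.block s _ (fun x hx => if_neg hx) ?_ ?_ ?_ (p j + 3)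
      (fun x => ∑ h, w ((kap s l (x + j * D.b s + x0) : Lamp (D.Γ s) Q).q h)) ?_
    · intro x; split_ifs
      · exact kap_tot _ _ _
      · simp
    · intro x; split_ifs
      · exact kap_pA _ _ _
      · simp
    · intro x; split_ifs
      · exact kap_pB _ _ _
      · simp
    · intro x hx1 hx2
      rw [if_pos ⟨hx1, hx2⟩]
      exact (kap_path (hp j hj _ (by omega) (by omega))).prog hS.w0
  have hch := hS.chain s (D.b s) N (fun x => kap (Q := Q) s l (x + x0)) _
    (fun x hx => kap_out s l _ (by
      have : ((N * D.b s : ℕ) : ℤ) = N * D.b s := by push_cast; ring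
      rw [← this] at hx
      omega)) hbl
  have := hS.conj x0 hch
  rw [conj_el] at this
  refine this.mono ?_
  rw [Finset.sum_add_distrib, ← Finset.mul_sum]
  have hW : ∑ j ∈ Finset.range N, ∑ x ∈ Finset.range (D.b s),
      ∑ h, w ((kap s l (x + j * D.b s + x0) : Lamp (D.Γ s) Q).q h) ≤ 2 * Wt (Q := Q) w s l := by
    have hinj : Set.InjOn (fun y : ℕ × ℕ => ((y.2 : ℤ) + y.1 * D.b s + x0))
        (Finset.range N ×ˢ Finset.range (D.b s) : Finset (ℕ × ℕ)) := by
      rintro ⟨j, x⟩ h1 ⟨j', x'⟩ h2 h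
      simp at h1 h2 h
      have h' : x + j * D.b s = x' + j' * D.b s := by exact_mod_cast h
      have e1 : (x + j * D.b s) / D.b s = j := by
        rw [Nat.add_mul_div_right _ _ hb, Nat.div_eq_of_lt h1.2, zero_add]
      have e2 : (x' + j' * D.b s) / D.b s = j' := by
        rw [Nat.add_mul_div_right _ _ hb, Nat.div_eq_of_lt h2.2, zero_add]
      have : j = j' := by rw [← e1, ← e2, h']
      subst this
      simp at h'
      rw [h']
    have := hS.Wt_sum s l ((Finset.range N ×ˢ Finset.range (D.b s)).image
      (fun y : ℕ × ℕ => ((y.2 : ℤ) + y.1 * D.b s + x0)))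
    rw [Finset.sum_image hinj, Finset.sum_product] at this
    exact this
  omega

theorem Cost.kap_sat (hS : Cost S w) (s : D.ι) (l : List Om) (hact : D.k s ≤ Dl l) :
    Reach S (el s (kap s l)) (2400 * (Fintype.card (D.Γ s) * Dl l) + 2 * Wt (Q := Q) w s l) := by
  have hk : D.k s = 2 * (D.b s : ℤ) := rfl
  refine (hS.kap_reach s l hact _ rfl (fun _ => 4 * Fintype.card (D.Γ s))
    (fun j _ x _ _ => PathCov.sat s _)).mono ?_
  rw [Finset.sum_const, Finset.card_range, smul_eq_mul]
  have hb := D.b_pos s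
  set N := (Dl l + 4 * D.b s) / D.b s + 1 with hN
  have hNb2 : N * D.b s ≤ Dl l + 5 * D.b s := by
    rw [hN, add_mul, one_mul]
    have := Nat.div_mul_le_self (Dl l + 4 * D.b s) (D.b s)
    omega
  have hNb3 : N * D.b s ≤ 4 * Dl l := by omega
  have hc : 1 ≤ Fintype.card (D.Γ s) := Fintype.card_pos
  set c := Fintype.card (D.Γ s)
  have e : 16 * D.b s * (N * (4 * c + 3)) = 16 * (N * D.b s) * (4 * c + 3) := by ring
  have e2 : 16 * (N * D.b s) * (4 * c + 3) ≤ 16 * (4 * Dl l) * (7 * c) := by gcongr; omega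
  have e3 : 16 * (4 * Dl l) * (7 * c) = 448 * (c * Dl l) := by ring
  have e4 : 1 * Dl l ≤ c * Dl l := by gcongr
  omega

theorem Cost.kap_unsat (hS : Cost S w) (s : D.ι) (l : List Om) (hact : D.k s ≤ Dl l) :
    Reach S (el s (kap s l)) (2400 * (Dl l + Alt (D.k s) l) + 2 * Wt (Q := Q) w s l) := by
  have hk : D.k s = 2 * (D.b s : ℤ) := rfl
  have hb := D.b_pos s
  have hu : ∀ j : ℕ, ∃ u : ℤ, loW l - D.k s + j * D.b s - D.b s ≤ u ∧ u < loW l - D.k s + j * D.b s ∧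
      D.b s * alt (D.k s) u l ≤ ∑ v ∈ Finset.Ico (loW l - D.k s + j * D.b s - D.b s)
        (loW l - D.k s + j * D.b s), alt (D.k s) v l := by
    intro j
    set y := loW l - D.k s + j * D.b s
    obtain ⟨u, hu, hmin⟩ := Finset.exists_min_image (Finset.Ico (y - D.b s) y)
      (fun u => alt (D.k s) u l) ⟨y - 1, by simp; omega⟩
    rw [Finset.mem_Ico] at hu
    refine ⟨u, hu.1, hu.2, ?_⟩
    have := Finset.card_nsmul_le_sum _ _ _ hmin
    rw [Int.card_Ico, smul_eq_mul, show (y - (y - (D.b s : ℤ))).toNat = D.b s by omega] at this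
    exact this
  choose u hu1 hu2 hu3 using hu
  refine (hS.kap_reach s l hact _ rfl (fun j => 33 * alt (D.k s) (u j) l + 33)
    (fun j _ x hx1 hx2 => pathCov_alt s l (u j) x (by have := hu2 j; omega)
      (by have := hu1 j; omega))).mono ?_
  set N := (Dl l + 4 * D.b s) / D.b s + 1 with hN
  have hNb2 : N * D.b s ≤ Dl l + 5 * D.b s := by
    rw [hN, add_mul, one_mul]
    have := Nat.div_mul_le_self (Dl l + 4 * D.b s) (D.b s)
    omega
  have hNb3 : N * D.b s ≤ 4 * Dl l := by omega
  have hA : ∑ j ∈ Finset.range N, D.b s * alt (D.k s) (u j) l ≤ Alt (D.k s) l := by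
    refine (Finset.sum_le_sum fun j _ => hu3 j).trans ?_
    rw [← Finset.sum_biUnion]
    · exact alt_sum _ (by omega) l _
    · intro i _ j _ hij
      rw [Function.onFun, Finset.disjoint_left]
      intro v h1 h2
      rw [Finset.mem_Ico] at h1 h2
      rcases lt_or_gt_of_ne hij with h | h
      · have : ((i : ℤ) + 1) * D.b s ≤ j * D.b s := by gcongr; exact_mod_cast h
        rw [add_mul, one_mul] at this
        omega
      · have : ((j : ℤ) + 1) * D.b s ≤ i * D.b s := by gcongr; exact_mod_cast h
        rw [add_mul, one_mul] at this
        omega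
  have e : 16 * D.b s * ∑ j ∈ Finset.range N, (33 * alt (D.k s) (u j) l + 33 + 3)
      = 528 * ∑ j ∈ Finset.range N, D.b s * alt (D.k s) (u j) l + 576 * (N * D.b s) := by
    rw [Finset.mul_sum, Finset.mul_sum]
    have : ∀ j, 16 * D.b s * (33 * alt (D.k s) (u j) l + 33 + 3)
      = 528 * (D.b s * alt (D.k s) (u j) l) + 576 * D.b s := fun j => by ring
    simp only [this, Finset.sum_add_distrib, Finset.sum_const, Finset.card_range, smul_eq_mul]
    ring
  omega

theorem Cost.kap_min (hS : Cost S w) (s : D.ι) (l : List Om) (hact : D.k s ≤ Dl l) :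
    Reach S (el s (kap s l)) (2400 * (min (Dl l + Alt (D.k s) l) (Fintype.card (D.Γ s) * Dl l))
      + 2 * Wt (Q := Q) w s l) := by
  rcases min_choice (Dl l + Alt (D.k s) l) (Fintype.card (D.Γ s) * Dl l) with h | h <;> rw [h]
  · exact hS.kap_unsat s l hact
  · exact hS.kap_sat s l hact

theorem Cost.prodA (T : ∀ s : D.ι, ℤ → Lamp (D.Γ s) Q) (c : D.ι → ℕ) (A : Finset D.ι)
    (h : ∀ s ∈ A, Reach S (el s (T s)) (c s)) :
    Reach S (⟨fun s x => if s ∈ A then T s x else 1, 0⟩ : Hg D Q) (∑ s ∈ A, c s) := by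
  induction A using Finset.induction_on with
  | empty => simp; exact Reach.one
  | insert a A ha ih =>
    rw [Finset.sum_insert ha]
    have := (h a (by simp)).mul (ih fun s hs => h s (by simp [hs]))
    convert this using 1
    apply Hg.ext'
    · intro s x
      by_cases hs : s = a
      · subst hs; simp [el_same, ha]
      · simp [el_other hs, hs]
    · simp

theorem Cost.W0 (hS : Cost S w) (l : List Om) :
    Reach S (hC D (q0 Q l) * hA Q D (al0 l) * hB Q D (be0 l) * SE.tt D Q (XX D Q l).z)
      (15 * (Dl l + 1) + ∑ x ∈ Finset.Icc (loW l) (hiW l), w (q0 Q l x)) := by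
  have hD := Dl_eq l
  have h1 := hiW_nonneg l
  have h2 := loW_nonpos l
  have hz := XX_z_mem (D := D) (Q := Q) l
  have a1 := hS.sweepC' (loW l) (Dl l + 1) (q0 Q l) (fun x hx => q0_out l x (by push_cast at hx; omega))
  have a2 := hS.sweepA' (loW l) (Dl l + 1) (al0 l) (fun x hx => al0_out l x (by push_cast at hx; omega))
  have a3 := hS.sweepB' (loW l) (Dl l + 1) (be0 l) (fun x hx => be0_out l x (by push_cast at hx; omega))
  have a4 := hS.tt (XX D Q l).z
  refine (((a1.mul a2).mul a3).mul a4).mono ?_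
  have e : ∑ x ∈ Finset.range (Dl l + 1), w (q0 Q l (x + loW l))
      = ∑ x ∈ Finset.Icc (loW l) (hiW l), w (q0 Q l x) := by
    refine Finset.sum_bij (fun (x : ℕ) _ => (x : ℤ) + loW l) ?_ ?_ ?_ ?_
    · intro x hx; simp at hx ⊢; omega
    · intro x _ y _ h; simpa using h
    · intro y hy; simp at hy
      exact ⟨(y - loW l).toNat, by simp; omega, by omega⟩
    · intro x _; rfl
  rw [e]; omega

theorem Cost.reach_XX (hS : Cost S w) (l : List Om) (A : Finset D.ι)
    (hA : ∀ s, s ∈ A ↔ D.k s ≤ Dl l) :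
    Reach S (XX D Q l) (15 * (Dl l + 1) + ∑ x ∈ Finset.Icc (loW l) (hiW l), w (q0 Q l x)
      + ∑ s ∈ A, (2400 * (min (Dl l + Alt (D.k s) l) (Fintype.card (D.Γ s) * Dl l))
      + 2 * Wt (Q := Q) w s l)) := by
  have h1 := Cost.prodA (S := S) (fun s => kap (Q := Q) s l) _ A
    (fun s hs => hS.kap_min s l ((hA s).mp hs))
  have h2 := h1.mul (hS.W0 l)
  have e : XX D Q l = (⟨fun s x => if s ∈ A then kap (Q := Q) s l x else 1, 0⟩ : Hg D Q) *
      (hC D (q0 Q l) * SE.hA Q D (al0 l) * hB Q D (be0 l) * SE.tt D Q (XX D Q l).z) := by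
    apply Hg.ext'
    · intro s x
      simp only [Hg.mul_φ, Hg.mul_z, hC_z, hA_z, hB_z, sub_zero, add_zero, hC_φ, hA_φ, hB_φ, tt_φ,
        mul_one]
      split_ifs with hs
      · rw [kap, inv_mul_cancel_right]
      · rw [hA, Dl_eq] at hs
        rw [one_mul]; exact XX_inactive s l x (by omega)
    · simp
  rw [e]
  exact h2.mono (by omega)

theorem Nsupp_le (s : D.ι) (l : List Om) :
    ∑ x ∈ Finset.Icc (loW l) (hiW l), (Finset.univ.filter (fun h => ((XX D Q l).φ s x).q h ≠ 0)).card
      ≤ 34 * (Dl l + 1) + 33 * Alt (D.k s) l := by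
  have hk := D.k_pos s
  have h : ∀ x, (Finset.univ.filter (fun h => ((XX D Q l).φ s x).q h ≠ 0)).card
      ≤ 33 * alt (D.k s) x l + 34 := fun x => (pathCov_alt s l x x le_rfl (by omega)).card
  refine (Finset.sum_le_sum fun x _ => h x).trans ?_
  rw [Finset.sum_add_distrib, ← Finset.mul_sum, Finset.sum_const, Int.card_Icc, smul_eq_mul]
  have := alt_sum (D.k s) (by omega) l (Finset.Icc (loW l) (hiW l))
  have := Dl_eq l
  have := hiW_nonneg l
  have := loW_nonpos l
  have : (hiW l + 1 - loW l).toNat = Dl l + 1 := by omega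
  rw [this]; omega

theorem Nsupp_le' (s : D.ι) (l : List Om) :
    ∑ x ∈ Finset.Icc (loW l) (hiW l), (Finset.univ.filter (fun h => ((XX D Q l).φ s x).q h ≠ 0)).card
      ≤ Fintype.card (D.Γ s) * (Dl l + 1) := by
  refine (Finset.sum_le_sum fun x _ => Finset.card_le_univ _).trans ?_
  rw [Finset.sum_const, Int.card_Icc, smul_eq_mul]
  have := Dl_eq l
  have := hiW_nonneg l
  have := loW_nonpos l
  have : (hiW l + 1 - loW l).toNat = Dl l + 1 := by omega
  rw [this, mul_comm]

theorem act_finite (D : Sys) (n : ℕ) : {s : D.ι | D.k s ≤ n}.Finite := by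
  have hinj : Function.Injective D.k := by
    intro s s' h
    by_contra hne
    have := D.iso s s' hne
    have hb := D.b_pos s
    unfold Sys.k at h
    rw [h] at this; simp at this; omega
  refine Set.Finite.of_finite_image ((Finset.Icc (0 : ℤ) n).finite_toSet.subset ?_) hinj.injOn
  rintro _ ⟨s, hs, rfl⟩
  have := D.k_pos s
  simp at hs ⊢; omega

end ReachX
end SE

namespace SE

set_option linter.unusedSectionVars false
set_option linter.unusedVariables false
set_option linter.unusedSimpArgs false

theorem Ex_step (n : ℕ) (F : List Om → ℝ) : Ex pr (n + 1) F
    = (1 / 8) * (Ex pr n (fun l => F (Sum.inl true :: l)) + Ex pr n (fun l => F (Sum.inl false :: l)))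
      + (1 / 4) * avg (fun α => Ex pr n (fun l => F (Sum.inr (Sum.inl α) :: l)))
      + (1 / 4) * avg (fun α => Ex pr n (fun l => F (Sum.inr (Sum.inr (Sum.inl α)) :: l)))
      + (1 / 16) * ∑ e : Bool × Bool, Ex pr n (fun l => F (Sum.inr (Sum.inr (Sum.inr e)) :: l)) := by
  rw [Ex_succ]
  exact sum_Om (fun ω => Ex pr n (fun l => F (ω :: l)))

/-- Step for functionals that only see moves. -/
theorem Ex_step_move (n : ℕ) (F G : List Om → ℝ) (h : ∀ ω l, F (Sum.inr ω :: l) = G l) :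
    Ex pr (n + 1) F = (1 / 8) * (Ex pr n (fun l => F (Sum.inl true :: l))
      + Ex pr n (fun l => F (Sum.inl false :: l))) + (3 / 4) * Ex pr n G := by
  rw [Ex_step]
  simp only [h, avg_const]
  simp
  ring

theorem Ex_hi (n : ℕ) : Ex pr n (fun l => (hiW l : ℝ) ^ 2) ≤ n / 4 := by
  induction n with
  | zero => simp [Ex_zero, hiW]
  | succ n ih =>
    rw [Ex_step_move n _ (fun l => (hiW l : ℝ) ^ 2) (fun _ _ => rfl), ← Ex_add]
    have h : Ex pr n (fun l => (hiW (Sum.inl true :: l) : ℝ) ^ 2 + (hiW (Sum.inl false :: l) : ℝ) ^ 2)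
        ≤ Ex pr n (fun l => 2 * (hiW l : ℝ) ^ 2 + 2) := by
      refine Ex_mono pr_nonneg fun l _ => ?_
      simp only [hiW, dir]
      push_cast
      have h1 : ∀ y : ℝ, (max 0 y) ^ 2 ≤ y ^ 2 := by
        intro y
        rcases le_total 0 y with h | h
        · rw [max_eq_right h]
        · rw [max_eq_left h]; nlinarith [sq_nonneg y]
      have := h1 (1 + (hiW l : ℝ))
      have := h1 (-1 + (hiW l : ℝ))
      simp
      nlinarith
    rw [Ex_add (fun l => 2 * (hiW l : ℝ) ^ 2) (fun _ => 2), Ex_mul_left, Ex_const pr_sum] at h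
    push_cast
    linarith

theorem Ex_lo (n : ℕ) : Ex pr n (fun l => (loW l : ℝ) ^ 2) ≤ n / 4 := by
  induction n with
  | zero => simp [Ex_zero, loW]
  | succ n ih =>
    rw [Ex_step_move n _ (fun l => (loW l : ℝ) ^ 2) (fun _ _ => rfl), ← Ex_add]
    have h : Ex pr n (fun l => (loW (Sum.inl true :: l) : ℝ) ^ 2 + (loW (Sum.inl false :: l) : ℝ) ^ 2)
        ≤ Ex pr n (fun l => 2 * (loW l : ℝ) ^ 2 + 2) := by
      refine Ex_mono pr_nonneg fun l _ => ?_
      simp only [loW, dir]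
      push_cast
      have h1 : ∀ y : ℝ, (min 0 y) ^ 2 ≤ y ^ 2 := by
        intro y
        rcases le_total 0 y with h | h
        · rw [min_eq_left h]; nlinarith [sq_nonneg y]
        · rw [min_eq_right h]
      have := h1 (1 + (loW l : ℝ))
      have := h1 (-1 + (loW l : ℝ))
      simp
      nlinarith
    rw [Ex_add (fun l => 2 * (loW l : ℝ) ^ 2) (fun _ => 2), Ex_mul_left, Ex_const pr_sum] at h
    push_cast
    linarith

theorem Ex_Dl_sq (n : ℕ) : Ex pr n (fun l => (Dl l : ℝ) ^ 2) ≤ n := by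
  have h : Ex pr n (fun l => (Dl l : ℝ) ^ 2)
      ≤ Ex pr n (fun l => 2 * (hiW l : ℝ) ^ 2 + 2 * (loW l : ℝ) ^ 2) := by
    refine Ex_mono pr_nonneg fun l _ => ?_
    have : (Dl l : ℝ) = hiW l - loW l := by exact_mod_cast Dl_eq l
    rw [this]; nlinarith [sq_nonneg ((hiW l : ℝ) + loW l)]
  rw [Ex_add, Ex_mul_left, Ex_mul_left] at h
  linarith [Ex_hi n, Ex_lo n]

theorem Ex_Dl (n : ℕ) : Ex pr n (fun l => (Dl l : ℝ)) ≤ Real.sqrt n := by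
  apply Real.le_sqrt_of_sq_le
  exact (Ex_sq_le pr_nonneg pr_sum _).trans (Ex_Dl_sq n)

theorem Ex_Dl_ind (n : ℕ) (k : ℝ) (hk : 0 < k) :
    Ex pr n (fun l => if k ≤ (Dl l : ℝ) then (Dl l : ℝ) else 0) ≤ n / k := by
  have h : Ex pr n (fun l => if k ≤ (Dl l : ℝ) then (Dl l : ℝ) else 0)
      ≤ Ex pr n (fun l => (1 / k) * (Dl l : ℝ) ^ 2) := by
    refine Ex_mono pr_nonneg fun l _ => ?_
    split_ifs with h
    · rw [one_div, inv_mul_eq_div, le_div_iff₀ hk]; nlinarith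
    · positivity
  rw [Ex_mul_left] at h
  refine h.trans ?_
  rw [one_div, inv_mul_eq_div]
  gcongr; exact Ex_Dl_sq n

theorem Ex_nx_hi (k : ℤ) (hk : 0 < k) (n : ℕ) : ∀ u : ℤ, -k ≤ u → u ≤ 0 →
    Ex pr n (fun l => if nx k u l = some true then (1 : ℝ) else 0) ≤ -u / k := by
  have hk' : (0 : ℝ) < k := by exact_mod_cast hk
  induction n with
  | zero =>
    intro u h1 h2
    rw [Ex_zero]
    split_ifs with h
    · simp only [nx] at h
      have : u = -k := by
        by_contra hne
        by_cases h3 : 0 ≤ u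
        · simp [h3] at h
        · simp [h3, show ¬ u ≤ -k by omega] at h
      rw [this]; push_cast; rw [neg_neg, div_self hk'.ne']
    · apply div_nonneg _ hk'.le; have : (u : ℝ) ≤ 0 := by exact_mod_cast h2
      linarith
  | succ n ih =>
    intro u h1 h2
    by_cases hu0 : 0 ≤ u
    · have : u = 0 := by omega
      subst this
      have : Ex pr (n + 1) (fun l => if nx k 0 l = some true then (1 : ℝ) else 0)
          = Ex pr (n + 1) (fun _ => 0) := Ex_congr fun l _ => by rw [nx_lo k 0 l le_rfl]; simp
      rw [this, Ex_zero_fun]; simp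
    · by_cases huk : u ≤ -k
      · have : u = -k := by omega
        subst this
        push_cast; rw [neg_neg, div_self hk'.ne']
        have : Ex pr (n + 1) (fun l => if nx k (-k) l = some true then (1 : ℝ) else 0)
          ≤ Ex pr (n + 1) (fun _ => 1) := Ex_mono pr_nonneg fun l _ => by split_ifs <;> norm_num
        rwa [Ex_const pr_sum] at this
      · rw [Ex_step_move n _ (fun l => if nx k u l = some true then (1 : ℝ) else 0) (fun _ _ => rfl)]
        simp only [nx, hu0, huk, if_false, dir, if_true]
        have a1 := ih u h1 h2
        have a2 := ih (u - 1) (by omega) (by omega)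
        have a3 := ih (u - -1) (by omega) (by omega)
        simp only [Bool.false_eq_true, if_false]
        push_cast at a2 a3
        have : -(u : ℝ) / k = (1 / 8) * (-((u : ℝ) - 1) / k + -((u : ℝ) - -1) / k)
          + (3 / 4) * (-(u : ℝ) / k) := by field_simp; ring
        rw [this]
        gcongr

theorem Ex_nx_lo (k : ℤ) (hk : 0 < k) (n : ℕ) : ∀ u : ℤ, -k ≤ u → u ≤ 0 →
    Ex pr n (fun l => if nx k u l = some false then (1 : ℝ) else 0) ≤ (k + u) / k := by
  have hk' : (0 : ℝ) < k := by exact_mod_cast hk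
  induction n with
  | zero =>
    intro u h1 h2
    rw [Ex_zero]
    split_ifs with h
    · simp only [nx] at h
      have : u = 0 := by
        by_contra hne
        by_cases h3 : u ≤ -k
        · simp [h3, show ¬ 0 ≤ u by omega] at h
        · simp [h3, show ¬ 0 ≤ u by omega] at h
      rw [this]; push_cast; rw [add_zero, div_self hk'.ne']
    · apply div_nonneg _ hk'.le; have : (-k : ℝ) ≤ u := by exact_mod_cast h1
      linarith
  | succ n ih =>
    intro u h1 h2
    by_cases hu0 : 0 ≤ u
    · have : u = 0 := by omega
      subst this
      push_cast; rw [add_zero, div_self hk'.ne']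
      have : Ex pr (n + 1) (fun l => if nx k 0 l = some false then (1 : ℝ) else 0)
        ≤ Ex pr (n + 1) (fun _ => 1) := Ex_mono pr_nonneg fun l _ => by split_ifs <;> norm_num
      rwa [Ex_const pr_sum] at this
    · by_cases huk : u ≤ -k
      · have : u = -k := by omega
        subst this
        have : Ex pr (n + 1) (fun l => if nx k (-k) l = some false then (1 : ℝ) else 0)
          = Ex pr (n + 1) (fun _ => 0) := Ex_congr fun l _ => by rw [nx_hi k hk _ l le_rfl]; simp
        rw [this, Ex_zero_fun]; simp
      · rw [Ex_step_move n _ (fun l => if nx k u l = some false then (1 : ℝ) else 0) (fun _ _ => rfl)]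
        simp only [nx, hu0, huk, if_false, dir, if_true]
        have a1 := ih u h1 h2
        have a2 := ih (u - 1) (by omega) (by omega)
        have a3 := ih (u - -1) (by omega) (by omega)
        simp only [Bool.false_eq_true, if_false]
        push_cast at a2 a3
        have : ((k : ℝ) + u) / k = (1 / 8) * ((k + ((u : ℝ) - 1)) / k + (k + ((u : ℝ) - -1)) / k)
          + (3 / 4) * ((k + (u : ℝ)) / k) := by field_simp; ring
        rw [this]
        gcongr

theorem Ex_Alt (k : ℤ) (hk : 0 < k) (n : ℕ) : Ex pr n (fun l => (Alt k l : ℝ)) ≤ n / (4 * k) := by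
  have hk' : (0 : ℝ) < k := by exact_mod_cast hk
  induction n with
  | zero => simp [Ex_zero, Alt]
  | succ n ih =>
    rw [Ex_step_move n _ (fun l => (Alt k l : ℝ)) (fun _ _ => rfl)]
    have e1 : Ex pr n (fun l => (Alt k (Sum.inl true :: l) : ℝ))
        = Ex pr n (fun l => (Alt k l : ℝ)) + Ex pr n (fun l => if nx k (-1) l = some true then (1 : ℝ) else 0) := by
      rw [← Ex_add]; refine Ex_congr fun l _ => ?_
      simp [Alt]
    have e2 : Ex pr n (fun l => (Alt k (Sum.inl false :: l) : ℝ))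
        = Ex pr n (fun l => (Alt k l : ℝ)) + Ex pr n (fun l => if nx k (1 - k) l = some false then (1 : ℝ) else 0) := by
      rw [← Ex_add]; refine Ex_congr fun l _ => ?_
      simp [Alt]
    have a1 := Ex_nx_hi k hk n (-1) (by omega) (by omega)
    have a2 := Ex_nx_lo k hk n (1 - k) (by omega) (by omega)
    rw [e1, e2]
    push_cast at a1 a2 ⊢
    have : ((n : ℝ) + 1) / (4 * k) = n / (4 * k) + (1 / 8) * (1 / k + 1 / k) := by field_simp; ring
    rw [this]
    rw [neg_neg] at a1
    rw [show (k : ℝ) + (1 - k) = 1 by ring] at a2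
    linarith

/-! Generic fields. -/

section Gfl
variable {P : Type} (τ : Om → P ≃ P) (o : P) (ξ : Bool × Bool → ℤ)

/-- Increment carried by a letter. -/
def inc : Om → ℤ
  | Sum.inl _ => 0
  | Sum.inr (Sum.inl _) => 0
  | Sum.inr (Sum.inr (Sum.inl _)) => 0
  | Sum.inr (Sum.inr (Sum.inr e)) => ξ e

noncomputable def gfl : List Om → P → ℤ
  | [], _ => 0
  | ω :: l, p => gfl l (τ ω p) + if p = o then inc ξ ω else 0

theorem gfl_supp (l : List Om) : (Function.support (gfl τ o ξ l)).Finite := by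
  induction l with
  | nil => simp [gfl, Function.support]
  | cons ω l ih =>
    refine ((ih.image (τ ω).symm).union (Set.finite_singleton o)).subset ?_
    intro p hp
    by_cases h : p = o
    · right; exact h
    · left
      simp [gfl, h] at hp
      exact ⟨τ ω p, hp, by simp⟩

/-- Total of `Ψ` over the field. -/
noncomputable def Tot (Ψ : ℤ → ℝ) (f : P → ℤ) : ℝ := ∑' p, Ψ (f p)

theorem gfl_summable (Ψ : ℤ → ℝ) (h0 : Ψ 0 = 0) (l : List Om) (e : P ≃ P) :
    Summable (fun p => Ψ (gfl τ o ξ l (e p))) := by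
  apply summable_of_hasFiniteSupport
  refine ((gfl_supp τ o ξ l).image e.symm).subset ?_
  intro p hp
  refine ⟨e p, ?_, by simp⟩
  intro hc
  apply hp
  simp only [hc, h0]

/-- Requirement that lamp letters fix positions. -/
theorem Tot_cons (hτ : ∀ ω, inc ξ ω ≠ 0 → τ ω = Equiv.refl P) (Ψ : ℤ → ℝ) (h0 : Ψ 0 = 0) (ω : Om)
    (l : List Om) : Tot Ψ (gfl τ o ξ (ω :: l)) = Tot Ψ (gfl τ o ξ l)
      + (Ψ (gfl τ o ξ l o + inc ξ ω) - Ψ (gfl τ o ξ l o)) := by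
  have e1 : Tot Ψ (gfl τ o ξ l) = ∑' p, Ψ (gfl τ o ξ l (τ ω p)) :=
    ((τ ω).tsum_eq (fun p => Ψ (gfl τ o ξ l p))).symm
  by_cases hi : inc ξ ω = 0
  · rw [hi, add_zero, sub_self, add_zero, e1]
    unfold Tot
    refine tsum_congr fun p => ?_
    simp [gfl, hi]
  · have e2 : ∀ p, Ψ (gfl τ o ξ (ω :: l) p) = Ψ (gfl τ o ξ l (τ ω p))
        + if p = o then (Ψ (gfl τ o ξ l o + inc ξ ω) - Ψ (gfl τ o ξ l o)) else 0 := by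
      intro p
      rw [hτ ω hi]
      by_cases hp : p = o
      · subst hp; simp [gfl, hτ ω hi]
      · simp [gfl, hp, hτ ω hi]
    rw [e1, Tot, tsum_congr e2, Summable.tsum_add (gfl_summable τ o ξ Ψ h0 l (τ ω)) , tsum_ite_eq]
    exact summable_of_hasFiniteSupport ((Set.finite_singleton o).subset (by
      intro p hp; by_contra h; apply hp; simp only [Set.mem_singleton_iff] at h; simp [h]))

theorem Ex_Tot (hτ : ∀ ω, inc ξ ω ≠ 0 → τ ω = Equiv.refl P) (Ψ : ℤ → ℝ) (h0 : Ψ 0 = 0) (n : ℕ) :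
    Ex pr (n + 1) (fun l => Tot Ψ (gfl τ o ξ l)) = Ex pr n (fun l => Tot Ψ (gfl τ o ξ l))
      + Ex pr n (fun l => (1 / 16) * ∑ e, (Ψ (gfl τ o ξ l o + ξ e) - Ψ (gfl τ o ξ l o))) := by
  rw [Ex_step]
  simp only [Tot_cons τ o ξ hτ Ψ h0, inc, add_zero, sub_self, avg_const, Ex_add]
  rw [Finset.sum_add_distrib, Ex_mul_left, Ex_sum]
  simp
  ring

theorem Ex_Tot_sq (hτ : ∀ ω, inc (xi ℤ) ω ≠ 0 → τ ω = Equiv.refl P) (n : ℕ) :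
    Ex pr n (fun l => Tot (fun y => (y : ℝ) ^ 2) (gfl τ o (xi ℤ) l)) = n / 8 := by
  induction n with
  | zero => simp [Ex_zero, gfl, Tot]
  | succ n ih =>
    rw [Ex_Tot τ o _ hτ _ (by simp), ih]
    have : Ex pr n (fun l => (1 / 16) * ∑ e, (((gfl τ o (xi ℤ) l o + xi ℤ e : ℤ) : ℝ) ^ 2
        - (gfl τ o (xi ℤ) l o : ℝ) ^ 2)) = Ex pr n (fun l => (1 / 8 : ℝ)) := by
      refine Ex_congr fun l _ => ?_
      rw [Fintype.sum_prod_type]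
      simp [xi]
      ring
    rw [this, Ex_const pr_sum]
    push_cast; ring

end Gfl
end SE

namespace SE

set_option linter.unusedSectionVars false
set_option linter.unusedVariables false
set_option linter.unusedSimpArgs false

section Upper
variable {D : Sys}

/-- Motion of positions in coordinate `s`. -/
noncomputable def tauS (s : D.ι) : Om → (ℤ × D.Γ s) ≃ (ℤ × D.Γ s)
  | Sum.inl e => Equiv.prodShear (Equiv.subRight (dir e)) (fun _ => Equiv.refl _)
  | Sum.inr (Sum.inl α) => Equiv.prodShear (Equiv.refl ℤ)
      (fun x => Equiv.mulLeft (D.ha s (if x = D.k s then α else 1))⁻¹)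
  | Sum.inr (Sum.inr (Sum.inl α)) => Equiv.prodShear (Equiv.refl ℤ)
      (fun x => Equiv.mulLeft (D.hb s (if x = - D.k s then α else 1))⁻¹)
  | Sum.inr (Sum.inr (Sum.inr _)) => Equiv.refl _

theorem tauS_inc (s : D.ι) (ξ : Bool × Bool → ℤ) :
    ∀ ω, inc ξ ω ≠ 0 → tauS s ω = Equiv.refl (ℤ × D.Γ s)
  | Sum.inl e => by simp [inc]
  | Sum.inr (Sum.inl α) => by simp [inc]
  | Sum.inr (Sum.inr (Sum.inl α)) => by simp [inc]
  | Sum.inr (Sum.inr (Sum.inr _)) => fun _ => rfl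

/-- Field of coordinate `s`. -/
noncomputable def fS (s : D.ι) (ξ : Bool × Bool → ℤ) (l : List Om) : ℤ × D.Γ s → ℤ :=
  gfl (tauS s) ((0 : ℤ), (1 : D.Γ s)) ξ l

theorem q_eq_fS (s : D.ι) : ∀ (l : List Om) (x : ℤ) (h : D.Γ s),
    ((XX D ℤ l).φ s x).q h = fS s (xi ℤ) l (x, h)
  | [], x, h => by rw [XX_nil]; rfl
  | Sum.inl e :: l, x, h => by
    rw [XX_t, q_eq_fS s l]
    simp [fS, gfl, tauS, inc, Equiv.prodShear]
  | Sum.inr (Sum.inl α) :: l, x, h => by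
    rw [XX_a]
    simp only [Lamp.mul_q, gL_q, gL_g, zero_add]
    rw [q_eq_fS s l]
    simp [fS, gfl, tauS, inc, Equiv.prodShear]
  | Sum.inr (Sum.inr (Sum.inl α)) :: l, x, h => by
    rw [XX_b]
    simp only [Lamp.mul_q, gL_q, gL_g, zero_add]
    rw [q_eq_fS s l]
    simp [fS, gfl, tauS, inc, Equiv.prodShear]
  | Sum.inr (Sum.inr (Sum.inr e)) :: l, x, h => by
    rw [XX_c]
    simp only [Lamp.mul_q, cL_q, cL_g, inv_one, one_mul]
    rw [q_eq_fS s l]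
    simp only [fS, gfl, tauS, inc, Equiv.refl_apply, Prod.mk.injEq]
    by_cases hx : x = 0 <;> by_cases hh : h = 1 <;> simp [hx, hh, add_comm]

noncomputable def tau0 : Om → ℤ ≃ ℤ
  | Sum.inl e => Equiv.subRight (dir e)
  | Sum.inr _ => Equiv.refl _

theorem tau0_inc (ξ : Bool × Bool → ℤ) : ∀ ω, inc ξ ω ≠ 0 → tau0 ω = Equiv.refl ℤ
  | Sum.inl e => by simp [inc]
  | Sum.inr _ => fun _ => rfl

theorem q0_eq : ∀ (l : List Om) (x : ℤ), q0 ℤ l x = gfl tau0 0 (xi ℤ) l x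
  | [], x => rfl
  | Sum.inl e :: l, x => by simp [q0, gfl, inc, tau0, q0_eq l]
  | Sum.inr (Sum.inl _) :: l, x => by simp [q0, gfl, inc, tau0, q0_eq l]
  | Sum.inr (Sum.inr (Sum.inl _)) :: l, x => by simp [q0, gfl, inc, tau0, q0_eq l]
  | Sum.inr (Sum.inr (Sum.inr e)) :: l, x => by
    simp [q0, gfl, inc, tau0, q0_eq l, add_comm]

theorem Tot_q (s : D.ι) (Ψ : ℤ → ℝ) (h0 : Ψ 0 = 0) (l : List Om) :
    Tot Ψ (fS s (xi ℤ) l) = ∑ x ∈ Finset.Icc (loW l) (hiW l), ∑ h, Ψ (((XX D ℤ l).φ s x).q h) := by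
  rw [← Finset.sum_product', Tot, tsum_eq_sum (s := Finset.Icc (loW l) (hiW l) ×ˢ Finset.univ)]
  · refine Finset.sum_congr rfl fun p _ => ?_
    rw [q_eq_fS]
  · rintro ⟨x, h⟩ hp
    rw [← q_eq_fS, XX_q_out s l x h (by simpa using hp), h0]

theorem Tot_q0 (Ψ : ℤ → ℝ) (h0 : Ψ 0 = 0) (l : List Om) :
    Tot Ψ (gfl tau0 0 (xi ℤ) l) = ∑ x ∈ Finset.Icc (loW l) (hiW l), Ψ (q0 ℤ l x) := by
  rw [Tot, tsum_eq_sum (s := Finset.Icc (loW l) (hiW l))]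
  · refine Finset.sum_congr rfl fun p _ => ?_
    rw [q0_eq]
  · intro x hp
    rw [← q0_eq, q0_out l x (by simpa using hp), h0]

variable (Q : Type) [CommRing Q]

noncomputable def Ns (s : D.ι) (l : List Om) : ℕ :=
  ∑ x ∈ Finset.Icc (loW l) (hiW l), (Finset.univ.filter (fun h => ((XX D Q l).φ s x).q h ≠ 0)).card

noncomputable def ind (s : D.ι) (l : List Om) : ℝ := if D.k s ≤ (Dl l : ℤ) then 1 else 0

theorem ind_nonneg (s : D.ι) (l : List Om) : 0 ≤ ind s l := by unfold ind; split_ifs <;> norm_num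
theorem ind_le (s : D.ι) (l : List Om) : ind s l ≤ 1 := by unfold ind; split_ifs <;> norm_num

theorem kR (s : D.ι) : (2 : ℝ) ≤ (D.k s : ℝ) := by exact_mod_cast D.k_pos s

theorem ind_Dl (s : D.ι) (l : List Om) : ind s l ≤ ind s l * Dl l := by
  unfold ind; split_ifs with h
  · have := D.k_pos s
    have : 1 ≤ Dl l := by omega
    simpa using (by exact_mod_cast this : (1 : ℝ) ≤ Dl l)
  · simp

theorem Ex_ind_Dl (s : D.ι) (n : ℕ) :
    Ex pr n (fun l => ind s l * (Dl l : ℝ)) ≤ n / (D.k s : ℝ) := by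
  refine le_trans (le_of_eq ?_) (Ex_Dl_ind n (D.k s) (by linarith [kR s]))
  refine Ex_congr fun l _ => ?_
  unfold ind
  have : ((D.k s : ℝ) ≤ (Dl l : ℝ)) ↔ D.k s ≤ (Dl l : ℤ) := by
    rw [← Int.cast_natCast, Int.cast_le]
  simp only [this]
  split_ifs <;> simp

theorem Ex_ind_Dl' (s : D.ι) (n : ℕ) :
    Ex pr n (fun l => ind s l * (Dl l : ℝ)) ≤ Real.sqrt n := by
  refine le_trans ?_ (Ex_Dl n)
  refine Ex_mono pr_nonneg fun l _ => ?_
  have := ind_le s l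
  have : (0 : ℝ) ≤ Dl l := by positivity
  nlinarith

theorem Ex_Alt' (s : D.ι) (n : ℕ) :
    Ex pr n (fun l => (Alt (D.k s) l : ℝ)) ≤ n / (4 * (D.k s : ℝ)) :=
  Ex_Alt (D.k s) (by have := D.k_pos s; omega) n

theorem Ex_ind_Ns (s : D.ι) (n : ℕ) :
    Ex pr n (fun l => ind s l * (Ns Q s l : ℝ)) ≤ 80 * (n / (D.k s : ℝ)) := by
  have h : Ex pr n (fun l => ind s l * (Ns Q s l : ℝ))
      ≤ Ex pr n (fun l => 68 * (ind s l * (Dl l : ℝ)) + 33 * (Alt (D.k s) l : ℝ)) := by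
    refine Ex_mono pr_nonneg fun l _ => ?_
    have h1 : (Ns Q s l : ℝ) ≤ 34 * (Dl l + 1) + 33 * Alt (D.k s) l := by
      exact_mod_cast Nsupp_le s l
    have h2 := ind_Dl s l
    have h3 := ind_nonneg s l
    have h4 := ind_le s l
    have h5 : (0 : ℝ) ≤ Alt (D.k s) l := by positivity
    calc ind s l * (Ns Q s l : ℝ) ≤ ind s l * (34 * (Dl l + 1) + 33 * Alt (D.k s) l) := by gcongr
      _ ≤ _ := by nlinarith
  rw [Ex_add, Ex_mul_left, Ex_mul_left] at h
  have h1 := Ex_ind_Dl s n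
  have h2 := Ex_Alt' s n
  have h3 : (n : ℝ) / (4 * D.k s) = (1 / 4) * (n / D.k s) := by
    have := kR s; field_simp
  have h4 : (0 : ℝ) ≤ n / D.k s := by have := kR s; positivity
  rw [h3] at h2
  linarith

theorem Ex_ind_Ns' (s : D.ι) (n : ℕ) :
    Ex pr n (fun l => ind s l * (Ns Q s l : ℝ)) ≤ 2 * (Fintype.card (D.Γ s) * Real.sqrt n) := by
  have h : Ex pr n (fun l => ind s l * (Ns Q s l : ℝ))
      ≤ Ex pr n (fun l => (2 * Fintype.card (D.Γ s) : ℝ) * (ind s l * (Dl l : ℝ))) := by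
    refine Ex_mono pr_nonneg fun l _ => ?_
    have h1 : (Ns Q s l : ℝ) ≤ Fintype.card (D.Γ s) * (Dl l + 1) := by
      exact_mod_cast Nsupp_le' s l
    have h2 := ind_Dl s l
    have h3 := ind_nonneg s l
    have h5 : (0 : ℝ) ≤ Fintype.card (D.Γ s) := by positivity
    calc ind s l * (Ns Q s l : ℝ) ≤ ind s l * (Fintype.card (D.Γ s) * (Dl l + 1)) := by gcongr
      _ ≤ _ := by nlinarith
  rw [Ex_mul_left] at h
  have h1 := Ex_ind_Dl' s n
  have h5 : (0 : ℝ) ≤ Fintype.card (D.Γ s) := by positivity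
  nlinarith

variable {Q}
/-- The explicit reach bound. -/
noncomputable def RB (D : Sys) (w : Q → ℕ) (l : List Om) : ℕ :=
  15 * (Dl l + 1) + ∑ x ∈ Finset.Icc (loW l) (hiW l), w (q0 Q l x)
      + ∑ s ∈ (act_finite D (Dl l)).toFinset, (2400 * (min (Dl l + Alt (D.k s) l) (Fintype.card (D.Γ s) * Dl l))
      + 2 * Wt (Q := Q) w s l)

theorem Cost.reach_RB {S : Set (Hg D Q)} {w : Q → ℕ} (hS : Cost S w) (l : List Om) :
    Reach S (XX D Q l) (RB D w l) :=
  hS.reach_XX l _ (fun s => by simp)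

theorem RB_le (w : Q → ℕ) (n : ℕ) (Sat Un : Finset D.ι)
    (hcov : ∀ s, D.k s ≤ n → s ∈ Sat ∨ s ∈ Un) (l : List Om) (hl : l.length = n) :
    (RB D w l : ℝ) ≤ (15 * (Dl l + 1) : ℝ) + ((∑ x ∈ Finset.Icc (loW l) (hiW l), w (q0 Q l x) : ℕ) : ℝ)
      + (∑ s ∈ Sat, (2400 * (Fintype.card (D.Γ s) * (ind s l * (Dl l : ℝ)))
          + 2 * (ind s l * (Wt (Q := Q) w s l : ℝ))))
      + ∑ s ∈ Un, (2400 * (ind s l * (Dl l : ℝ) + (Alt (D.k s) l : ℝ))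
          + 2 * (ind s l * (Wt (Q := Q) w s l : ℝ))) := by
  unfold RB
  push_cast
  rw [add_assoc _ (∑ s ∈ Sat, _)]
  refine add_le_add le_rfl ?_
  set A := (act_finite D (Dl l)).toFinset with hA
  have hA' : ∀ s, s ∈ A ↔ D.k s ≤ (Dl l : ℤ) := by intro s; simp [hA]
  have hsub : A ⊆ (A.filter (· ∈ Sat)) ∪ (A.filter (· ∈ Un)) := by
    intro s hs
    have h1 := (hA' s).1 hs
    have h2 := Dl_le l
    rcases hcov s (by omega) with h | h
    · exact Finset.mem_union_left _ (by simp [hs, h])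
    · exact Finset.mem_union_right _ (by simp [hs, h])
  have hpos : ∀ s, (0:ℝ) ≤ 2400 * min ((Dl l : ℝ) + Alt (D.k s) l) (Fintype.card (D.Γ s) * Dl l)
      + 2 * (Wt (Q := Q) w s l : ℝ) := by intro s; positivity
  refine (Finset.sum_le_sum_of_subset_of_nonneg hsub (fun s _ _ => hpos s)).trans ?_
  have hun : ∀ (F : D.ι → ℝ), (∀ s, 0 ≤ F s) → ∀ X Y : Finset D.ι,
      ∑ s ∈ X ∪ Y, F s ≤ ∑ s ∈ X, F s + ∑ s ∈ Y, F s := by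
    intro F hF X Y
    rw [← Finset.sum_union_inter]
    have : 0 ≤ ∑ s ∈ X ∩ Y, F s := Finset.sum_nonneg fun s _ => hF s
    linarith
  refine (hun _ hpos _ _).trans (add_le_add ?_ ?_)
  · have hsub2 : A.filter (· ∈ Sat) ⊆ Sat := fun s hs => (Finset.mem_filter.1 hs).2
    refine le_trans (Finset.sum_le_sum fun s hs => ?_)
      (Finset.sum_le_sum_of_subset_of_nonneg hsub2 fun s _ _ => ?_)
    · have : ind s l = 1 := by simp [ind, (hA' s).1 (Finset.mem_filter.1 hs).1]
      rw [this, one_mul, one_mul]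
      gcongr
      exact min_le_right _ _
    · have := ind_nonneg s l; positivity
  · have hsub2 : A.filter (· ∈ Un) ⊆ Un := fun s hs => (Finset.mem_filter.1 hs).2
    refine le_trans (Finset.sum_le_sum fun s hs => ?_)
      (Finset.sum_le_sum_of_subset_of_nonneg hsub2 fun s _ _ => ?_)
    · have : ind s l = 1 := by simp [ind, (hA' s).1 (Finset.mem_filter.1 hs).1]
      rw [this, one_mul, one_mul]
      gcongr
      exact min_le_left _ _
    · have := ind_nonneg s l; positivity

theorem sqrt_n_ge {n : ℕ} (hn : 1 ≤ n) : 1 ≤ Real.sqrt n := by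
  rw [Real.one_le_sqrt]; exact_mod_cast hn

theorem Ex_RB (w : Q → ℕ) (n : ℕ) (hn : 1 ≤ n) (Sat Un : Finset D.ι)
    (hcov : ∀ s, D.k s ≤ n → s ∈ Sat ∨ s ∈ Un) (W0 : ℝ) (WS WU : D.ι → ℝ)
    (h0 : Ex pr n (fun l => ((∑ x ∈ Finset.Icc (loW l) (hiW l), w (q0 Q l x) : ℕ) : ℝ)) ≤ W0)
    (hWS : ∀ s, Ex pr n (fun l => ind s l * (Wt (Q := Q) w s l : ℝ)) ≤ WS s)
    (hWU : ∀ s, Ex pr n (fun l => ind s l * (Wt (Q := Q) w s l : ℝ)) ≤ WU s) :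
    Ex pr n (fun l => (RB D w l : ℝ)) ≤ 30 * Real.sqrt n + W0
      + (∑ s ∈ Sat, (2400 * (Fintype.card (D.Γ s) * Real.sqrt n) + 2 * WS s))
      + ∑ s ∈ Un, (3000 * (n / (D.k s : ℝ)) + 2 * WU s) := by
  refine (Ex_mono pr_nonneg fun l hl => RB_le w n Sat Un hcov l hl).trans ?_
  rw [Ex_add, Ex_add, Ex_add, Ex_sum, Ex_sum]
  have e1 : Ex pr n (fun l => 15 * ((Dl l : ℝ) + 1)) ≤ 30 * Real.sqrt n := by
    rw [Ex_mul_left, Ex_add, Ex_const pr_sum]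
    linarith [Ex_Dl n, sqrt_n_ge hn]
  refine add_le_add (add_le_add (add_le_add e1 h0) ?_) ?_
  · refine Finset.sum_le_sum fun s _ => ?_
    rw [Ex_add, Ex_mul_left, Ex_mul_left, Ex_mul_left]
    have := hWS s
    have := Ex_ind_Dl' s n
    gcongr
  · refine Finset.sum_le_sum fun s _ => ?_
    rw [Ex_add, Ex_mul_left, Ex_mul_left, Ex_add]
    have h1 := hWU s
    have h2 := Ex_ind_Dl s n
    have h3 := Ex_Alt' s n
    have h4 : (n : ℝ) / (4 * D.k s) = (1 / 4) * (n / D.k s) := by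
      have := kR s; field_simp
    rw [h4] at h3
    linarith

/-- Weights that are 0/1 on the walk. -/
theorem Ex_RB_small (w : Q → ℕ) (w0 : w 0 = 0) (n : ℕ) (hn : 1 ≤ n) (Sat Un : Finset D.ι)
    (hcov : ∀ s, D.k s ≤ n → s ∈ Sat ∨ s ∈ Un)
    (h1 : ∀ l x, l.length = n → w (q0 Q l x) ≤ 1)
    (h2 : ∀ l s x h, l.length = n → w (((XX D Q l).φ s x).q h) ≤ 1) :
    Ex pr n (fun l => (RB D w l : ℝ)) ≤ 3200 * (Real.sqrt n * (1 + ∑ s ∈ Sat, (Fintype.card (D.Γ s) : ℝ))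
      + n * ∑ s ∈ Un, 1 / (D.k s : ℝ)) := by
  have hW : ∀ (s : D.ι) l, l.length = n → Wt (Q := Q) w s l ≤ Ns Q s l := by
    intro s l hl
    refine Finset.sum_le_sum fun x _ => ?_
    rw [Finset.card_filter]
    refine Finset.sum_le_sum fun h _ => ?_
    split_ifs with hh
    · exact h2 l s x h hl
    · push Not at hh; rw [hh, w0]
  have hW' : ∀ s : D.ι, Ex pr n (fun l => ind s l * (Wt (Q := Q) w s l : ℝ))
      ≤ Ex pr n (fun l => ind s l * (Ns Q s l : ℝ)) := by
    intro s
    refine Ex_mono pr_nonneg fun l hl => ?_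
    have := ind_nonneg s l
    have : (Wt (Q := Q) w s l : ℝ) ≤ Ns Q s l := by exact_mod_cast hW s l hl
    gcongr
  have h0 : Ex pr n (fun l => ((∑ x ∈ Finset.Icc (loW l) (hiW l), w (q0 Q l x) : ℕ) : ℝ))
      ≤ 2 * Real.sqrt n := by
    have : Ex pr n (fun l => ((∑ x ∈ Finset.Icc (loW l) (hiW l), w (q0 Q l x) : ℕ) : ℝ))
        ≤ Ex pr n (fun l => (Dl l : ℝ) + 1) := by
      refine Ex_mono pr_nonneg fun l hl => ?_
      have : ∑ x ∈ Finset.Icc (loW l) (hiW l), w (q0 Q l x) ≤ Dl l + 1 := by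
        refine (Finset.sum_le_sum fun x _ => h1 l x hl).trans ?_
        have := Dl_eq l
        simp; omega
      exact_mod_cast this
    rw [Ex_add, Ex_const pr_sum] at this
    linarith [Ex_Dl n, sqrt_n_ge hn]
  refine (Ex_RB w n hn Sat Un hcov _ _ _ h0 (fun s => (hW' s).trans (Ex_ind_Ns' Q s n))
    (fun s => (hW' s).trans (Ex_ind_Ns Q s n))).trans ?_
  have e1 : ∑ s ∈ Sat, (2400 * (Fintype.card (D.Γ s) * Real.sqrt n) + 2 * (2 * (Fintype.card (D.Γ s) * Real.sqrt n)))
      = 2404 * (Real.sqrt n * ∑ s ∈ Sat, (Fintype.card (D.Γ s) : ℝ)) := by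
    rw [Finset.mul_sum, Finset.mul_sum]; refine Finset.sum_congr rfl fun s _ => by ring
  have e2 : ∑ s ∈ Un, (3000 * (n / (D.k s : ℝ)) + 2 * (80 * (n / (D.k s : ℝ))))
      = 3160 * (n * ∑ s ∈ Un, 1 / (D.k s : ℝ)) := by
    rw [Finset.mul_sum, Finset.mul_sum]; refine Finset.sum_congr rfl fun s _ => by ring
  rw [e1, e2]
  have p1 : 0 ≤ Real.sqrt n * ∑ s ∈ Sat, (Fintype.card (D.Γ s) : ℝ) := by positivity
  have p2 : 0 ≤ (n : ℝ) * ∑ s ∈ Un, 1 / (D.k s : ℝ) := by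
    have : ∀ s, (0 : ℝ) ≤ 1 / (D.k s : ℝ) := fun s => by have := kR s; positivity
    exact mul_nonneg (by positivity) (Finset.sum_nonneg fun s _ => this s)
  have p3 : 0 ≤ Real.sqrt n := by positivity
  nlinarith

theorem abs_le_quad (R : ℝ) (hR : 0 < R) (q : ℤ) :
    ((q.natAbs : ℕ) : ℝ) ≤ (1 / (2 * R)) * (q : ℝ) ^ 2 + (R / 2) * (if q ≠ 0 then 1 else 0) := by
  have : ((q.natAbs : ℕ) : ℝ) = |(q : ℝ)| := by simp
  rw [this]
  split_ifs with h
  · have h1 : 0 ≤ (|(q : ℝ)| - R) ^ 2 := sq_nonneg _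
    rw [sub_sq, sq_abs] at h1
    have : (1 / (2 * R)) * (q : ℝ) ^ 2 + (R / 2) * 1 = ((q : ℝ) ^ 2 + R ^ 2) / (2 * R) := by
      field_simp
    rw [this, le_div_iff₀ (by positivity)]
    nlinarith
  · push Not at h; simp [h]

theorem Wt_natAbs (s : D.ι) (l : List Om) (R : ℝ) (hR : 0 < R) :
    (Wt (Q := ℤ) Int.natAbs s l : ℝ) ≤ (1 / (2 * R)) * Tot (fun y => (y : ℝ) ^ 2) (fS s (xi ℤ) l)
      + (R / 2) * Ns ℤ s l := by
  rw [Tot_q s _ (by simp)]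
  unfold Wt Ns
  push_cast
  rw [Finset.mul_sum, Finset.mul_sum, ← Finset.sum_add_distrib]
  refine Finset.sum_le_sum fun x _ => ?_
  rw [Finset.card_filter]; push_cast
  rw [Finset.mul_sum, Finset.mul_sum, ← Finset.sum_add_distrib]
  refine Finset.sum_le_sum fun h _ => ?_
  have := abs_le_quad R hR (((XX D ℤ l).φ s x).q h)
  simpa using this

theorem Ex_Wt_natAbs (s : D.ι) (n : ℕ) (R : ℝ) (hR : 0 < R) :
    Ex pr n (fun l => ind s l * (Wt (Q := ℤ) Int.natAbs s l : ℝ)) ≤ (1 / (2 * R)) * (n / 8)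
      + (R / 2) * Ex pr n (fun l => ind s l * (Ns ℤ s l : ℝ)) := by
  rw [← Ex_Tot_sq (tauS s) ((0 : ℤ), (1 : D.Γ s)) (tauS_inc s _) n, ← Ex_mul_left, ← Ex_mul_left, ← Ex_add]
  refine Ex_mono pr_nonneg fun l _ => ?_
  have h1 := Wt_natAbs s l R hR
  have h2 := ind_nonneg s l
  have h3 := ind_le s l
  have h4 : 0 ≤ (1 / (2 * R)) * Tot (fun y => (y : ℝ) ^ 2) (fS s (xi ℤ) l) := by
    apply mul_nonneg (by positivity)
    exact tsum_nonneg fun p => sq_nonneg _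
  change _ ≤ (1 / (2 * R)) * Tot (fun y => (y : ℝ) ^ 2) (fS s (xi ℤ) l) + _
  nlinarith

theorem Ex_W0_natAbs (n : ℕ) (hn : 1 ≤ n) (R : ℝ) (hR : 0 < R) :
    Ex pr n (fun l => ((∑ x ∈ Finset.Icc (loW l) (hiW l), (q0 ℤ l x).natAbs : ℕ) : ℝ))
      ≤ (1 / (2 * R)) * (n / 8) + (R / 2) * (2 * Real.sqrt n) := by
  have h : Ex pr n (fun l => (Dl l : ℝ) + 1) ≤ 2 * Real.sqrt n := by
    rw [Ex_add, Ex_const pr_sum]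
    linarith [Ex_Dl n, sqrt_n_ge hn]
  refine le_trans ?_ (add_le_add le_rfl (mul_le_mul_of_nonneg_left h (by positivity)))
  rw [← Ex_Tot_sq tau0 0 (tau0_inc _) n, ← Ex_mul_left, ← Ex_mul_left, ← Ex_add]
  refine Ex_mono pr_nonneg fun l _ => ?_
  rw [Tot_q0 _ (by simp)]
  push_cast
  have : ((Dl l : ℝ) + 1) = ∑ x ∈ Finset.Icc (loW l) (hiW l), (1 : ℝ) := by
    have := Dl_eq l
    have := hiW_nonneg l
    have := loW_nonpos l
    simp
    have : (hiW l + 1 - loW l).toNat = Dl l + 1 := by omega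
    rw [this]; push_cast; ring
  rw [this, Finset.mul_sum, Finset.mul_sum, ← Finset.sum_add_distrib]
  refine Finset.sum_le_sum fun x _ => ?_
  have := abs_le_quad R hR (q0 ℤ l x)
  refine le_trans this ?_
  gcongr
  split_ifs <;> norm_num

theorem Ex_RB_Z (n : ℕ) (hn : 1 ≤ n) (Sat Un : Finset D.ι)
    (hcov : ∀ s, D.k s ≤ n → s ∈ Sat ∨ s ∈ Un) :
    Ex pr n (fun l => (RB D Int.natAbs l : ℝ))
      ≤ 3200 * (Real.sqrt n * (1 + ∑ s ∈ Sat, (Fintype.card (D.Γ s) : ℝ))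
          + n * ∑ s ∈ Un, 1 / (D.k s : ℝ))
        + 3200 * (Real.sqrt n * Real.sqrt (Real.sqrt n) * (1 + ∑ s ∈ Sat, Real.sqrt (Fintype.card (D.Γ s) : ℝ))
          + n * ∑ s ∈ Un, 1 / Real.sqrt (D.k s : ℝ)) := by
  set y := Real.sqrt (Real.sqrt n) with hy
  have hs1 := sqrt_n_ge hn
  have hy1 : 1 ≤ y := by rw [hy, Real.one_le_sqrt]; exact hs1
  have hy2 : y ^ 2 = Real.sqrt n := by rw [hy, Real.sq_sqrt (by positivity)]
  have hy4 : y ^ 4 = n := by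
    rw [show y ^ 4 = (y ^ 2) ^ 2 by ring, hy2, Real.sq_sqrt (by positivity)]
  rw [← hy2, ← hy4]
  have h0 : Ex pr n (fun l => ((∑ x ∈ Finset.Icc (loW l) (hiW l), (q0 ℤ l x).natAbs : ℕ) : ℝ))
      ≤ 2 * y ^ 3 := by
    refine (Ex_W0_natAbs n hn y (by positivity)).trans ?_
    rw [← hy2, ← hy4]
    have : 1 / (2 * y) * (y ^ 4 / 8) + y / 2 * (2 * y ^ 2) = (1 / 16 + 1) * y ^ 3 := by
      field_simp; ring
    rw [this]
    have : 0 ≤ y ^ 3 := by positivity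
    linarith
  have hS : ∀ s : D.ι, Ex pr n (fun l => ind s l * (Wt (Q := ℤ) Int.natAbs s l : ℝ))
      ≤ 2 * (y ^ 3 * Real.sqrt (Fintype.card (D.Γ s) : ℝ)) := by
    intro s
    set z := Real.sqrt (Fintype.card (D.Γ s) : ℝ) with hz
    have hc : (0 : ℝ) < Fintype.card (D.Γ s) := by exact_mod_cast Fintype.card_pos
    have hzp : 0 < z := Real.sqrt_pos.2 hc
    have hz2 : z ^ 2 = Fintype.card (D.Γ s) := Real.sq_sqrt hc.le
    refine (Ex_Wt_natAbs s n (y / z) (by positivity)).trans ?_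
    have h2 := Ex_ind_Ns' ℤ s n
    rw [← hy2, ← hz2] at h2
    refine (add_le_add le_rfl (mul_le_mul_of_nonneg_left h2 (by positivity))).trans ?_
    rw [← hy4]
    have : 1 / (2 * (y / z)) * (y ^ 4 / 8) + y / z / 2 * (2 * (z ^ 2 * y ^ 2)) = (1 / 16 + 1) * (y ^ 3 * z) := by
      field_simp; ring
    rw [this]
    have : 0 ≤ y ^ 3 * z := by positivity
    linarith
  have hU : ∀ s : D.ι, Ex pr n (fun l => ind s l * (Wt (Q := ℤ) Int.natAbs s l : ℝ))
      ≤ 41 * (y ^ 4 * (1 / Real.sqrt (D.k s : ℝ))) := by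
    intro s
    set z := Real.sqrt (D.k s : ℝ) with hz
    have hc : (0 : ℝ) < D.k s := by linarith [kR s]
    have hzp : 0 < z := Real.sqrt_pos.2 hc
    have hz2 : z ^ 2 = D.k s := Real.sq_sqrt hc.le
    refine (Ex_Wt_natAbs s n z (by positivity)).trans ?_
    have h2 := Ex_ind_Ns ℤ s n
    rw [← hy4, ← hz2] at h2
    refine (add_le_add le_rfl (mul_le_mul_of_nonneg_left h2 (by positivity))).trans ?_
    rw [← hy4]
    have : 1 / (2 * z) * (y ^ 4 / 8) + z / 2 * (80 * (y ^ 4 / z ^ 2)) = (1 / 16 + 40) * (y ^ 4 * (1 / z)) := by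
      field_simp; ring
    rw [this]
    have : 0 ≤ y ^ 4 * (1 / z) := by positivity
    linarith
  refine (Ex_RB Int.natAbs n hn Sat Un hcov _ _ _ h0 hS hU).trans ?_
  rw [← hy2, ← hy4, Finset.sum_add_distrib, Finset.sum_add_distrib]
  have e1 : ∑ s ∈ Sat, 2400 * ((Fintype.card (D.Γ s) : ℝ) * y ^ 2)
      = 2400 * (y ^ 2 * ∑ s ∈ Sat, (Fintype.card (D.Γ s) : ℝ)) := by
    rw [Finset.mul_sum, Finset.mul_sum]; exact Finset.sum_congr rfl fun s _ => by ring
  have e2 : ∑ s ∈ Un, 3000 * (y ^ 4 / (D.k s : ℝ)) = 3000 * (y ^ 4 * ∑ s ∈ Un, 1 / (D.k s : ℝ)) := by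
    rw [Finset.mul_sum, Finset.mul_sum]; exact Finset.sum_congr rfl fun s _ => by ring
  have e3 : ∑ s ∈ Sat, 2 * (2 * (y ^ 3 * Real.sqrt (Fintype.card (D.Γ s) : ℝ)))
      = 4 * (y ^ 3 * ∑ s ∈ Sat, Real.sqrt (Fintype.card (D.Γ s) : ℝ)) := by
    rw [Finset.mul_sum, Finset.mul_sum]; exact Finset.sum_congr rfl fun s _ => by ring
  have e4 : ∑ s ∈ Un, 2 * (41 * (y ^ 4 * (1 / Real.sqrt (D.k s : ℝ))))
      = 82 * (y ^ 4 * ∑ s ∈ Un, 1 / Real.sqrt (D.k s : ℝ)) := by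
    rw [Finset.mul_sum, Finset.mul_sum]; exact Finset.sum_congr rfl fun s _ => by ring
  rw [e1, e2, e3, e4]
  have p1 : 0 ≤ y ^ 2 * ∑ s ∈ Sat, (Fintype.card (D.Γ s) : ℝ) := by positivity
  have hk : ∀ s : D.ι, (0 : ℝ) ≤ D.k s := fun s => by linarith [kR s]
  have p2 : 0 ≤ y ^ 4 * ∑ s ∈ Un, 1 / (D.k s : ℝ) :=
    mul_nonneg (by positivity) (Finset.sum_nonneg fun s _ => one_div_nonneg.2 (hk s))
  have p3 : 0 ≤ y ^ 3 * ∑ s ∈ Sat, Real.sqrt (Fintype.card (D.Γ s) : ℝ) := by positivity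
  have p4 : 0 ≤ y ^ 4 * ∑ s ∈ Un, 1 / Real.sqrt (D.k s : ℝ) := by positivity
  have p5 : 0 ≤ y ^ 3 := by positivity
  have p6 : 0 ≤ y ^ 2 := by positivity
  have e5 : y ^ 2 * y = y ^ 3 := by ring
  rw [e5]
  linarith

end Upper
end SE

namespace SE

set_option linter.unusedSectionVars false
set_option linter.unusedVariables false
set_option linter.unusedSimpArgs false

section Low
variable {D : Sys}

/-- Averaging operator. -/
noncomputable def TT {G : Type} [Group G] (h : AA →* G) (π : G → ℝ) (g : G) : ℝ :=
  avg (fun α => π (h α * g))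

/-- Visit counts. -/
noncomputable def VV (s : D.ι) (l : List Om) : ℤ × D.Γ s → ℤ := fS s (fun _ => 1) l

noncomputable def PP (s : D.ι) (n : ℕ) (π : D.Γ s → ℝ) (x : ℤ) : ℝ :=
  Ex pr n (fun l => ∑ g, π g * (VV s l (x, g) : ℝ))

theorem PP_avg (s : D.ι) (n : ℕ) (π : D.Γ s → ℝ) (x : ℤ) (h : AA →* D.Γ s) :
    avg (fun α => Ex pr n (fun l => ∑ g, π g * (VV s l (x, (h α)⁻¹ * g) : ℝ)))
      = PP s n (TT h π) x := by
  unfold avg PP TT avg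
  rw [← Ex_sum, ← Ex_mul_left]
  refine Ex_congr fun l _ => ?_
  have e : ∀ α, ∑ g, π g * (VV s l (x, (h α)⁻¹ * g) : ℝ) = ∑ g, π (h α * g) * (VV s l (x, g) : ℝ) := by
    intro α
    rw [← Equiv.sum_comp (Equiv.mulLeft (h α))]
    simp
  simp only [e]
  rw [Finset.sum_comm, Finset.mul_sum]
  refine Finset.sum_congr rfl fun g _ => ?_
  rw [← Finset.sum_mul]; ring

theorem TT_one {G : Type} [Group G] (π : G → ℝ) : TT (1 : AA →* G) π = π := by
  funext g; simp [TT, avg_const]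

theorem PP_succ (s : D.ι) (n : ℕ) (π : D.Γ s → ℝ) (x : ℤ) :
    PP s (n + 1) π x = (1 / 8) * (PP s n π (x - 1) + PP s n π (x + 1))
      + (1 / 4) * (PP s n (if x = D.k s then TT (D.ha s) π else π) x)
      + (1 / 4) * (PP s n (if x = - D.k s then TT (D.hb s) π else π) x)
      + (1 / 4) * PP s n π x + (1 / 4) * (if x = 0 then π 1 else 0) := by
  have e1 : (if x = D.k s then TT (D.ha s) π else π)
      = TT (if x = D.k s then D.ha s else 1) π := by
    split_ifs <;> simp [TT_one]
  have e2 : (if x = - D.k s then TT (D.hb s) π else π)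
      = TT (if x = - D.k s then D.hb s else 1) π := by
    split_ifs <;> simp [TT_one]
  rw [e1, e2, ← PP_avg, ← PP_avg]
  unfold PP
  rw [Ex_step]
  have c1 : ∀ e l g, VV s (Sum.inl e :: l) (x, g) = VV s l (x - dir e, g) := by
    intro e l g; simp [VV, fS, gfl, tauS, inc, Equiv.prodShear]
  have c2 : ∀ α l g, VV s (Sum.inr (Sum.inl α) :: l) (x, g)
      = VV s l (x, ((if x = D.k s then D.ha s else 1 : AA →* D.Γ s) α)⁻¹ * g) := by
    intro e l g; simp [VV, fS, gfl, tauS, inc, Equiv.prodShear]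
    split_ifs <;> simp
  have c3 : ∀ α l g, VV s (Sum.inr (Sum.inr (Sum.inl α)) :: l) (x, g)
      = VV s l (x, ((if x = - D.k s then D.hb s else 1 : AA →* D.Γ s) α)⁻¹ * g) := by
    intro e l g; simp [VV, fS, gfl, tauS, inc, Equiv.prodShear]
    split_ifs <;> simp
  have c4 : ∀ e l g, VV s (Sum.inr (Sum.inr (Sum.inr e)) :: l) (x, g)
      = VV s l (x, g) + if x = 0 ∧ g = 1 then 1 else 0 := by
    intro e l g; simp [VV, fS, gfl, tauS, inc]
  have c5 : ∀ l, ∑ g, π g * ((VV s l (x, g) + if x = 0 ∧ g = 1 then 1 else 0 : ℤ) : ℝ)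
      = ∑ g, π g * (VV s l (x, g) : ℝ) + (if x = 0 then π 1 else 0) := by
    intro l
    push_cast
    simp only [mul_add, Finset.sum_add_distrib]
    by_cases hx : x = 0 <;> simp [hx]
  simp only [c1, c2, c3, c4, c5, Ex_add, Ex_const pr_sum]
  generalize (if x = 0 then π 1 else 0) = w
  simp [dir]
  ring

/-- Position of the side `e`. -/
noncomputable def hE (s : D.ι) (e : Bool) : AA →* D.Γ s := if e then D.ha s else D.hb s

noncomputable def piE (s : D.ι) : ℕ → Bool → D.Γ s → ℝ
  | 0, _ => fun g => if g = 1 then 1 else 0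
  | j + 1, e => TT (hE s e) (piE s j (!e))

theorem TT_idem {G : Type} [Group G] (h : AA →* G) (π : G → ℝ) : TT h (TT h π) = TT h π := by
  funext g
  unfold TT
  have : ∀ α, avg (fun β => π (h β * (h α * g))) = avg (fun β => π (h β * g)) := by
    intro α
    unfold avg
    congr 1
    rw [← Equiv.sum_comp (Equiv.mulRight α⁻¹)]
    refine Finset.sum_congr rfl fun β _ => ?_
    congr 1
    simp [mul_assoc]
  simp only [this, avg_const]

noncomputable def UU (s : D.ι) (n j : ℕ) (e : Bool) (y : ℤ) : ℝ := PP s n (piE s j e) (dir e * y)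

theorem UU_succ (s : D.ι) (n j : ℕ) (hj : 1 ≤ j) (e : Bool) (y : ℤ) :
    UU s (n + 1) j e y = (1 / 8) * (UU s n j e (y - 1) + UU s n j e (y + 1)) + (3 / 4) * UU s n j e y
      + (1 / 4) * (if y = - D.k s then UU s n (j + 1) (!e) (D.k s) - UU s n j e (- D.k s) else 0)
      + (1 / 4) * (if y = 0 then piE s j e 1 else 0) := by
  unfold UU
  rw [PP_succ]
  obtain ⟨i, rfl⟩ : ∃ i, j = i + 1 := ⟨j - 1, by omega⟩
  have hk := D.k_pos s
  have hT : TT (hE s e) (piE s (i + 1) e) = piE s (i + 1) e := by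
    simp only [piE]; exact TT_idem _ _
  have hT2 : TT (hE s (!e)) (piE s (i + 1) e) = piE s (i + 1 + 1) (!e) := by
    simp [piE]
  cases e
  · simp only [hE, dir, Bool.not_false, if_true, Bool.false_eq_true, if_false] at *
    simp only [neg_one_mul, one_mul]
    by_cases h1 : y = - D.k s
    · have h2 : ¬ (y = 0) := by omega
      subst h1
      simp [hT2, show ¬ (D.k s = - D.k s) by omega, show ¬ (D.k s = 0) by omega]
      ring_nf
    · by_cases h3 : y = D.k s
      · subst h3
        simp [hT, show ¬ (- D.k s = D.k s) by omega, show ¬ (D.k s = 0) by omega, h1]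
        ring_nf
      · simp [h1, h3, show ¬ (- y = D.k s) by omega, show ¬ (- y = - D.k s) by omega]
        ring_nf
  · simp only [hE, dir, Bool.not_true, if_true, Bool.false_eq_true, if_false] at *
    simp only [neg_one_mul, one_mul]
    by_cases h1 : y = - D.k s
    · have h2 : ¬ (y = 0) := by omega
      subst h1
      simp [hT2, show ¬ (- D.k s = D.k s) by omega, show ¬ (D.k s = 0) by omega]
      ring
    · by_cases h3 : y = D.k s
      · subst h3
        simp [hT, show ¬ (D.k s = - D.k s) by omega, show ¬ (D.k s = 0) by omega]
        ring
      · simp [h1, h3]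
        ring

theorem PP0_succ (s : D.ι) (n : ℕ) (y : ℤ) :
    PP s (n + 1) (piE s 0 true) y = (1 / 8) * (PP s n (piE s 0 true) (y - 1) + PP s n (piE s 0 true) (y + 1))
      + (3 / 4) * PP s n (piE s 0 true) y
      + (1 / 4) * (if y = D.k s then UU s n 1 true (D.k s) - PP s n (piE s 0 true) (D.k s) else 0)
      + (1 / 4) * (if y = - D.k s then UU s n 1 false (D.k s) - PP s n (piE s 0 true) (- D.k s) else 0)
      + (1 / 4) * (if y = 0 then 1 else 0) := by
  unfold UU
  rw [PP_succ]
  have hk := D.k_pos s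
  have h1 : TT (D.ha s) (piE s 0 true) = piE s 1 true := by
    simp [piE, hE]
  have h2 : TT (D.hb s) (piE s 0 true) = piE s 1 false := by
    simp [piE, hE]
  rw [h1, h2]
  by_cases h1 : y = D.k s
  · subst h1
    simp [show ¬ (D.k s = - D.k s) by omega, show ¬ (D.k s = 0) by omega, dir]
    ring
  · by_cases h3 : y = - D.k s
    · subst h3
      simp [show ¬ (- D.k s = D.k s) by omega, show ¬ (D.k s = 0) by omega, dir]
      ring
    · simp [h1, h3, piE]
      ring

/-- Local time bound. -/
noncomputable def BB (n : ℕ) (x : ℤ) : ℝ := Real.sqrt ((x : ℝ) ^ 2 + n / 4) - |(x : ℝ)|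

theorem BB_nonneg (n : ℕ) (x : ℤ) : 0 ≤ BB n x := by
  unfold BB
  rw [sub_nonneg]
  apply Real.abs_le_sqrt
  have : (0 : ℝ) ≤ n / 4 := by positivity
  linarith

theorem BB_succ (n : ℕ) (x : ℤ) : (1 / 8) * (BB n (x - 1) + BB n (x + 1)) + (3 / 4) * BB n x
    + (1 / 4) * (if x = 0 then 1 else 0) ≤ BB (n + 1) x := by
  unfold BB
  have h1 : (1 / 8) * (|((x - 1 : ℤ) : ℝ)| + |((x + 1 : ℤ) : ℝ)|) + (3 / 4) * |(x : ℝ)|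
      = |(x : ℝ)| + (1 / 4) * (if x = 0 then 1 else 0) := by
    push_cast
    rcases lt_trichotomy x 0 with h | h | h
    · have : (x : ℝ) ≤ -1 := by exact_mod_cast (by omega : x ≤ -1)
      rw [abs_of_nonpos (by linarith), abs_of_nonpos (by linarith), abs_of_nonpos (by linarith)]
      simp [h.ne]; ring
    · subst h; norm_num
    · have : (1 : ℝ) ≤ x := by exact_mod_cast (by omega : 1 ≤ x)
      rw [abs_of_nonneg (by linarith), abs_of_nonneg (by linarith), abs_of_nonneg (by linarith)]
      simp [h.ne']; ring
  set a := Real.sqrt (((x - 1 : ℤ) : ℝ) ^ 2 + n / 4) with ha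
  set b := Real.sqrt (((x + 1 : ℤ) : ℝ) ^ 2 + n / 4) with hb
  set c := Real.sqrt ((x : ℝ) ^ 2 + n / 4) with hc
  have a2 : a ^ 2 = ((x - 1 : ℤ) : ℝ) ^ 2 + n / 4 := Real.sq_sqrt (by positivity)
  have b2 : b ^ 2 = ((x + 1 : ℤ) : ℝ) ^ 2 + n / 4 := Real.sq_sqrt (by positivity)
  have c2 : c ^ 2 = (x : ℝ) ^ 2 + n / 4 := Real.sq_sqrt (by positivity)
  have h2 : (1 / 8) * (a + b) + (3 / 4) * c ≤ Real.sqrt ((x : ℝ) ^ 2 + ((n + 1 : ℕ) : ℝ) / 4) := by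
    apply Real.le_sqrt_of_sq_le
    push_cast at *
    nlinarith [sq_nonneg (a - b), sq_nonneg (a - c), sq_nonneg (b - c)]
  linarith

/-- One-sided potential. -/
noncomputable def uu (k x : ℤ) : ℝ := 1 + 2 * ((min (max (x + k) 0) k : ℤ) : ℝ)
noncomputable def u0 (k x : ℤ) : ℝ := 1 + 2 * ((max (k - |x|) 0 : ℤ) : ℝ)

theorem uu_succ (k : ℤ) (hk : 1 ≤ k) (x : ℤ) : (1 / 8) * (uu k (x - 1) + uu k (x + 1)) + (3 / 4) * uu k x
    = uu k x + (1 / 4) * (if x = - k then 1 else 0) - (1 / 4) * (if x = 0 then 1 else 0) := by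
  have h : min (max (x - 1 + k) 0) k + min (max (x + 1 + k) 0) k
      = 2 * min (max (x + k) 0) k + (if x = - k then 1 else 0) - (if x = 0 then 1 else 0) := by
    split_ifs <;> omega
  have h' := congrArg (Int.cast : ℤ → ℝ) h
  push_cast at h'
  unfold uu
  push_cast
  linarith

theorem u0_succ (k : ℤ) (hk : 1 ≤ k) (x : ℤ) : (1 / 8) * (u0 k (x - 1) + u0 k (x + 1)) + (3 / 4) * u0 k x
    = u0 k x + (1 / 4) * (if x = k then 1 else 0) + (1 / 4) * (if x = - k then 1 else 0)
      - (1 / 2) * (if x = 0 then 1 else 0) := by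
  have h : max (k - |x - 1|) 0 + max (k - |x + 1|) 0
      = 2 * max (k - |x|) 0 + (if x = k then 1 else 0) + (if x = - k then 1 else 0)
        - 2 * (if x = 0 then 1 else 0) := by
    have e1 := abs_cases x
    have e2 := abs_cases (x - 1)
    have e3 := abs_cases (x + 1)
    split_ifs <;> omega
  have h' := congrArg (Int.cast : ℤ → ℝ) h
  push_cast at h'
  unfold u0
  push_cast
  linarith

/-- Decay hypothesis on the return probabilities. -/
def Decay (s : D.ι) (C : ℝ) : Prop :=
  ∀ j e, 1 ≤ j → piE s j e 1 ≤ C / (j : ℝ) ^ 2 + C / Fintype.card (D.Γ s)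

noncomputable def FF (C : ℝ) (j : ℕ) : ℝ := 2 * C * (1 / j - 1 / (j + 1))

theorem UU_le (s : D.ι) (C : ℝ) (hC : 0 ≤ C) (hd : Decay s C) (n : ℕ) : ∀ (j : ℕ) (e : Bool) (y : ℤ), 1 ≤ j →
    UU s n j e y ≤ FF C j * uu (D.k s) y + (2 * D.k s + 1) * (2 * C / (j + 1))
      + (C / Fintype.card (D.Γ s)) * BB n y := by
  have hk := D.k_pos s
  have hkR := kR s
  have hF : ∀ j : ℕ, 1 ≤ j → 0 ≤ FF C j := by
    intro j hj
    unfold FF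
    have : (1 : ℝ) ≤ j := by exact_mod_cast hj
    have h2 : (0 : ℝ) ≤ 1 / j - 1 / (j + 1) := by
      rw [sub_nonneg]; apply one_div_le_one_div_of_le <;> linarith
    positivity
  induction n with
  | zero =>
    intro j e y hj
    have h1 := hF j hj
    have h2 : 0 ≤ uu (D.k s) y := by
      unfold uu
      have : 0 ≤ min (max (y + D.k s) 0) (D.k s) := by omega
      have : (0 : ℝ) ≤ ((min (max (y + D.k s) 0) (D.k s) : ℤ) : ℝ) := by exact_mod_cast this
      linarith
    have h3 := BB_nonneg 0 y
    have : UU s 0 j e y = 0 := by simp [UU, PP, Ex_zero, VV, fS, gfl]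
    rw [this]
    positivity
  | succ n ih =>
    intro j e y hj
    rw [UU_succ s n j hj]
    have i1 := ih j e (y - 1) hj
    have i2 := ih j e (y + 1) hj
    have i3 := ih j e y hj
    have i4 := ih (j + 1) (!e) (D.k s) (by omega)
    have hB := mul_le_mul_of_nonneg_left (BB_succ n y)
      (show 0 ≤ C / (Fintype.card (D.Γ s) : ℝ) by positivity)
    have hu := congrArg (fun z => FF C j * z) (uu_succ (D.k s) (by omega) y)
    have hj' : (1 : ℝ) ≤ j := by exact_mod_cast hj
    by_cases h1 : y = - D.k s
    · subst h1
      have hBk : BB n (D.k s) = BB n (- D.k s) := by simp [BB]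
      have hu1 : uu (D.k s) (D.k s) = 2 * D.k s + 1 := by
        unfold uu; rw [show min (max (D.k s + D.k s) 0) (D.k s) = D.k s by omega]; ring
      have hu2 : uu (D.k s) (- D.k s) = 1 := by
        unfold uu; rw [show min (max (- D.k s + D.k s) 0) (D.k s) = 0 by omega]; simp
      rw [hu1, hBk] at i4
      rw [hu2] at i3 ⊢
      have hd0 : ¬ (- D.k s = 0) := by omega
      simp only [if_true, hd0, if_false, hu2] at hB hu ⊢
      have hFj : FF C (j + 1) * (2 * D.k s + 1) + (2 * D.k s + 1) * (2 * C / (((j + 1 : ℕ) : ℝ) + 1))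
          = (2 * D.k s + 1) * (2 * C / (j + 1)) := by
        unfold FF; push_cast; field_simp; ring
      linarith
    · by_cases h0 : y = 0
      · subst h0
        have hp := hd j e hj
        have hFp : C / (j : ℝ) ^ 2 ≤ FF C j := by
          unfold FF
          rw [div_sub_div _ _ (by linarith) (by linarith), mul_div_assoc', div_le_div_iff₀ (by positivity) (by positivity)]
          have : 0 ≤ C * (j : ℝ) * ((j : ℝ) - 1) := by
            apply mul_nonneg (by positivity); linarith
          nlinarith
        have hd2 : ¬ ((0 : ℤ) = - D.k s) := by omega
        simp only [hd2, if_true, if_false] at hB hu ⊢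
        linarith
      · simp only [h1, h0, if_false] at hB hu ⊢
        linarith

theorem v_le (s : D.ι) (C : ℝ) (hC : 0 ≤ C) (hd : Decay s C) (n : ℕ) : ∀ (y : ℤ),
    PP s n (piE s 0 true) y ≤ u0 (D.k s) y + (2 * D.k s + 1) * (2 * C)
      + (C / Fintype.card (D.Γ s)) * BB n y := by
  have hk := D.k_pos s
  have hkR := kR s
  induction n with
  | zero =>
    intro y
    have h2 : 0 ≤ u0 (D.k s) y := by
      unfold u0
      have : (0 : ℝ) ≤ ((max (D.k s - |y|) 0 : ℤ) : ℝ) := by exact_mod_cast le_max_right _ _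
      linarith
    have h3 := BB_nonneg 0 y
    have : PP s 0 (piE s 0 true) y = 0 := by simp [UU, PP, Ex_zero, VV, fS, gfl]
    rw [this]
    positivity
  | succ n ih =>
    intro y
    rw [PP0_succ]
    have i1 := ih (y - 1)
    have i2 := ih (y + 1)
    have i3 := ih y
    have i4 := UU_le s C hC hd n 1 true (D.k s) le_rfl
    have i5 := UU_le s C hC hd n 1 false (D.k s) le_rfl
    have hB := mul_le_mul_of_nonneg_left (BB_succ n y)
      (show 0 ≤ C / (Fintype.card (D.Γ s) : ℝ) by positivity)
    have hu := u0_succ (D.k s) (by omega) y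
    have hu1 : uu (D.k s) (D.k s) = 2 * D.k s + 1 := by
      unfold uu; rw [show min (max (D.k s + D.k s) 0) (D.k s) = D.k s by omega]; ring
    have hFj : FF C 1 * (2 * D.k s + 1) + (2 * D.k s + 1) * (2 * C / (((1 : ℕ) : ℝ) + 1))
          = (2 * D.k s + 1) * (2 * C) := by
        unfold FF; push_cast; ring
    rw [hu1, hFj] at i4 i5
    by_cases h1 : y = D.k s
    · subst h1
      have hu2 : u0 (D.k s) (D.k s) = 1 := by
        unfold u0; rw [show max (D.k s - |D.k s|) 0 = 0 by rw [abs_of_nonneg (by omega)]; omega]; simp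
      have hd0 : ¬ (D.k s = 0) := by omega
      have hd1 : ¬ (D.k s = - D.k s) := by omega
      rw [hu2] at i3 ⊢
      simp only [if_true, hd0, hd1, if_false, hu2] at hB hu ⊢
      linarith
    · by_cases h2 : y = - D.k s
      · subst h2
        have hBk : BB n (D.k s) = BB n (- D.k s) := by simp [BB]
        have hu2 : u0 (D.k s) (- D.k s) = 1 := by
          unfold u0; rw [show max (D.k s - |- D.k s|) 0 = 0 by rw [abs_neg, abs_of_nonneg (by omega)]; omega]; simp
        have hd0 : ¬ (- D.k s = 0) := by omega
        rw [hu2] at i3 ⊢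
        rw [hBk] at i5
        simp only [if_true, hd0, h1, if_false, hu2] at hB hu ⊢
        linarith
      · simp only [h1, h2, if_false] at hu ⊢
        have hCl : 0 ≤ C / (Fintype.card (D.Γ s) : ℝ) := by positivity
        split_ifs at hu hB ⊢ with h0
        · linarith
        · linarith

/-- Bound on the mean number of visits to the origin. -/
theorem v_origin (s : D.ι) (C : ℝ) (hC : 0 ≤ C) (hd : Decay s C) (n : ℕ) :
    Ex pr n (fun l => (VV s l ((0 : ℤ), (1 : D.Γ s)) : ℝ))
      ≤ (2 * D.k s + 1) * (1 + 2 * C) + C * (Real.sqrt n / Fintype.card (D.Γ s)) := by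
  have h := v_le s C hC hd n 0
  have e : PP s n (piE s 0 true) 0 = Ex pr n (fun l => (VV s l ((0 : ℤ), (1 : D.Γ s)) : ℝ)) := by
    unfold PP; refine Ex_congr fun l _ => ?_
    simp [piE]
  rw [e] at h
  have hk := D.k_pos s
  have hu2 : u0 (D.k s) 0 = 2 * D.k s + 1 := by
    unfold u0; rw [show max (D.k s - |0|) 0 = D.k s by simp; omega]; ring
  have hB : BB n 0 ≤ Real.sqrt n := by
    unfold BB; simp
    apply div_le_self (by positivity)
    rw [Real.one_le_sqrt]; norm_num
  rw [hu2] at h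
  have : C / (Fintype.card (D.Γ s) : ℝ) * BB n 0 ≤ C * (Real.sqrt n / Fintype.card (D.Γ s)) := by
    rw [div_mul_eq_mul_div, mul_div_assoc]; gcongr
  linarith

end Low
end SE

namespace SE

set_option linter.unusedSectionVars false
set_option linter.unusedVariables false
set_option linter.unusedSimpArgs false

section Low
variable {D : Sys}

theorem VV_nonneg (s : D.ι) : ∀ (l : List Om) (p : ℤ × D.Γ s), 0 ≤ VV s l p
  | [], p => by simp [VV, fS, gfl]
  | ω :: l, p => by
    have h := VV_nonneg s l (tauS s ω p)
    simp only [VV, fS, gfl] at *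
    refine add_nonneg h ?_
    split_ifs
    · rcases ω with e | α | α | e <;> simp [inc]
    · rfl

theorem Ex_V1 (s : D.ι) (n : ℕ) : Ex pr n (fun l => Tot (fun y => (y : ℝ)) (VV s l)) = n / 4 := by
  unfold VV fS
  induction n with
  | zero => simp [Ex_zero, gfl, Tot]
  | succ n ih =>
    rw [Ex_Tot _ _ _ (tauS_inc s _) _ (by simp), ih]
    have : Ex pr n (fun l => (1 / 16) * ∑ e : Bool × Bool, (((gfl (tauS s) ((0 : ℤ), (1 : D.Γ s)) (fun _ => 1) l (0, 1) + 1 : ℤ) : ℝ)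
        - (gfl (tauS s) ((0 : ℤ), (1 : D.Γ s)) (fun _ => 1) l (0, 1) : ℝ))) = Ex pr n (fun l => (1 / 4 : ℝ)) := by
      refine Ex_congr fun l _ => ?_
      push_cast; simp; norm_num
    rw [this, Ex_const pr_sum]; push_cast; ring

theorem Ex_V2 (s : D.ι) (n : ℕ) (M : ℝ)
    (hM : ∀ j < n, Ex pr j (fun l => (VV s l ((0 : ℤ), (1 : D.Γ s)) : ℝ)) ≤ M) :
    Ex pr n (fun l => Tot (fun y => (y : ℝ) ^ 2) (VV s l)) ≤ n / 4 + n * M / 2 := by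
  induction n with
  | zero => simp [Ex_zero, gfl, Tot, VV, fS]
  | succ n ih =>
    have ih := ih fun j hj => hM j (by omega)
    have h1 := hM n (by omega)
    unfold VV fS at *
    rw [Ex_Tot _ _ _ (tauS_inc s _) _ (by simp)]
    have : Ex pr n (fun l => (1 / 16) * ∑ e : Bool × Bool, (((gfl (tauS s) ((0 : ℤ), (1 : D.Γ s)) (fun _ => 1) l (0, 1) + 1 : ℤ) : ℝ) ^ 2
        - (gfl (tauS s) ((0 : ℤ), (1 : D.Γ s)) (fun _ => 1) l (0, 1) : ℝ) ^ 2))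
        = Ex pr n (fun l => (1 / 4 : ℝ) + (1 / 2) * (gfl (tauS s) ((0 : ℤ), (1 : D.Γ s)) (fun _ => 1) l (0, 1) : ℝ)) := by
      refine Ex_congr fun l _ => ?_
      push_cast; simp; ring
    rw [this, Ex_add, Ex_mul_left, Ex_const pr_sum]; push_cast; linarith

/-- Number of visited points. -/
noncomputable def NV (s : D.ι) (l : List Om) : ℝ := Tot (fun y => if y = 0 then 0 else 1) (VV s l)

theorem low_N (s : D.ι) (n : ℕ) (M : ℝ) (hM0 : 0 ≤ M)
    (hM : ∀ j < n, Ex pr j (fun l => (VV s l ((0 : ℤ), (1 : D.Γ s)) : ℝ)) ≤ M) :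
    n / (4 * (1 + 2 * M)) ≤ Ex pr n (fun l => NV s l) := by
  set R : ℝ := 1 + 2 * M with hR
  have hRp : 0 < R := by linarith
  have key : ∀ l, 2 / R * Tot (fun y => (y : ℝ)) (VV s l) - 1 / R ^ 2 * Tot (fun y => (y : ℝ) ^ 2) (VV s l) ≤ NV s l := by
    intro l
    have s1 := gfl_summable (tauS s) ((0 : ℤ), (1 : D.Γ s)) (fun _ => 1) (fun y => (y : ℝ)) (by simp) l (Equiv.refl _)
    have s2 := gfl_summable (tauS s) ((0 : ℤ), (1 : D.Γ s)) (fun _ => 1) (fun y => (y : ℝ) ^ 2) (by simp) l (Equiv.refl _)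
    have s3 := gfl_summable (tauS s) ((0 : ℤ), (1 : D.Γ s)) (fun _ => 1) (fun y => if y = 0 then 0 else 1) (by simp) l (Equiv.refl _)
    simp only [Equiv.refl_apply] at s1 s2 s3
    unfold NV Tot VV fS
    beta_reduce
    rw [← tsum_mul_left, ← tsum_mul_left, ← (s1.mul_left _).tsum_sub (s2.mul_left _)]
    refine Summable.tsum_le_tsum ?_ ((s1.mul_left _).sub (s2.mul_left _)) s3
    intro p
    set y := gfl (tauS s) ((0 : ℤ), (1 : D.Γ s)) (fun _ => 1) l p
    split_ifs with h
    · simp [h]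
    · have : 2 / R * (y : ℝ) - 1 / R ^ 2 * (y : ℝ) ^ 2 = 1 - (1 - y / R) ^ 2 := by field_simp; ring
      rw [this]; nlinarith [sq_nonneg (1 - y / R)]
  have h := Ex_mono (n := n) pr_nonneg (fun l (_ : l.length = n) => key l)
  refine le_trans ?_ h
  rw [Ex_sub, Ex_mul_left, Ex_mul_left, Ex_V1]
  have h2 := mul_le_mul_of_nonneg_left (Ex_V2 s n M hM) (show 0 ≤ 1 / R ^ 2 by positivity)
  have : (n : ℝ) / (4 * R) = 2 / R * (n / 4) - 1 / R ^ 2 * (n / 4 + n * M / 2) := by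
    have : M = (R - 1) / 2 := by rw [hR]; ring
    rw [this]; field_simp; ring
  rw [this]; linarith

theorem Ex_q2 (s : D.ι) (n : ℕ) : ∀ p : ℤ × D.Γ s, Ex pr n (fun l => (fS s (xi ℤ) l p : ℝ) ^ 2)
    = (1 / 2) * Ex pr n (fun l => (VV s l p : ℝ)) := by
  induction n with
  | zero => intro p; simp [Ex_zero, gfl, VV, fS]
  | succ n ih =>
    intro p
    rw [Ex_step, Ex_step]
    have c : ∀ ω ξ l, inc ξ ω = 0 → fS s ξ (ω :: l) p = fS s ξ l (tauS s ω p) := by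
      intro ω ξ l h; simp [fS, gfl, h]
    have c1 : ∀ e l ξ, fS s ξ (Sum.inl e :: l) p = fS s ξ l (tauS s (Sum.inl e) p) := fun _ _ _ => c _ _ _ rfl
    have c2 : ∀ e l ξ, fS s ξ (Sum.inr (Sum.inl e) :: l) p = fS s ξ l (tauS s (Sum.inr (Sum.inl e)) p) := fun _ _ _ => c _ _ _ rfl
    have c3 : ∀ e l ξ, fS s ξ (Sum.inr (Sum.inr (Sum.inl e)) :: l) p = fS s ξ l (tauS s (Sum.inr (Sum.inr (Sum.inl e))) p) := fun _ _ _ => c _ _ _ rfl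
    have c4 : ∀ e l ξ, fS s ξ (Sum.inr (Sum.inr (Sum.inr e)) :: l) p = fS s ξ l p + if p = (0, 1) then ξ e else 0 := fun _ _ _ => by
      simp [fS, gfl, tauS, inc]
    simp only [VV, c1, c2, c3, c4] at *
    simp only [ih]
    have h4 : ∑ e : Bool × Bool, Ex pr n (fun l => ((fS s (xi ℤ) l p + if p = (0, 1) then xi ℤ e else 0 : ℤ) : ℝ) ^ 2)
        = (1 / 2) * ∑ e : Bool × Bool, Ex pr n (fun l => ((fS s (fun _ => 1) l p + if p = (0, 1) then 1 else 0 : ℤ) : ℝ)) := by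
      rw [← Ex_sum, ← Ex_sum]
      have e1 : ∀ l, ∑ e : Bool × Bool, ((fS s (xi ℤ) l p + if p = (0, 1) then xi ℤ e else 0 : ℤ) : ℝ) ^ 2
        = 4 * (fS s (xi ℤ) l p : ℝ) ^ 2 + if p = (0, 1) then 2 else 0 := by
        intro l
        rw [Fintype.sum_prod_type]
        split_ifs <;> simp [xi] <;> ring
      have e2 : ∀ l, ∑ e : Bool × Bool, ((fS s (fun _ => 1) l p + if p = (0, 1) then 1 else 0 : ℤ) : ℝ)
        = 4 * (fS s (fun _ => 1) l p : ℝ) + if p = (0, 1) then 4 else 0 := by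
        intro l
        rw [Fintype.sum_prod_type]
        split_ifs <;> simp <;> ring
      simp only [e1, e2]
      rw [Ex_add, Ex_add, Ex_mul_left, Ex_mul_left, Ex_const pr_sum, Ex_const pr_sum, ih]
      split_ifs <;> ring
    rw [h4]
    unfold avg
    simp only [← Finset.mul_sum]
    ring

theorem Ex_q4 (s : D.ι) (n : ℕ) (M : ℝ)
    (hM : ∀ j < n, Ex pr j (fun l => (VV s l ((0 : ℤ), (1 : D.Γ s)) : ℝ)) ≤ M) :
    Ex pr n (fun l => Tot (fun y => (y : ℝ) ^ 4) (fS s (xi ℤ) l)) ≤ n * (1 + 3 * M) / 8 := by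
  induction n with
  | zero => simp [Ex_zero, gfl, Tot, VV, fS]
  | succ n ih =>
    have ih := ih fun j hj => hM j (by omega)
    have h1 := hM n (by omega)
    have h2 := Ex_q2 s n (0, 1)
    have : Ex pr n (fun l => (1 / 16) * ∑ e : Bool × Bool, (((fS s (xi ℤ) l (0, 1) + xi ℤ e : ℤ) : ℝ) ^ 4
        - (fS s (xi ℤ) l (0, 1) : ℝ) ^ 4))
        = Ex pr n (fun l => (1 / 8 : ℝ) + (3 / 4) * (fS s (xi ℤ) l (0, 1) : ℝ) ^ 2) := by
      refine Ex_congr fun l _ => ?_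
      rw [Fintype.sum_prod_type]
      simp [xi]; ring
    rw [Ex_add, Ex_mul_left (3 / 4), Ex_const pr_sum, h2] at this
    unfold fS at *
    rw [Ex_Tot _ _ _ (tauS_inc s _) _ (by simp), this]
    push_cast; linarith

theorem Ex_q2Tot (s : D.ι) (n : ℕ) : Ex pr n (fun l => Tot (fun y => (y : ℝ) ^ 2) (fS s (xi ℤ) l)) = n / 8 :=
  Ex_Tot_sq _ _ (tauS_inc s _) n

theorem low_q (s : D.ι) (n : ℕ) (M : ℝ) (hM0 : 0 ≤ M)
    (hM : ∀ j < n, Ex pr j (fun l => (VV s l ((0 : ℤ), (1 : D.Γ s)) : ℝ)) ≤ M) :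
    n / (8 * Real.sqrt (1 + 3 * M)) ≤ Ex pr n (fun l => Tot (fun y => |(y : ℝ)|) (fS s (xi ℤ) l)) := by
  set R : ℝ := Real.sqrt (1 + 3 * M) with hR
  have hRp : 0 < R := Real.sqrt_pos.mpr (by linarith)
  have hR2 : R ^ 2 = 1 + 3 * M := Real.sq_sqrt (by linarith)
  have key : ∀ l, 3 / (2 * R) * Tot (fun y => (y : ℝ) ^ 2) (fS s (xi ℤ) l)
      - 1 / (2 * R ^ 3) * Tot (fun y => (y : ℝ) ^ 4) (fS s (xi ℤ) l) ≤ Tot (fun y => |(y : ℝ)|) (fS s (xi ℤ) l) := by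
    intro l
    have s1 := gfl_summable (tauS s) ((0 : ℤ), (1 : D.Γ s)) (xi ℤ) (fun y => (y : ℝ) ^ 2) (by simp) l (Equiv.refl _)
    have s2 := gfl_summable (tauS s) ((0 : ℤ), (1 : D.Γ s)) (xi ℤ) (fun y => (y : ℝ) ^ 4) (by simp) l (Equiv.refl _)
    have s3 := gfl_summable (tauS s) ((0 : ℤ), (1 : D.Γ s)) (xi ℤ) (fun y => |(y : ℝ)|) (by simp) l (Equiv.refl _)
    simp only [Equiv.refl_apply] at s1 s2 s3
    unfold Tot fS
    beta_reduce
    rw [← tsum_mul_left, ← tsum_mul_left, ← (s1.mul_left _).tsum_sub (s2.mul_left _)]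
    refine Summable.tsum_le_tsum ?_ ((s1.mul_left _).sub (s2.mul_left _)) s3
    intro p
    generalize gfl (tauS s) ((0 : ℤ), (1 : D.Γ s)) (xi ℤ) l p = y
    have e2 : (y : ℝ) ^ 2 = |(y : ℝ)| ^ 2 := by simp
    have e4 : (y : ℝ) ^ 4 = |(y : ℝ)| ^ 4 := by
      rw [show (y : ℝ) ^ 4 = ((y : ℝ) ^ 2) ^ 2 by ring, e2]; ring
    rw [e2, e4]
    have ht : 0 ≤ |(y : ℝ)| := abs_nonneg _
    generalize |(y : ℝ)| = t at ht
    have : t - (3 / (2 * R) * t ^ 2 - 1 / (2 * R ^ 3) * t ^ 4) = t * (t - R) ^ 2 * (t + 2 * R) / (2 * R ^ 3) := by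
      field_simp; ring
    have h0 : 0 ≤ t * (t - R) ^ 2 * (t + 2 * R) / (2 * R ^ 3) := by positivity
    linarith
  have h := Ex_mono (n := n) pr_nonneg (fun l (_ : l.length = n) => key l)
  refine le_trans ?_ h
  rw [Ex_sub, Ex_mul_left, Ex_mul_left, Ex_q2Tot]
  have h2 := mul_le_mul_of_nonneg_left (Ex_q4 s n M hM) (show 0 ≤ 1 / (2 * R ^ 3) by positivity)
  have : (n : ℝ) / (8 * R) = 3 / (2 * R) * (n / 8) - 1 / (2 * R ^ 3) * (n * (1 + 3 * M) / 8) := by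
    rw [← hR2]; field_simp; ring
  rw [this]; linarith

end Low
end SE

namespace SE

set_option linter.unusedSectionVars false
set_option linter.unusedVariables false
set_option linter.unusedSimpArgs false

section Low
variable {D : Sys}

/-- Total lamp content in a window. -/
noncomputable def Phi (s : D.ι) (W : Finset ℤ) (g : Hg D ℤ) : ℝ :=
  ∑ x ∈ W, ∑ h, |(((g.φ s x).q h : ℤ) : ℝ)|

theorem Phi_one (s : D.ι) (W : Finset ℤ) : Phi s W 1 = 0 := by
  simp [Phi]

theorem Phi_step (s : D.ι) (W : Finset ℤ) (g : Hg D ℤ) (ω : Om) :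
    Phi s W (g * val D ℤ ω) ≤ Phi s W g + 1 := by
  have key : ∀ x h, |((((g * val D ℤ ω).φ s x).q h : ℤ) : ℝ)| ≤ |(((g.φ s x).q h : ℤ) : ℝ)|
      + if x = g.z then (if h = (g.φ s x).g then 1 else 0) else 0 := by
    intro x h
    have h0 : (0 : ℝ) ≤ if x = g.z then (if h = (g.φ s x).g then 1 else 0) else 0 := by
      split_ifs <;> norm_num
    rcases ω with e | α | α | e
    · simpa [val] using h0
    · simpa [val] using h0
    · simpa [val] using h0
    · have hx : |((xi ℤ e : ℤ) : ℝ)| ≤ 1 := by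
        rcases e with ⟨a, b⟩; cases a <;> cases b <;> simp [xi]
      simp only [val, Hg.mul_φ, Lamp.mul_q, hC_φ, cL_q, Pi.single_apply, sub_eq_zero, inv_mul_eq_one]
      by_cases h1 : x = g.z
      · by_cases h2 : h = (g.φ s x).g
        · rw [if_pos h2.symm, if_pos h1, if_pos h1, if_pos h2]
          push_cast
          exact (abs_add_le _ _).trans (by linarith)
        · rw [if_neg (fun h => h2 h.symm)]
          simp [h1, if_neg h2]
          split_ifs <;> norm_num
      · simp [h1]
  unfold Phi
  calc _ ≤ ∑ x ∈ W, ∑ h, (|(((g.φ s x).q h : ℤ) : ℝ)|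
      + if x = g.z then (if h = (g.φ s x).g then 1 else 0) else 0) :=
        Finset.sum_le_sum fun x _ => Finset.sum_le_sum fun h _ => key x h
    _ ≤ _ := by
      simp only [Finset.sum_add_distrib]
      gcongr
      have : ∀ x, ∑ h, (if x = g.z then (if h = (g.φ s x).g then (1 : ℝ) else 0) else 0) = if x = g.z then 1 else 0 := by
        intro x; split_ifs <;> simp
      simp only [this]
      rw [Finset.sum_ite_eq']
      split_ifs <;> norm_num

theorem Phi_XX (s : D.ι) (l : List Om) :
    Phi s (Finset.Icc (loW l) (hiW l)) (XX D ℤ l) = Tot (fun y => |(y : ℝ)|) (fS s (xi ℤ) l) := by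
  rw [Tot_q s _ (by simp)]; rfl

/-- Marker of lamp letters. -/
def isC : Om → Bool
  | Sum.inr (Sum.inr (Sum.inr _)) => true
  | _ => false

abbrev Q2 := ZMod 2

noncomputable def c1 (D : Sys) : Hg D Q2 := hC D (Pi.single 0 1)

theorem c1_inv : (c1 D)⁻¹ = c1 D := by
  unfold c1; rw [← hC_neg, ← Pi.single_neg]; rfl

/-- Conditional law given the trajectory of the base. -/
noncomputable def KK : List Om → Hg D Q2 → ℝ
  | [], g => if g = 1 then 1 else 0
  | ω :: l, g => if isC ω then (1 / 2) * (KK l g + KK l ((c1 D)⁻¹ * g)) else KK l ((val D Q2 ω)⁻¹ * g)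

theorem KK_nonneg : ∀ (l : List Om) (g : Hg D Q2), 0 ≤ KK l g
  | [], g => by unfold KK; split_ifs <;> norm_num
  | ω :: l, g => by
    unfold KK
    have := KK_nonneg l g
    have := KK_nonneg l ((c1 D)⁻¹ * g)
    split_ifs
    · positivity
    · exact KK_nonneg l _

theorem Pr_succ (n : ℕ) (g : Hg D Q2) : Pr pr (val D Q2) (n + 1) g
    = ∑ ω, pr ω * Pr pr (val D Q2) n ((val D Q2 ω)⁻¹ * g) := by
  unfold Pr
  rw [Ex_succ]
  refine Finset.sum_congr rfl fun ω _ => ?_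
  congr 1
  refine Ex_congr fun l _ => ?_
  have : (Xw (val D Q2) (ω :: l) = g) ↔ (Xw (val D Q2) l = (val D Q2 ω)⁻¹ * g) := by
    rw [eq_inv_mul_iff_mul_eq]; simp [Xw]
  simp only [this]

theorem KK_law (n : ℕ) : ∀ g : Hg D Q2, Ex pr n (fun l => KK l g) = Pr pr (val D Q2) n g := by
  induction n with
  | zero => intro g; simp [Ex_zero, KK, Pr, Xw, eq_comm]
  | succ n ih =>
    intro g
    rw [Ex_step, Pr_succ, sum_Om]
    simp only [KK, isC, if_true, Bool.false_eq_true, if_false, ih, Ex_mul_left, Ex_add]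
    congr 1
    congr 1
    rw [Fintype.sum_prod_type, Fintype.sum_prod_type]
    have h1 : (c1 D)⁻¹ = hC D (Pi.single 0 (1 : Q2)) := c1_inv
    have h2 : (hC D (Pi.single 0 (1 : Q2)))⁻¹ = hC D (Pi.single 0 (1 : Q2)) := c1_inv
    have h3 : (-1 : Q2) = 1 := rfl
    simp [val, xi, h1, h2, h3, hC_zero]
    ring

theorem q_val (s : D.ι) (ω : Om) (hω : isC ω = false) (g : Hg D Q2) (p : ℤ × D.Γ s) :
    ((val D Q2 ω * g).φ s p.1).q p.2 = (g.φ s (tauS s ω p).1).q (tauS s ω p).2 := by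
  rcases ω with e | α | α | e
  · simp [val, tauS, Equiv.prodShear]
  · simp [val, tauS, Equiv.prodShear, Pi.mulSingle_apply, sub_eq_zero]
  · simp [val, tauS, Equiv.prodShear, Pi.mulSingle_apply, add_eq_zero_iff_eq_neg]
  · simp [isC] at hω

theorem q_c1 (s : D.ι) (g : Hg D Q2) (p : ℤ × D.Γ s) :
    ((c1 D * g).φ s p.1).q p.2 = (g.φ s p.1).q p.2 + if p = (0, 1) then 1 else 0 := by
  rcases p with ⟨x, h⟩
  by_cases hx : x = 0 <;> by_cases hh : h = 1 <;> simp [c1, hx, hh, Pi.single_apply, add_comm]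

theorem VV_cons (s : D.ι) (ω : Om) (l : List Om) (p : ℤ × D.Γ s) :
    VV s (ω :: l) p = if isC ω then VV s l p + (if p = (0, 1) then 1 else 0) else VV s l (tauS s ω p) := by
  rcases ω with e | α | α | e <;> simp [VV, fS, gfl, isC, inc, tauS]

theorem KK_supp (s : D.ι) : ∀ (l : List Om) (g : Hg D Q2), KK l g ≠ 0 → ∀ p : ℤ × D.Γ s, VV s l p = 0 →
    (g.φ s p.1).q p.2 = 0
  | [], g, h, p, _ => by
    have : g = 1 := by by_contra hg; simp [KK, hg] at h
    subst this; simp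
  | ω :: l, g, h, p, hp => by
    rw [VV_cons] at hp
    unfold KK at h
    by_cases hω : isC ω = true
    · rw [if_pos hω] at h hp
      have hV := VV_nonneg s l p
      have hp0 : p ≠ (0, 1) := by
        intro h0; rw [if_pos h0] at hp; omega
      rw [if_neg hp0, add_zero] at hp
      by_cases h1 : KK l g = 0
      · have h2 : KK l ((c1 D)⁻¹ * g) ≠ 0 := by intro h2; simp [h1, h2] at h
        have := KK_supp s l _ h2 p hp
        rw [c1_inv, q_c1, if_neg hp0, add_zero] at this
        exact this
      · exact KK_supp s l g h1 p hp
    · rw [if_neg hω] at h hp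
      have := KK_supp s l _ h _ hp
      rw [← q_val s ω (by simpa using hω)] at this
      simpa using this

theorem NV_cons (s : D.ι) (ω : Om) (l : List Om) :
    NV s (ω :: l) = NV s l + if isC ω ∧ VV s l (0, 1) = 0 then 1 else 0 := by
  unfold NV VV fS
  rw [Tot_cons _ _ _ (tauS_inc s _) _ (by simp)]
  congr 1
  have hV : 0 ≤ gfl (tauS s) ((0 : ℤ), (1 : D.Γ s)) (fun _ => 1) l (0, 1) := VV_nonneg s l (0, 1)
  rcases ω with e | α | α | e
  · simp [isC, inc]
  · simp [isC, inc]
  · simp [isC, inc]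
  · simp only [isC, inc, true_and]
    by_cases h : gfl (tauS s) ((0 : ℤ), (1 : D.Γ s)) (fun _ => 1) l (0, 1) = 0
    · simp [h]
    · have h' : ¬ (gfl (tauS s) ((0 : ℤ), (1 : D.Γ s)) (fun _ => 1) l (0, 1) + 1 = 0) := by omega
      simp [h, h']

theorem NV_nonneg (s : D.ι) (l : List Om) : 0 ≤ NV s l := by
  unfold NV Tot
  refine tsum_nonneg fun p => ?_
  beta_reduce
  split_ifs <;> norm_num

theorem KK_le (s : D.ι) : ∀ (l : List Om) (g : Hg D Q2), KK l g ≤ Real.exp (- (Real.log 2 * NV s l))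
  | [], g => by
    have : NV s ([] : List Om) = 0 := by simp [NV, Tot, VV, fS, gfl]
    rw [this]; unfold KK; split_ifs <;> simp
  | ω :: l, g => by
    rw [NV_cons]
    unfold KK
    have i1 := KK_le s l g
    have i2 := KK_le s l ((c1 D)⁻¹ * g)
    have n1 := KK_nonneg l g
    have n2 := KK_nonneg l ((c1 D)⁻¹ * g)
    by_cases hω : isC ω = true
    · rw [if_pos hω]
      by_cases h : VV s l (0, 1) = 0
      · rw [if_pos ⟨hω, h⟩]
        have e : Real.exp (- (Real.log 2 * (NV s l + 1))) = (1 / 2) * Real.exp (- (Real.log 2 * NV s l)) := by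
          rw [show - (Real.log 2 * (NV s l + 1)) = - Real.log 2 + - (Real.log 2 * NV s l) by ring, Real.exp_add,
            Real.exp_neg, Real.exp_log (by norm_num)]; norm_num
        rw [e]
        have : KK l g = 0 ∨ KK l ((c1 D)⁻¹ * g) = 0 := by
          by_contra! hcon
          have a := KK_supp s l _ hcon.1 _ h
          have b := KK_supp s l _ hcon.2 _ h
          rw [c1_inv, q_c1] at b
          simp at a b
          rw [a] at b
          revert b; decide
        rcases this with h | h <;> rw [h] <;> linarith
      · rw [if_neg (by simp [h])]
        simp only [add_zero]; linarith
    · rw [if_neg hω, if_neg (by simp [hω])]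
      simp only [add_zero]
      exact KK_le s l _

theorem KK_sum : ∀ l : List Om, HasSum (fun g : Hg D Q2 => KK l g) 1
  | [] => by
    have := hasSum_ite_eq (1 : Hg D Q2) (1 : ℝ)
    simpa [KK] using this
  | ω :: l => by
    have h := KK_sum l
    unfold KK
    split_ifs
    · have h2 := ((Equiv.mulLeft (c1 D)⁻¹).hasSum_iff (f := fun g : Hg D Q2 => KK l g)).mpr h
      have := (h.add h2).mul_left (1 / 2)
      norm_num at this ⊢
      exact this
    · exact ((Equiv.mulLeft (val D Q2 ω)⁻¹).hasSum_iff (f := fun g : Hg D Q2 => KK l g)).mpr h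

theorem KK_range : ∀ (l : List Om) (g : Hg D Q2), KK l g ≠ 0 → ∃ l' : List Om, l'.length = l.length ∧ XX D Q2 l' = g
  | [], g, h => by
    have : g = 1 := by by_contra hg; simp [KK, hg] at h
    exact ⟨[], rfl, by rw [this]; rfl⟩
  | ω :: l, g, h => by
    unfold KK at h
    have step : ∀ ω', KK l ((val D Q2 ω')⁻¹ * g) ≠ 0 →
        ∃ l' : List Om, l'.length = (ω :: l).length ∧ XX D Q2 l' = g := by
      intro ω' h
      obtain ⟨l', h1, h2⟩ := KK_range l _ h
      exact ⟨ω' :: l', by simp [h1], by rw [XX_cons, h2]; simp⟩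
    split_ifs at h
    · by_cases h1 : KK l g = 0
      · refine step (Sum.inr (Sum.inr (Sum.inr (true, false)))) ?_
        intro h2
        apply h
        have : val D Q2 (Sum.inr (Sum.inr (Sum.inr (true, false)))) = c1 D := by simp [val, c1, xi]
        rw [this] at h2
        rw [h1, h2]; simp
      · refine step (Sum.inr (Sum.inr (Sum.inr (false, false)))) ?_
        have : val D Q2 (Sum.inr (Sum.inr (Sum.inr (false, false)))) = 1 := by simp [val, xi, hC_zero]
        rw [this]; simpa using h1
    · exact step ω h

theorem Ent_low (s : D.ι) (n : ℕ) : Real.log 2 * Ex pr n (fun l => NV s l) ≤ Ent pr (val D Q2) n := by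
  obtain ⟨T, hT⟩ := exists_range (Ω := Om) n (XX D Q2)
  have e1 : Ent pr (val D Q2) n = ∑ g ∈ T, Real.negMulLog (Pr pr (val D Q2) n g) := by
    unfold Ent
    rw [Ex_finset (XX D Q2) T hT (fun g => - Real.log (Pr pr (val D Q2) n g))]
    refine Finset.sum_congr rfl fun g _ => ?_
    unfold Real.negMulLog
    rw [show Ex pr n (fun l => if XX D Q2 l = g then 1 else 0) = Pr pr (val D Q2) n g from rfl]
    ring
  rw [e1]
  have e2 : ∑ g ∈ T, Ex pr n (fun l => Real.negMulLog (KK l g)) ≤ ∑ g ∈ T, Real.negMulLog (Pr pr (val D Q2) n g) := by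
    refine Finset.sum_le_sum fun g _ => ?_
    rw [← KK_law]
    exact Ex_concave pr_nonneg pr_sum Real.concaveOn_negMulLog (fun l => KK_nonneg l g)
  refine le_trans ?_ e2
  rw [← Ex_sum, ← Ex_mul_left]
  refine Ex_mono pr_nonneg fun l hl => ?_
  have hsum : ∑ g ∈ T, KK l g = 1 := by
    rw [← (KK_sum (D := D) l).tsum_eq, tsum_eq_sum (s := T)]
    intro g hg
    by_contra h
    obtain ⟨l', h1, h2⟩ := KK_range l g h
    exact hg (h2 ▸ hT l' (h1.trans hl))
  calc Real.log 2 * NV s l = ∑ g ∈ T, KK l g * (Real.log 2 * NV s l) := by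
        rw [← Finset.sum_mul, hsum, one_mul]
    _ ≤ _ := by
      refine Finset.sum_le_sum fun g _ => ?_
      unfold Real.negMulLog
      rcases (KK_nonneg l g).eq_or_lt with h | h
      · rw [← h]; simp
      · have := Real.log_le_log h (KK_le s l g)
        rw [Real.log_exp] at this
        nlinarith

end Low
end SE

namespace SE

set_option linter.unusedSectionVars false
set_option linter.unusedVariables false
set_option linter.unusedSimpArgs false

/-- Binomial weights. -/
noncomputable def bw : ℕ → ℤ → ℝ
  | 0, t => if t = 0 then 1 else 0
  | N + 1, t => (1 / 2) * (bw N t + bw N (t - 1))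

theorem bw_nonneg : ∀ (N : ℕ) (t : ℤ), 0 ≤ bw N t
  | 0, t => by unfold bw; split_ifs <;> norm_num
  | N + 1, t => by
    have h1 := bw_nonneg N t
    have h2 := bw_nonneg N (t - 1)
    unfold bw; positivity

theorem bw_rel : ∀ (N : ℕ) (t : ℤ), ((N : ℝ) + 1 - t) * bw N (t - 1) = t * bw N t
  | 0, t => by
    unfold bw
    by_cases h : t = 0
    · subst h; simp
    · by_cases h1 : t = 1
      · subst h1; simp
      · have : ¬ (t - 1 = 0) := by omega
        simp [h, this]
  | N + 1, t => by
    have h1 := bw_rel N t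
    have h2 := bw_rel N (t - 1)
    simp only [bw]
    push_cast at *
    linear_combination (1 / 2) * h1 + (1 / 2) * h2

theorem bw_diff (N : ℕ) (t : ℤ) : bw N (t - 1) - bw N t
    = 2 / ((N : ℝ) + 1) * ((2 * t - (N + 1)) * bw (N + 1) t) := by
  have h := bw_rel N t
  simp only [bw]
  have : (N : ℝ) + 1 ≠ 0 := by positivity
  field_simp
  linear_combination 2 * h

theorem hasSum_shift {f : ℤ → ℝ} {a : ℝ} (h : HasSum f a) (c : ℤ) : HasSum (fun t => f (t - c)) a :=
  ((Equiv.subRight c).hasSum_iff (f := f)).mpr h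

theorem hs_congr {f g : ℤ → ℝ} {a b : ℝ} (h : HasSum f a) (hg : ∀ t, g t = f t) (hb : b = a) : HasSum g b := by
  rw [hb, show g = f from funext hg]; exact h

theorem bw_mom : ∀ N : ℕ, HasSum (bw N) 1 ∧ HasSum (fun t : ℤ => (2 * (t : ℝ) - N) * bw N t) 0
    ∧ HasSum (fun t : ℤ => (2 * (t : ℝ) - N) ^ 2 * bw N t) (N : ℝ)
  | 0 => by
    refine ⟨?_, ?_, ?_⟩
    · exact hs_congr (hasSum_ite_eq (0 : ℤ) (1 : ℝ)) (fun t => by simp [bw]) rfl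
    · exact hs_congr hasSum_zero (fun t => by by_cases h : t = 0 <;> simp [bw, h]) rfl
    · exact hs_congr hasSum_zero (fun t => by by_cases h : t = 0 <;> simp [bw, h]) (by simp)
  | N + 1 => by
    obtain ⟨h0, h1, h2⟩ := bw_mom N
    have s0 := hasSum_shift h0 1
    have s1 := hasSum_shift h1 1
    have s2 := hasSum_shift h2 1
    refine ⟨?_, ?_, ?_⟩
    · exact hs_congr ((h0.add s0).mul_left (1 / 2)) (fun t => by simp [bw]) (by norm_num)
    · exact hs_congr (((h1.sub h0).add (s1.add s0)).mul_left (1 / 2))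
        (fun t => by simp only [bw]; push_cast; ring) (by norm_num)
    · exact hs_congr ((((h2.sub (h1.mul_left 2)).add h0).add ((s2.add (s1.mul_left 2)).add s0)).mul_left (1 / 2))
        (fun t => by simp only [bw]; push_cast; ring) (by push_cast; ring)

theorem bw_tv (N : ℕ) : Summable (fun t => |bw N (t - 1) - bw N t|)
    ∧ ∑' t, |bw N (t - 1) - bw N t| ≤ 2 / Real.sqrt (N + 1) := by
  obtain ⟨h0, h1, h2⟩ := bw_mom (N + 1)
  set M : ℝ := (N : ℝ) + 1 with hM
  have hMp : 0 < M := by positivity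
  set R := Real.sqrt M with hR
  have hRp : 0 < R := Real.sqrt_pos.mpr hMp
  have hR2 : R ^ 2 = M := Real.sq_sqrt hMp.le
  have hb : HasSum (fun t : ℤ => 2 / M * ((1 / (2 * R)) * ((2 * (t : ℝ) - (N + 1 : ℕ)) ^ 2 * bw (N + 1) t) + R / 2 * bw (N + 1) t))
      (2 / R) := by
    refine hs_congr (((h2.mul_left (1 / (2 * R))).add (h0.mul_left (R / 2))).mul_left (2 / M)) (fun t => rfl) ?_
    push_cast
    rw [← hM, ← hR2]; field_simp; norm_num
  have hle : ∀ t : ℤ, |bw N (t - 1) - bw N t| ≤ 2 / M * ((1 / (2 * R)) * ((2 * (t : ℝ) - (N + 1 : ℕ)) ^ 2 * bw (N + 1) t) + R / 2 * bw (N + 1) t) := by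
    intro t
    rw [bw_diff, abs_mul, abs_of_pos (show 0 < 2 / ((N : ℝ) + 1) by positivity), abs_mul, abs_of_nonneg (bw_nonneg _ _)]
    rw [← hM]
    push_cast
    rw [← hM]
    refine mul_le_mul_of_nonneg_left ?_ (by positivity)
    rw [← mul_assoc, ← add_mul]
    refine mul_le_mul_of_nonneg_right ?_ (bw_nonneg _ _)
    rw [← sq_abs]
    generalize |2 * (t : ℝ) - M| = x
    have : 1 / (2 * R) * x ^ 2 + R / 2 - x = (x - R) ^ 2 / (2 * R) := by field_simp; ring
    have : 0 ≤ (x - R) ^ 2 / (2 * R) := by positivity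
    linarith
  have hs : Summable (fun t => |bw N (t - 1) - bw N t|) :=
    Summable.of_nonneg_of_le (fun _ => abs_nonneg _) hle hb.summable
  exact ⟨hs, (hs.tsum_le_tsum hle hb.summable).trans hb.tsum_eq.le⟩

section Dih
variable {m : ℕ} [NeZero m]

/-- Averaging with the neighbour. -/
noncomputable def LL : ℕ → (ZMod m → ℝ) → ZMod m → ℝ
  | 0, φ => φ
  | N + 1, φ => fun i => (1 / 2) * (LL N φ i + LL N φ (i + 1))

theorem LL_bw (ψ : ZMod m → ℝ) (K : ℝ) (hψ : ∀ x, |ψ x| ≤ K) : ∀ (N : ℕ) (x : ZMod m),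
    HasSum (fun t : ℤ => bw N t * ψ (x + t)) (LL N ψ x)
  | 0, x => by
    exact hs_congr (hasSum_ite_eq (0 : ℤ) (ψ x)) (fun t => by by_cases h : t = 0 <;> simp [bw, h]) rfl
  | N + 1, x => by
    have h1 := LL_bw ψ K hψ N x
    have h2 := hasSum_shift (LL_bw ψ K hψ N (x + 1)) 1
    refine hs_congr ((h1.add h2).mul_left (1 / 2)) (fun t => ?_) rfl
    simp only [bw]
    push_cast
    rw [show x + 1 + ((t : ZMod m) - 1) = x + t by ring]
    ring

theorem LL_diff (ψ : ZMod m → ℝ) (hψ : ∀ x, |ψ x| ≤ 1) (N : ℕ) (x : ZMod m) :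
    LL N ψ x - LL N ψ (x + 1) ≤ 2 / Real.sqrt (N + 1) := by
  have h1 := LL_bw ψ 1 hψ N x
  have h2 := hasSum_shift (LL_bw ψ 1 hψ N (x + 1)) 1
  obtain ⟨hs, ht⟩ := bw_tv N
  refine (hasSum_le ?_ (h1.sub h2) hs.hasSum).trans ht
  intro t
  push_cast
  rw [show x + 1 + ((t : ZMod m) - 1) = x + t by ring, ← sub_mul]
  calc _ ≤ |(bw N t - bw N (t - 1)) * ψ (x + t)| := le_abs_self _
    _ = |bw N (t - 1) - bw N t| * |ψ (x + t)| := by rw [abs_mul, abs_sub_comm]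
    _ ≤ _ := mul_le_of_le_one_right (abs_nonneg _) (hψ _)

noncomputable def del (x : ZMod m) : ℝ := if x = 0 then 1 else 0

theorem LL_del (N : ℕ) : ∀ x : ZMod m, LL N del x = 1 / m + (LL N (fun z => ((z - 1).val : ℝ) / m) x
    - LL N (fun z => ((z - 1).val : ℝ) / m) (x + 1)) := by
  induction N with
  | zero =>
    intro x
    have hm : (m : ℝ) ≠ 0 := by exact_mod_cast NeZero.ne m
    simp only [LL, del]
    rw [add_sub_cancel_right]
    by_cases h : x = 0
    · subst h
      rw [if_pos rfl, zero_sub]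
      have : ((-1 : ZMod m).val : ℝ) = m - 1 := by
        obtain ⟨k, rfl⟩ : ∃ k, m = k + 1 := ⟨m - 1, by have := NeZero.ne m; omega⟩
        rw [ZMod.val_neg_one]; push_cast; ring
      rw [this]; simp; field_simp; ring
    · rw [if_neg h]
      have hx : 1 ≤ x.val := by
        have := (ZMod.val_ne_zero x).mpr h; omega
      have : (x - 1).val = x.val - 1 := by
        by_cases h1 : m = 1
        · subst h1; exact absurd (Subsingleton.elim x 0) h
        · haveI : Fact (1 < m) := ⟨by have := NeZero.ne m; omega⟩
          rw [ZMod.val_sub, ZMod.val_one]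
          rw [ZMod.val_one]; exact hx
      rw [this, Nat.cast_sub hx]; field_simp; push_cast; ring
  | succ N ih =>
    intro x
    simp only [LL, ih]; ring

theorem LL_del_le (N : ℕ) (x : ZMod m) : LL N del x ≤ 1 / m + 2 / Real.sqrt (N + 1) := by
  rw [LL_del]
  have hm : (0 : ℝ) < m := by exact_mod_cast Nat.pos_of_ne_zero (NeZero.ne m)
  have := LL_diff (fun z : ZMod m => ((z - 1).val : ℝ) / m) (fun z => by
    rw [abs_of_nonneg (by positivity), div_le_one hm]
    exact_mod_cast (ZMod.val_lt _).le) N x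
  linarith

abbrev M2 := Multiplicative (ZMod 2)

theorem M2_cases (x : M2) : x = 1 ∨ x = Multiplicative.ofAdd 1 := by
  revert x; decide

/-- Order-two homomorphism onto a reflection. -/
def hS (j : ZMod m) : M2 →* DihedralGroup m where
  toFun x := if x = 1 then 1 else DihedralGroup.sr j
  map_one' := by simp
  map_mul' x y := by
    have h1 : ¬ (Multiplicative.ofAdd (1 : ZMod 2) = 1) := by decide
    have h2 : Multiplicative.ofAdd (1 : ZMod 2) * Multiplicative.ofAdd (1 : ZMod 2) = 1 := by decide
    rcases M2_cases x with rfl | rfl <;> rcases M2_cases y with rfl | rfl <;> simp [h1, h2]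

theorem hS_one (j : ZMod m) : hS j (Multiplicative.ofAdd 1) = DihedralGroup.sr j := rfl

theorem sum_M2 (F : M2 → ℝ) : ∑ x, F x = F 1 + F (Multiplicative.ofAdd 1) := by
  rw [← Equiv.sum_comp Multiplicative.ofAdd]
  exact Fin.sum_univ_two _

noncomputable def T1 {G : Type} [Group G] (h : M2 →* G) (π : G → ℝ) (g : G) : ℝ :=
  (1 / 2) * ∑ x, π (h x * g)

noncomputable def pi1 : ℕ → Bool → DihedralGroup m → ℝ
  | 0, _ => fun g => if g = 1 then 1 else 0
  | j + 1, e => T1 (if e then hS 0 else hS 1) (pi1 j (!e))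

theorem pi1_form (j : ℕ) : ∀ e : Bool, ∃ c : ZMod m, ∀ i : ZMod m,
    pi1 (j + 1) e (DihedralGroup.r i) = (1 / 2) * LL j del (i + c) ∧
    pi1 (j + 1) e (DihedralGroup.sr i) = (1 / 2) * LL j del (i + c - if e then 0 else 1) := by
  induction j with
  | zero =>
    intro e
    refine ⟨0, fun i => ?_⟩
    have hA : ∀ a b : ZMod m, (DihedralGroup.r a = DihedralGroup.r b) = (a = b) := fun a b => by simp
    have hB : ∀ a b : ZMod m, (DihedralGroup.sr a = DihedralGroup.r b) = False := fun a b => by simp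
    cases e
    · simp only [pi1, T1, sum_M2, hS_one, LL, del, DihedralGroup.one_def, Bool.false_eq_true, if_false, if_true]
      simp only [← DihedralGroup.one_def, map_one, one_mul, DihedralGroup.sr_mul_r, DihedralGroup.sr_mul_sr]
      simp only [DihedralGroup.one_def, hA, hB, if_false]
      simp
    · simp only [pi1, T1, sum_M2, hS_one, LL, del, DihedralGroup.one_def, Bool.false_eq_true, if_false, if_true]
      simp only [← DihedralGroup.one_def, map_one, one_mul, DihedralGroup.sr_mul_r, DihedralGroup.sr_mul_sr]
      simp only [DihedralGroup.one_def, hA, hB, if_false]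
      simp
  | succ j ih =>
    intro e
    obtain ⟨c, hc⟩ := ih (!e)
    have h1 := fun i => (hc i).1
    have h2 := fun i => (hc i).2
    cases e
    · refine ⟨c, fun i => ?_⟩
      rw [pi1]
      simp only [T1, sum_M2, hS_one, Bool.false_eq_true, if_false, map_one, one_mul, Bool.not_false, if_true,
        DihedralGroup.sr_mul_r, DihedralGroup.sr_mul_sr, LL] at *
      rw [h1, h1, h2, h2]
      constructor
      · ring_nf
      · ring_nf
    · refine ⟨c - 1, fun i => ?_⟩
      rw [pi1]
      simp only [T1, sum_M2, hS_one, Bool.false_eq_true, if_false, map_one, one_mul, Bool.not_true, if_true,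
        DihedralGroup.sr_mul_r, DihedralGroup.sr_mul_sr, LL] at *
      rw [h1, h1, h2, h2]
      constructor
      · ring_nf
      · ring_nf

theorem pi1_nonneg (j : ℕ) : ∀ (e : Bool) (g : DihedralGroup m), 0 ≤ pi1 j e g := by
  induction j with
  | zero => intro e g; simp only [pi1]; split_ifs <;> norm_num
  | succ j ih =>
    intro e g; simp only [pi1, T1]
    exact mul_nonneg (by norm_num) (Finset.sum_nonneg fun x _ => ih _ _)

theorem pi1_le (j : ℕ) (e : Bool) : pi1 (j + 1) e (1 : DihedralGroup m)
    ≤ (1 / 2) * (1 / m + 2 / Real.sqrt (j + 1)) := by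
  obtain ⟨c, hc⟩ := pi1_form (m := m) j e
  rw [DihedralGroup.one_def, (hc 0).1]
  exact mul_le_mul_of_nonneg_left (LL_del_le _ _) (by norm_num)

/-- Coordinatewise homomorphism. -/
def hP {G : Type} [Group G] (h : M2 →* G) : AA →* (Fin 4 → G) where
  toFun α i := h (α i)
  map_one' := by funext i; simp
  map_mul' x y := by funext i; simp

theorem TT_prod {G : Type} [Group G] (h : M2 →* G) (π : G → ℝ) :
    TT (hP h) (fun g => ∏ i, π (g i)) = fun g => ∏ i, T1 h π (g i) := by
  funext g
  unfold TT T1 avg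
  rw [Finset.prod_mul_distrib, Finset.prod_univ_sum]
  simp only [Finset.prod_const, Finset.card_univ, Fintype.card_fin, Fintype.piFinset_univ]
  norm_num
  rfl

end Dih

noncomputable def piG {G : Type} [Group G] (ha hb : AA →* G) : ℕ → Bool → G → ℝ
  | 0, _ => fun g => if g = 1 then 1 else 0
  | j + 1, e => TT (if e then ha else hb) (piG ha hb j (!e))

theorem piE_eq {D : Sys} (s : D.ι) (j : ℕ) : ∀ e, piE s j e = piG (D.ha s) (D.hb s) j e := by
  induction j with
  | zero => intro e; rfl
  | succ j ih => intro e; simp only [piE, piG, ih, hE]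

theorem piG_prod (m : ℕ) [NeZero m] (j : ℕ) : ∀ e, piG (hP (hS (0 : ZMod m))) (hP (hS (1 : ZMod m))) j e
    = fun g => ∏ i, pi1 j e (g i) := by
  induction j with
  | zero =>
    intro e; funext g
    simp only [piG, pi1]
    by_cases h : g = 1
    · subst h; simp
    · rw [if_neg h]
      obtain ⟨i, hi⟩ := Function.ne_iff.mp h
      symm
      exact Finset.prod_eq_zero (Finset.mem_univ i) (if_neg hi)
  | succ j ih =>
    intro e
    simp only [piG, ih, pi1]
    cases e
    · simp only [Bool.false_eq_true, if_false]; rw [TT_prod]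
    · simp only [if_true]; rw [TT_prod]

theorem piG_le (m : ℕ) [NeZero m] (j : ℕ) (hj : 1 ≤ j) (e : Bool) :
    piG (hP (hS (0 : ZMod m))) (hP (hS (1 : ZMod m))) j e 1 ≤ 8 / (j : ℝ) ^ 2 + 8 / ((2 * m) ^ 4 : ℝ) := by
  obtain ⟨i, rfl⟩ : ∃ i, j = i + 1 := ⟨j - 1, by omega⟩
  rw [piG_prod]
  simp only [Pi.one_apply, Finset.prod_const, Finset.card_univ, Fintype.card_fin]
  have hm : (0 : ℝ) < m := by exact_mod_cast Nat.pos_of_ne_zero (NeZero.ne m)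
  have h := pow_le_pow_left₀ (pi1_nonneg (m := m) (i + 1) e 1) (pi1_le (m := m) i e) 4
  refine h.trans ?_
  have hs : Real.sqrt ((i : ℝ) + 1) ^ 2 = i + 1 := Real.sq_sqrt (by positivity)
  have hsp : 0 < Real.sqrt ((i : ℝ) + 1) := Real.sqrt_pos.mpr (by positivity)
  set R := Real.sqrt ((i : ℝ) + 1)
  push_cast
  rw [← hs]
  have e1 : 8 / (R ^ 2) ^ 2 + 8 / ((2 * m) ^ 4 : ℝ) = (1 / 2) * ((1 / m) ^ 4 + (2 / R) ^ 4) := by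
    field_simp; ring
  rw [e1]
  have ha : (0 : ℝ) ≤ 1 / m := by positivity
  have hb : 0 ≤ 2 / R := by positivity
  generalize (1 : ℝ) / m = a at *
  generalize 2 / R = b at *
  have h1 : (a + b) ^ 2 ≤ 2 * (a ^ 2 + b ^ 2) := by nlinarith [sq_nonneg (a - b)]
  have h2 : (a ^ 2 + b ^ 2) ^ 2 ≤ 2 * (a ^ 4 + b ^ 4) := by nlinarith [sq_nonneg (a ^ 2 - b ^ 2)]
  have h3 : ((a + b) ^ 2) ^ 2 ≤ (2 * (a ^ 2 + b ^ 2)) ^ 2 := pow_le_pow_left₀ (by positivity) h1 2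
  nlinarith

/-- Parity maps. -/
def pD {m : ℕ} (hm : 2 ∣ m) (c : ZMod 2) : DihedralGroup m →* M2 where
  toFun
    | DihedralGroup.r i => Multiplicative.ofAdd (ZMod.castHom hm (ZMod 2) i)
    | DihedralGroup.sr i => Multiplicative.ofAdd (c + ZMod.castHom hm (ZMod 2) i)
  map_one' := by
    show Multiplicative.ofAdd (ZMod.castHom hm (ZMod 2) 0) = 1
    rw [map_zero]; rfl
  map_mul' x y := by
    have hc : ∀ a b c : ZMod 2, c + (b - a) = a + (c + b) := by decide
    have hd : ∀ a b c : ZMod 2, b - a = c + a + (c + b) := by decide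
    rcases x with i | i <;> rcases y with j | j
    · simp only [DihedralGroup.r_mul_r, map_add, ofAdd_add]
    · simp only [DihedralGroup.r_mul_sr, map_sub, ← ofAdd_add, hc]
    · simp only [DihedralGroup.sr_mul_r, map_add, ← ofAdd_add, add_assoc]
    · simp only [DihedralGroup.sr_mul_sr, map_sub, ← ofAdd_add]
      rw [hd _ _ c]

def pP {G : Type} [Group G] (h : G →* M2) : (Fin 4 → G) →* AA where
  toFun α i := h (α i)
  map_one' := by funext i; simp
  map_mul' x y := by funext i; simp

theorem pD_hS {m : ℕ} [NeZero m] (hm : 2 ∣ m) (c : ZMod 2) (j : ZMod m) (x : M2) :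
    pD hm c (hS j x) = if c + ZMod.castHom hm (ZMod 2) j = 1 then x else 1 := by
  rcases M2_cases x with rfl | rfl
  · simp only [map_one, ite_self]
  · rw [hS_one]
    show Multiplicative.ofAdd (c + ZMod.castHom hm (ZMod 2) j) = _
    have h01 : ∀ y : ZMod 2, Multiplicative.ofAdd y = if y = 1 then Multiplicative.ofAdd 1 else 1 := by decide
    exact h01 _

theorem gen_D (m : ℕ) [NeZero m] : Subgroup.closure (Set.range (hP (hS (0 : ZMod m))) ∪ Set.range (hP (hS (1 : ZMod m)))) = ⊤ := by
  rw [eq_top_iff]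
  intro x _
  refine Subgroup.pi_mem_of_mulSingle_mem x fun i => ?_
  set K := Subgroup.closure (Set.range (hP (hS (0 : ZMod m))) ∪ Set.range (hP (hS (1 : ZMod m))))
  let f : DihedralGroup m →* (Fin 4 → DihedralGroup m) := MonoidHom.mulSingle (fun _ => DihedralGroup m) i
  have hf : ∀ j, hP (hS (j : ZMod m)) (Pi.mulSingle i (Multiplicative.ofAdd 1)) = f (DihedralGroup.sr j) := by
    intro j; funext k
    show hS j ((Pi.mulSingle i (Multiplicative.ofAdd 1) : AA) k) = (Pi.mulSingle i (DihedralGroup.sr j) : Fin 4 → DihedralGroup m) k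
    by_cases h : k = i
    · subst h; simp [hS_one]
    · simp [Pi.mulSingle_eq_of_ne h]
  have h0 : f (DihedralGroup.sr 0) ∈ K := by
    rw [← hf]; exact Subgroup.subset_closure (Or.inl ⟨_, rfl⟩)
  have h1 : f (DihedralGroup.sr 1) ∈ K := by
    rw [← hf]; exact Subgroup.subset_closure (Or.inr ⟨_, rfl⟩)
  have hr : f (DihedralGroup.r 1) ∈ K := by
    have := K.mul_mem h0 h1
    rw [← map_mul] at this
    simpa using this
  have hri : ∀ j : ZMod m, f (DihedralGroup.r j) ∈ K := by
    intro j
    have := K.pow_mem hr j.val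
    rw [← map_pow, DihedralGroup.r_one_pow] at this
    simpa using this
  show f (x i) ∈ K
  rcases x i with j | j
  · exact hri j
  · have := K.mul_mem h0 (hri j)
    rw [← map_mul] at this
    simpa using this

end SE

namespace SE
set_option linter.unusedSectionVars false
set_option linter.unusedVariables false
set_option linter.unusedSimpArgs false

theorem geom_up (x : ℝ) (hx : 2 ≤ x) (N : ℕ) : ∑ s ∈ Finset.range (N + 1), x ^ s ≤ 2 * x ^ N := by
  induction N with
  | zero => simp
  | succ N ih =>
    rw [Finset.sum_range_succ]
    have : 0 ≤ x ^ N := by positivity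
    rw [pow_succ x N]; nlinarith

theorem geom_down (y : ℝ) (hy0 : 0 ≤ y) (hy : y ≤ 3 / 4) (a b : ℕ) :
    ∑ s ∈ Finset.Ico a b, y ^ (s - a) ≤ 4 := by
  rw [Finset.sum_Ico_eq_sum_range]
  simp only [Nat.add_sub_cancel_left]
  have h : ∀ N : ℕ, ∑ s ∈ Finset.range N, y ^ s + 4 * y ^ N ≤ 4 := by
    intro N
    induction N with
    | zero => simp
    | succ N ih =>
      rw [Finset.sum_range_succ]
      have : 0 ≤ y ^ N := by positivity
      rw [pow_succ y N]; nlinarith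
  have := h (b - a)
  have h2 : 0 ≤ y ^ (b - a) := by positivity
  linarith

theorem exists_beta (q : ℝ) (hq0 : 0 ≤ q) (hq : q < 2) : ∃ β : ℕ, 1 ≤ β ∧ q ^ (4 * β + 1) < 2 ^ (4 * β) := by
  obtain ⟨N, hN⟩ := exists_pow_lt_of_lt_one (show (0 : ℝ) < 1 / 2 by norm_num) (show q / 2 < 1 by linarith)
  refine ⟨N + 1, by omega, ?_⟩
  have h1 : (q / 2) ^ (4 * (N + 1)) < 1 / 2 :=
    lt_of_le_of_lt (pow_le_pow_of_le_one (by positivity) (by linarith) (by omega)) hN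
  rw [div_pow, div_lt_iff₀ (by positivity)] at h1
  rw [pow_succ]
  have : 0 ≤ q ^ (4 * (N + 1)) := by positivity
  nlinarith

section Params
variable (β : ℕ) (ρ : ℕ → ℝ)

def Pp (s : ℕ) : Prop := ∃ i, ((2 : ℝ) ^ (4 * β)) ^ s ≤ ρ i

noncomputable def is (s : {s : ℕ // Pp β ρ s}) : ℕ := Nat.find s.2

variable {β ρ}

theorem is_spec (s : {s : ℕ // Pp β ρ s}) : ((2 : ℝ) ^ (4 * β)) ^ s.1 ≤ ρ (is β ρ s) := Nat.find_spec s.2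

theorem is_min (s : {s : ℕ // Pp β ρ s}) {i : ℕ} (h : i < is β ρ s) : ρ i < ((2 : ℝ) ^ (4 * β)) ^ s.1 := by
  have := Nat.find_min s.2 h
  exact not_le.mp this

variable {q : ℝ} (hq0 : 0 ≤ q) (hβ1 : 1 ≤ β) (hβ : q ^ (4 * β + 1) < 2 ^ (4 * β)) (h0 : ρ 0 = 1) (hm : Monotone ρ)
  (hg : ∀ i j, ρ (i + j) ≤ q ^ j * ρ i)

theorem gapL {q : ℝ} (hq0 : 0 ≤ q) (hβ : q ^ (4 * β + 1) < 2 ^ (4 * β)) (h0 : ρ 0 = 1) (hm : Monotone ρ)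
    (hg : ∀ i j, ρ (i + j) ≤ q ^ j * ρ i)
    (i i' t : ℕ) (ht : 1 ≤ t) (x : ℝ) (hx : ρ i ≤ x) (h : ((2 : ℝ) ^ (4 * β)) ^ t * x ≤ ρ i') :
    i + (4 * β + 1) * t < i' := by
  by_contra hc
  push Not at hc
  have h1 := (hm hc).trans (hg i _)
  have hpos : 1 ≤ ρ i := by rw [← h0]; exact hm (Nat.zero_le _)
  rw [pow_mul] at h1
  have h2 : (q ^ (4 * β + 1)) ^ t < ((2 : ℝ) ^ (4 * β)) ^ t := pow_lt_pow_left₀ hβ (by positivity) (by omega)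
  have h3 : ((2 : ℝ) ^ (4 * β)) ^ t * ρ i ≤ ((2 : ℝ) ^ (4 * β)) ^ t * x := mul_le_mul_of_nonneg_left hx (by positivity)
  nlinarith

theorem is_ge {q : ℝ} (hq0 : 0 ≤ q) (hβ : q ^ (4 * β + 1) < 2 ^ (4 * β)) (h0 : ρ 0 = 1) (hm : Monotone ρ)
    (hg : ∀ i j, ρ (i + j) ≤ q ^ j * ρ i)
    (s : {s : ℕ // Pp β ρ s}) : (4 * β + 1) * s.1 ≤ is β ρ s := by
  rcases Nat.eq_zero_or_pos s.1 with h | h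
  · rw [h]; simp
  · have := gapL hq0 hβ h0 hm hg 0 (is β ρ s) s.1 h 1 h0.le (by rw [mul_one]; exact is_spec s)
    omega

theorem is_gap {q : ℝ} (hq0 : 0 ≤ q) (hβ : q ^ (4 * β + 1) < 2 ^ (4 * β)) (h0 : ρ 0 = 1) (hm : Monotone ρ)
    (hg : ∀ i j, ρ (i + j) ≤ q ^ j * ρ i)
    (s s' : {s : ℕ // Pp β ρ s}) (h : s.1 < s'.1) :
    is β ρ s + (4 * β + 1) * (s'.1 - s.1) ≤ is β ρ s' := by
  rcases Nat.eq_zero_or_pos (is β ρ s) with h1 | h1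
  · rw [h1]
    have h2 := is_ge hq0 hβ h0 hm hg s'
    have : (4 * β + 1) * (s'.1 - s.1) ≤ (4 * β + 1) * s'.1 := Nat.mul_le_mul_left _ (Nat.sub_le _ _)
    omega
  · have h2 := is_min s (i := is β ρ s - 1) (by omega)
    have := gapL hq0 hβ h0 hm hg (is β ρ s - 1) (is β ρ s') (s'.1 - s.1) (by omega) _ h2.le
      (by rw [← pow_add, Nat.sub_add_cancel h.le]; exact is_spec s')
    omega

variable (β ρ) in
noncomputable def bs (s : {s : ℕ // Pp β ρ s}) : ℕ := 2 ^ (is β ρ s - 4 * β * s.1)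

theorem bs_gap {q : ℝ} (hq0 : 0 ≤ q) (hβ : q ^ (4 * β + 1) < 2 ^ (4 * β)) (h0 : ρ 0 = 1) (hm : Monotone ρ)
    (hg : ∀ i j, ρ (i + j) ≤ q ^ j * ρ i)
    (s s' : {s : ℕ // Pp β ρ s}) (h : s.1 < s'.1) : 2 * bs β ρ s ≤ bs β ρ s' := by
  unfold bs
  rw [← pow_succ']
  refine Nat.pow_le_pow_right (by norm_num) ?_
  have h1 := is_gap hq0 hβ h0 hm hg s s' h
  have h2 := is_ge hq0 hβ h0 hm hg s
  obtain ⟨d, hd⟩ : ∃ d, s'.1 = s.1 + 1 + d := ⟨s'.1 - s.1 - 1, by omega⟩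
  rw [hd] at h1 ⊢
  have : s.1 + 1 + d - s.1 = 1 + d := by omega
  rw [this] at h1
  have e1 : (4 * β + 1) * (1 + d) = 4 * β + 4 * β * d + 1 + d := by ring
  have e2 : 4 * β * (s.1 + 1 + d) = 4 * β * s.1 + 4 * β + 4 * β * d := by ring
  have e3 : (4 * β + 1) * s.1 = 4 * β * s.1 + s.1 := by ring
  rw [e1] at h1; rw [e2]; rw [e3] at h2
  omega

def ms (β s : ℕ) : ℕ := 2 * 2 ^ (β * s)

instance (β s : ℕ) : NeZero (ms β s) := ⟨by unfold ms; positivity⟩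

theorem ms_even (β s : ℕ) : 2 ∣ ms β s := ⟨_, rfl⟩

noncomputable def DD : Sys where
  ι := {s : ℕ // Pp β ρ s}
  Γ s := Fin 4 → DihedralGroup (ms β s.1)
  grp s := inferInstance
  fin s := inferInstance
  b := bs β ρ
  b_pos s := Nat.one_le_two_pow
  iso s s' hs := by
    rcases Nat.lt_or_gt_of_ne (fun h => hs (Subtype.ext h)) with h | h
    · have := bs_gap hq0 hβ h0 hm hg s s' h
      rw [abs_sub_comm]
      refine le_trans ?_ (le_abs_self _)
      omega
    · have := bs_gap hq0 hβ h0 hm hg s' s h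
      refine le_trans ?_ (le_abs_self _)
      omega
  ha s := hP (hS 0)
  hb s := hP (hS 1)
  pA s := pP (pD (ms_even β s.1) 1)
  pB s := pP (pD (ms_even β s.1) 0)
  pAa s α := by
    funext i
    show pD _ 1 (hS 0 (α i)) = _
    rw [pD_hS, map_zero, if_pos (by decide)]
  pAb s α := by
    funext i
    show pD _ 1 (hS 1 (α i)) = _
    rw [pD_hS, map_one, if_neg (by decide)]; rfl
  pBa s α := by
    funext i
    show pD _ 0 (hS 0 (α i)) = _
    rw [pD_hS, map_zero, if_neg (by decide)]; rfl
  pBb s α := by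
    funext i
    show pD _ 0 (hS 1 (α i)) = _
    rw [pD_hS, map_one, if_pos (by decide)]
  gen s := gen_D _

theorem DD_card (s : (DD hq0 hβ h0 hm hg).ι) :
    (Fintype.card ((DD hq0 hβ h0 hm hg).Γ s) : ℝ) = 256 * ((2 : ℝ) ^ (4 * β)) ^ s.1 := by
  have : Fintype.card ((DD hq0 hβ h0 hm hg).Γ s) = (2 * ms β s.1) ^ 4 := by
    show Fintype.card (Fin 4 → DihedralGroup (ms β s.1)) = _
    rw [Fintype.card_fun, DihedralGroup.card, Fintype.card_fin]
  rw [this]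
  unfold ms
  push_cast
  rw [← pow_mul, show 4 * β * s.1 = (β * s.1) * 4 by ring, pow_mul]
  ring

theorem DD_k (s : (DD hq0 hβ h0 hm hg).ι) :
    ((DD hq0 hβ h0 hm hg).k s : ℝ) = 2 * 2 ^ (is β ρ s - 4 * β * s.1) := by
  show (((2 * ((bs β ρ s : ℕ) : ℤ) : ℤ)) : ℝ) = _
  unfold bs; push_cast; rfl

theorem DD_decay (s : (DD hq0 hβ h0 hm hg).ι) : Decay s 8 := by
  intro j e hj
  rw [piE_eq]
  refine (piG_le (ms β s.1) j hj e).trans (le_of_eq ?_)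
  congr 2
  have : Fintype.card ((DD hq0 hβ h0 hm hg).Γ s) = (2 * ms β s.1) ^ 4 := by
    show Fintype.card (Fin 4 → DihedralGroup (ms β s.1)) = _
    rw [Fintype.card_fun, DihedralGroup.card, Fintype.card_fin]
  rw [this]; push_cast; rfl

theorem exists_sstar (hβ1 : 1 ≤ β) (i : ℕ) (hρ1 : 1 ≤ ρ i) : ∃ t : ℕ, ((2 : ℝ) ^ (4 * β)) ^ t ≤ ρ i ∧ ρ i < ((2 : ℝ) ^ (4 * β)) ^ (t + 1) := by
  have hB : (1 : ℝ) < 2 ^ (4 * β) := one_lt_pow₀ (by norm_num) (by omega)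
  exact exists_nat_pow_near hρ1 hB

end Params
end SE

namespace SE
set_option linter.unusedSectionVars false
set_option linter.unusedVariables false
set_option linter.unusedSimpArgs false

theorem sum_subtype_le (P : ℕ → Prop) (T : Finset ℕ) (F : {s : ℕ // P s} → ℝ) (G : ℕ → ℝ)
    (hG : ∀ s, 0 ≤ G s) (h : ∀ s : {s : ℕ // P s}, s.1 ∈ T → F s ≤ G s.1) :
    ∑ s ∈ T.subtype P, F s ≤ ∑ s ∈ T, G s := by
  calc ∑ s ∈ T.subtype P, F s ≤ ∑ s ∈ T.subtype P, G s.1 :=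
        Finset.sum_le_sum fun s hs => h s (Finset.mem_subtype.mp hs)
    _ = ∑ s ∈ T with P s, G s := Finset.sum_subtype_eq_sum_filter (s := T) (p := P) G
    _ ≤ _ := Finset.sum_le_sum_of_subset_of_nonneg (Finset.filter_subset _ _) fun s _ _ => hG s

theorem sums_aux {β : ℕ} {ρ : ℕ → ℝ} {q : ℝ} (hq0 : 0 ≤ q) (hβ1 : 1 ≤ β) (hβ : q ^ (4 * β + 1) < 2 ^ (4 * β))
    (h0 : ρ 0 = 1) (hm : Monotone ρ) (hg : ∀ i j, ρ (i + j) ≤ q ^ j * ρ i) (B : ℝ) (hB : B = (2 : ℝ) ^ (4 * β))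
    (kk : {s : ℕ // Pp β ρ s} → ℤ) (cd : {s : ℕ // Pp β ρ s} → ℝ)
    (hkk : ∀ s, (kk s : ℝ) = 2 * 2 ^ (is β ρ s - 4 * β * s.1)) (hcd : ∀ s, cd s = 256 * ((2 : ℝ) ^ (4 * β)) ^ s.1)
    (i N : ℕ) :
      (∃ Sat Un : Finset {s : ℕ // Pp β ρ s}, (∀ s, kk s ≤ N → s ∈ Sat ∨ s ∈ Un) ∧
        1 + ∑ s ∈ Sat, cd s ≤ 1000 * B * ρ i ∧
        1 + ∑ s ∈ Sat, Real.sqrt (cd s) ≤ 1000 * B * Real.sqrt (ρ i) ∧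
        ∑ s ∈ Un, 1 / (kk s : ℝ) ≤ 1000 * B * (ρ i / 2 ^ i) ∧
        ∑ s ∈ Un, 1 / Real.sqrt (kk s : ℝ) ≤ 1000 * B * Real.sqrt (ρ i / 2 ^ i)) ∧
      ∃ s : {s : ℕ // Pp β ρ s}, (kk s : ℝ) ≤ 1000 * B * (2 ^ i / ρ i) ∧ 1 / cd s ≤ 1000 * B * (1 / ρ i) := by
  have hB16 : 16 ≤ B := by
    rw [hB, pow_mul]; norm_num
    exact le_self_pow₀ (by norm_num) (by omega)
  have hρ1 : 1 ≤ ρ i := by rw [← h0]; exact hm (Nat.zero_le _)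
  obtain ⟨t, ht1, ht2⟩ := exists_sstar hβ1 i hρ1
  have ht0 := ht1
  rw [← hB] at ht1 ht2
  have hge := is_ge hq0 hβ h0 hm hg
  have hBt : B ^ (t + 1) ≤ B * ρ i := by
    rw [pow_succ']; exact mul_le_mul_of_nonneg_left ht1 (by linarith)
  constructor
  · have hk : ∀ s : {s : ℕ // Pp β ρ s}, t + 1 ≤ s.1 →
        2 ^ i * 2 ^ (s.1 - (t + 1)) / (B * ρ i) ≤ (kk s : ℝ) := by
      intro s hs
      rw [hkk]
      rw [div_le_iff₀ (by positivity)]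
      have h1 : i + (4 * β + 1) * (s.1 - (t + 1)) ≤ is β ρ s := by
        rcases Nat.eq_zero_or_pos (s.1 - (t + 1)) with h | h
        · rw [h, mul_zero, add_zero]
          by_contra hc
          push Not at hc
          have e1 := is_spec s
          have e2 := hm hc.le
          have e3 : s.1 = t + 1 := by omega
          rw [e3, ← hB] at e1
          linarith
        · refine (gapL hq0 hβ h0 hm hg i (is β ρ s) _ h (B ^ (t + 1)) ht2.le ?_).le
          rw [← hB, ← pow_add, Nat.sub_add_cancel hs, hB]; exact is_spec s
      have h2 : i + (s.1 - (t + 1)) ≤ is β ρ s - 4 * β * s.1 + 4 * β * (t + 1) := by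
        obtain ⟨d, hd⟩ : ∃ d, s.1 = t + 1 + d := ⟨s.1 - (t + 1), by omega⟩
        have h3 := hge s
        rw [hd] at h1 h3 ⊢
        have : t + 1 + d - (t + 1) = d := by omega
        rw [this] at h1 ⊢
        have e1 : (4 * β + 1) * d = 4 * β * d + d := by ring
        have e2 : 4 * β * (t + 1 + d) = 4 * β * (t + 1) + 4 * β * d := by ring
        rw [e1] at h1; rw [e2]
        omega
      have h4 : (2 : ℝ) ^ i * 2 ^ (s.1 - (t + 1)) ≤ 2 ^ (is β ρ s - 4 * β * s.1) * B ^ (t + 1) := by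
        rw [hB, ← pow_mul, ← pow_add, ← pow_add]
        exact pow_le_pow_right₀ (by norm_num) h2
      have h5 : (2 : ℝ) ^ (is β ρ s - 4 * β * s.1) * B ^ (t + 1) ≤ 2 ^ (is β ρ s - 4 * β * s.1) * (B * ρ i) :=
        mul_le_mul_of_nonneg_left hBt (by positivity)
      have h6 : 0 ≤ (2 : ℝ) ^ (is β ρ s - 4 * β * s.1) * (B * ρ i) := by positivity
      nlinarith
    refine ⟨(Finset.range (t + 1)).subtype (Pp β ρ), (Finset.Ico (t + 1) (N + 1)).subtype (Pp β ρ), ?_, ?_, ?_, ?_, ?_⟩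
    · intro s hs
      rw [Finset.mem_subtype, Finset.mem_subtype, Finset.mem_range, Finset.mem_Ico]
      have h1 : s.1 < N := by
        have h2 : (kk s : ℝ) ≤ N := by exact_mod_cast hs
        rw [hkk] at h2
        have h3 := hge s
        have e3 : (4 * β + 1) * s.1 = 4 * β * s.1 + s.1 := by ring
        have h4 : s.1 ≤ is β ρ s - 4 * β * s.1 := by omega
        have h5 : (2 : ℝ) ^ s.1 ≤ 2 ^ (is β ρ s - 4 * β * s.1) := pow_le_pow_right₀ (by norm_num) h4
        have h6 : (s.1 : ℝ) < 2 ^ s.1 := by exact_mod_cast Nat.lt_two_pow_self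
        have : (s.1 : ℝ) < N := by linarith [show (0:ℝ) < 2 ^ s.1 by positivity]
        exact_mod_cast this
      omega
    · have h := sum_subtype_le (Pp β ρ) (Finset.range (t + 1))
        (fun s => cd s) (fun s => 256 * B ^ s) (fun s => by positivity)
        (fun s _ => le_of_eq (by rw [hcd, ← hB]))
      rw [← Finset.mul_sum] at h
      have h2 := geom_up B (by linarith) t
      refine (add_le_add_right h 1).trans ?_
      nlinarith
    · have h := sum_subtype_le (Pp β ρ) (Finset.range (t + 1))
        (fun s => Real.sqrt (cd s)) (fun s => 16 * (Real.sqrt B) ^ s) (fun s => by positivity)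
        (fun s _ => le_of_eq (by
          rw [hcd, Real.sqrt_mul (by norm_num), ← hB,
            show (256 : ℝ) = 16 ^ 2 by norm_num, Real.sqrt_sq (by norm_num)]
          congr 1
          rw [Real.sqrt_eq_iff_mul_self_eq (by positivity) (by positivity), ← mul_pow, Real.mul_self_sqrt (by positivity)]))
      rw [← Finset.mul_sum] at h
      have h1 : 2 ≤ Real.sqrt B := Real.le_sqrt_of_sq_le (by linarith)
      have h2 := geom_up (Real.sqrt B) h1 t
      have h3 : Real.sqrt B ^ t ≤ Real.sqrt (ρ i) := by
        apply Real.le_sqrt_of_sq_le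
        rw [← pow_mul, mul_comm, pow_mul, Real.sq_sqrt (by positivity)]; exact ht1
      have h4 : 1 ≤ Real.sqrt (ρ i) := Real.one_le_sqrt.mpr hρ1
      refine (add_le_add_right h 1).trans ?_
      nlinarith
    · have h := sum_subtype_le (Pp β ρ) (Finset.Ico (t + 1) (N + 1))
        (fun s => 1 / (kk s : ℝ)) (fun s => (B * (ρ i / 2 ^ i)) * (1 / 2) ^ (s - (t + 1))) (fun s => by positivity)
        (fun s hs => by
          have h1 := hk s (Finset.mem_Ico.mp hs).1
          refine (one_div_le_one_div_of_le (by positivity) h1).trans (le_of_eq ?_)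
          rw [div_pow, one_pow]
          field_simp)
      rw [← Finset.mul_sum] at h
      have h2 := geom_down (1 / 2) (by norm_num) (by norm_num) (t + 1) (N + 1)
      have h3 := mul_le_mul_of_nonneg_left h2 (show 0 ≤ B * (ρ i / 2 ^ i) by positivity)
      refine h.trans (h3.trans ?_)
      have : 0 ≤ B * (ρ i / 2 ^ i) := by positivity
      nlinarith
    · have hy1 : Real.sqrt (1 / 2) ≤ 3 / 4 := by
        rw [Real.sqrt_le_left (by norm_num)]; norm_num
      have h := sum_subtype_le (Pp β ρ) (Finset.Ico (t + 1) (N + 1))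
        (fun s => 1 / Real.sqrt (kk s : ℝ))
        (fun s => (Real.sqrt B * Real.sqrt (ρ i / 2 ^ i)) * (Real.sqrt (1 / 2)) ^ (s - (t + 1))) (fun s => by positivity)
        (fun s hs => by
          have h1 := hk s (Finset.mem_Ico.mp hs).1
          have h2 := one_div_le_one_div_of_le (by positivity) (Real.sqrt_le_sqrt h1)
          refine h2.trans (le_of_eq ?_)
          have e : ∀ (x : ℝ) (d : ℕ), 0 ≤ x → Real.sqrt x ^ d = Real.sqrt (x ^ d) := by
            intro x d hx
            symm
            rw [Real.sqrt_eq_iff_mul_self_eq (by positivity) (by positivity), ← mul_pow, Real.mul_self_sqrt hx]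
          rw [e _ _ (by norm_num), ← Real.sqrt_mul (by positivity), ← Real.sqrt_mul (by positivity), one_div, ← Real.sqrt_inv]
          congr 1
          rw [div_pow, one_pow]
          field_simp)
      rw [← Finset.mul_sum] at h
      have h2 := geom_down (Real.sqrt (1 / 2)) (by positivity) hy1 (t + 1) (N + 1)
      have h3 := mul_le_mul_of_nonneg_left h2 (show 0 ≤ Real.sqrt B * Real.sqrt (ρ i / 2 ^ i) by positivity)
      refine h.trans (h3.trans ?_)
      have h4 : Real.sqrt B ≤ B := by
        rw [Real.sqrt_le_left (by positivity)]; nlinarith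
      have h5 : Real.sqrt B * Real.sqrt (ρ i / 2 ^ i) ≤ B * Real.sqrt (ρ i / 2 ^ i) := mul_le_mul_of_nonneg_right h4 (by positivity)
      have h6 : 0 ≤ B * Real.sqrt (ρ i / 2 ^ i) := by positivity
      linarith
  · have hinv : 1 / B ^ t ≤ B * (1 / ρ i) := by
      rw [mul_one_div, div_le_div_iff₀ (by positivity) (by positivity)]
      rw [pow_succ'] at ht2; linarith
    have hPt : Pp β ρ t := ⟨i, ht0⟩
    refine ⟨(⟨t, hPt⟩ : {s : ℕ // Pp β ρ s}), ?_, ?_⟩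
    · rw [hkk]
      have h3 : is β ρ ⟨t, hPt⟩ ≤ i := Nat.find_min' _ ht0
      have h4 := hge ⟨t, hPt⟩
      have e3 : (4 * β + 1) * t = 4 * β * t + t := by ring
      simp only at h4 ⊢
      have h5 : (2 : ℝ) ^ (is β ρ ⟨t, hPt⟩ - 4 * β * t) * B ^ t ≤ 2 ^ i := by
        rw [hB, ← pow_mul, ← pow_add]
        exact pow_le_pow_right₀ (by norm_num) (by omega)
      rw [← le_div_iff₀ (by positivity)] at h5
      have h6 : (2 : ℝ) ^ i / B ^ t ≤ 2 ^ i * (B * (1 / ρ i)) := by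
        rw [div_eq_mul_one_div]; exact mul_le_mul_of_nonneg_left hinv (by positivity)
      have e7 : 1000 * B * (2 ^ i / ρ i) = 1000 * (2 ^ i * (B * (1 / ρ i))) := by ring
      rw [e7]
      have h8 : 0 ≤ (2 : ℝ) ^ i * (B * (1 / ρ i)) := by positivity
      linarith
    · rw [hcd, ← hB]
      have h8 : 0 ≤ (B * (1 / ρ i)) := by positivity
      have h9 : 1 / (256 * B ^ t) ≤ 1 / B ^ t := one_div_le_one_div_of_le (by positivity) (by nlinarith [show 0 < B ^ t by positivity])
      refine h9.trans (hinv.trans ?_)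
      rw [mul_assoc]; linarith


theorem sys_exists (q : ℝ) (hq0 : 0 ≤ q) (hq : q < 2) : ∃ K : ℝ, 1 ≤ K ∧ ∀ ρ : ℕ → ℝ, ρ 0 = 1 → Monotone ρ →
    (∀ i j, ρ (i + j) ≤ q ^ j * ρ i) → ∃ D : Sys, (∀ s : D.ι, Decay s 8) ∧ ∀ i N : ℕ,
      (∃ Sat Un : Finset D.ι, (∀ s, D.k s ≤ N → s ∈ Sat ∨ s ∈ Un) ∧
        1 + ∑ s ∈ Sat, (Fintype.card (D.Γ s) : ℝ) ≤ K * ρ i ∧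
        1 + ∑ s ∈ Sat, Real.sqrt (Fintype.card (D.Γ s) : ℝ) ≤ K * Real.sqrt (ρ i) ∧
        ∑ s ∈ Un, 1 / (D.k s : ℝ) ≤ K * (ρ i / 2 ^ i) ∧
        ∑ s ∈ Un, 1 / Real.sqrt (D.k s : ℝ) ≤ K * Real.sqrt (ρ i / 2 ^ i)) ∧
      ∃ s : D.ι, (D.k s : ℝ) ≤ K * (2 ^ i / ρ i) ∧ 1 / (Fintype.card (D.Γ s) : ℝ) ≤ K * (1 / ρ i) := by
  obtain ⟨β, hβ1, hβ⟩ := exists_beta q hq0 hq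
  obtain ⟨B, hB⟩ : ∃ B : ℝ, B = (2 : ℝ) ^ (4 * β) := ⟨_, rfl⟩
  have hB16 : 16 ≤ B := by
    rw [hB, pow_mul]; norm_num
    exact le_self_pow₀ (by norm_num) (by omega)
  refine ⟨1000 * B, by linarith, fun ρ h0 hm hg => ?_⟩
  refine ⟨DD hq0 hβ h0 hm hg, DD_decay hq0 hβ h0 hm hg, fun i N => ?_⟩
  exact sums_aux hq0 hβ1 hβ h0 hm hg B hB (DD hq0 hβ h0 hm hg).k (fun s : (DD hq0 hβ h0 hm hg).ι => (Fintype.card ((DD hq0 hβ h0 hm hg).Γ s) : ℝ))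
    (DD_k hq0 hβ h0 hm hg) (DD_card hq0 hβ h0 hm hg) i N

end SE

namespace SE
set_option linter.unusedSectionVars false
set_option linter.unusedVariables false
set_option linter.unusedSimpArgs false

theorem four_sqrt : (4 : ℝ) ^ ((1 : ℝ) / 2) = 2 := by
  rw [← Real.sqrt_eq_rpow, show (4 : ℝ) = 2 ^ 2 by norm_num, Real.sqrt_sq (by norm_num)]

set_option maxHeartbeats 2000000 in
theorem sys_real (γ : ℝ) (hγ0 : 0 ≤ γ) (hγ : γ < 1) : ∃ K : ℝ, 1 ≤ K ∧ ∀ r : ℝ → ℝ,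
    (∀ x, 1 ≤ x → 0 < r x) → r 1 = 1 →
    (∀ a n : ℝ, 1 ≤ a → 1 ≤ n → a ^ ((1 : ℝ) / 2) * r n ≤ r (a * n) ∧ r (a * n) ≤ a ^ γ * r n) →
    ∃ D : Sys, ∀ n : ℕ, 1 ≤ n →
      (∃ Sat Un : Finset D.ι, (∀ s, D.k s ≤ n → s ∈ Sat ∨ s ∈ Un) ∧
        Real.sqrt n * (1 + ∑ s ∈ Sat, (Fintype.card (D.Γ s) : ℝ)) + n * ∑ s ∈ Un, 1 / (D.k s : ℝ) ≤ K * r n ∧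
        Real.sqrt n * Real.sqrt (Real.sqrt n) * (1 + ∑ s ∈ Sat, Real.sqrt (Fintype.card (D.Γ s) : ℝ))
          + n * ∑ s ∈ Un, 1 / Real.sqrt (D.k s : ℝ) ≤ K * Real.sqrt (n * r n)) ∧
      ∃ (s : D.ι) (M : ℝ), 1 ≤ M ∧ M ≤ K * (n / r n) ∧
        ∀ j, j < n → Ex pr j (fun l => (VV s l ((0 : ℤ), (1 : D.Γ s)) : ℝ)) ≤ M := by
  have hq : (4 : ℝ) ^ γ / 2 < 2 := by
    have : (4 : ℝ) ^ γ < 4 ^ (1 : ℝ) := Real.rpow_lt_rpow_of_exponent_lt (by norm_num) hγ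
    rw [Real.rpow_one] at this; linarith
  obtain ⟨K, hK, H⟩ := sys_exists ((4 : ℝ) ^ γ / 2) (by positivity) hq
  refine ⟨118 * K, by linarith, fun r hpos h1 hr => ?_⟩
  have h41 : ∀ i : ℕ, (1 : ℝ) ≤ 4 ^ i := fun i => one_le_pow₀ (by norm_num)
  obtain ⟨D, hdec, hD⟩ := H (fun i => r (4 ^ i) / 2 ^ i) (by simp [h1])
    (monotone_nat_of_le_succ fun i => by
      have := (hr 4 (4 ^ i) (by norm_num) (h41 i)).1
      rw [four_sqrt, ← pow_succ'] at this
      rw [div_le_div_iff₀ (by positivity) (by positivity), pow_succ (2 : ℝ) i]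
      nlinarith [show (0 : ℝ) < 2 ^ i by positivity])
    (fun i j => by
      have := (hr (4 ^ j) (4 ^ i) (h41 j) (h41 i)).2
      rw [← pow_add, add_comm j i, ← Real.rpow_pow_comm (by norm_num)] at this
      rw [div_pow, div_mul_div_comm, ← pow_add, add_comm j i]
      gcongr)
  refine ⟨D, fun n hn => ?_⟩
  obtain ⟨i, hi1, hi2⟩ : ∃ i : ℕ, 4 ^ i ≤ n ∧ n < 4 ^ (i + 1) :=
    exists_nat_pow_near hn (by norm_num)
  obtain ⟨⟨Sat, Un, hcov, a1, a2, a3, a4⟩, s, b1, b2⟩ := hD i n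
  have hnR : (1 : ℝ) ≤ n := by exact_mod_cast hn
  have hi1R : (4 : ℝ) ^ i ≤ n := by exact_mod_cast hi1
  have hi2R : (n : ℝ) < 4 ^ (i + 1) := by exact_mod_cast hi2
  have e4 : (4 : ℝ) ^ i = (2 ^ i) ^ 2 := by rw [← pow_mul, mul_comm, pow_mul]; norm_num
  obtain ⟨X, hX⟩ : ∃ X, X = Real.sqrt n := ⟨_, rfl⟩
  have hX2 : X ^ 2 = n := by rw [hX]; exact Real.sq_sqrt (by positivity)
  have hX0 : 0 < X := by rw [hX]; exact Real.sqrt_pos.mpr (by linarith)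
  rw [pow_succ] at hi2R
  rw [e4] at hi1R hi2R
  obtain ⟨p, hp⟩ : ∃ p : ℝ, p = 2 ^ i := ⟨_, rfl⟩
  have hp0 : 0 < p := by rw [hp]; positivity
  have hρr := hr (n / 4 ^ i) (4 ^ i) (by rw [one_le_div (by positivity), e4]; exact hi1R) (h41 i)
  rw [div_mul_cancel₀ _ (by positivity)] at hρr
  obtain ⟨ρ, hρ⟩ : ∃ ρ : ℝ, ρ = r (4 ^ i) / 2 ^ i := ⟨_, rfl⟩
  have hρ0 : 0 < ρ := by rw [hρ]; exact div_pos (hpos _ (h41 i)) (by positivity)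
  have hr4 : r (4 ^ i) = p * ρ := by rw [hρ, hp]; field_simp
  simp only [← hρ] at a1 a2 a3 a4 b1 b2
  simp only [← hp] at e4 hi1R hi2R a3 a4 b1
  rw [← hX2] at hi1R hi2R
  have hpX : p ≤ X := by nlinarith
  have hXp : X ≤ 2 * p := by nlinarith
  obtain ⟨R, hR⟩ : ∃ R, R = r n := ⟨_, rfl⟩
  have hR0 : 0 < R := by rw [hR]; exact hpos _ hnR
  have hlo : X * ρ ≤ R := by
    have h := hρr.1
    rw [← Real.sqrt_eq_rpow, e4, ← hX2, Real.sqrt_div (by positivity), Real.sqrt_sq hX0.le, Real.sqrt_sq hp0.le, hX2, ← e4, hr4, ← hR] at h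
    calc X * ρ = X / p * (p * ρ) := by field_simp
      _ ≤ R := h
  have hhi : R ≤ 2 * X * ρ := by
    have h := hρr.2
    have h1 : (n / 4 ^ i : ℝ) ^ γ ≤ n / 4 ^ i := by
      have : (1 : ℝ) ≤ n / 4 ^ i := by rw [one_le_div (by positivity), e4, ← hX2]; exact hi1R
      calc (n / 4 ^ i : ℝ) ^ γ ≤ (n / 4 ^ i : ℝ) ^ (1 : ℝ) := Real.rpow_le_rpow_of_exponent_le this hγ.le
        _ = _ := Real.rpow_one _
    rw [← hR] at h
    have h2 : R ≤ n / 4 ^ i * r (4 ^ i) := h.trans (mul_le_mul_of_nonneg_right h1 (hpos _ (h41 i)).le)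
    rw [hr4, e4, ← hX2] at h2
    have h3 : X ^ 2 / p ^ 2 * (p * ρ) = X * ρ * (X / p) := by field_simp
    have h4 : X / p ≤ 2 := by rw [div_le_iff₀ hp0]; exact hXp
    rw [h3] at h2
    nlinarith [mul_pos hX0 hρ0]
  rw [← hX, ← hR, ← hX2]
  have hpos3 : 0 < X * ρ := by positivity
  refine ⟨⟨Sat, Un, hcov, ?_, ?_⟩, s, (2 * D.k s + 1) * (1 + 2 * 8) + 8 * (X / Fintype.card (D.Γ s)), ?_, ?_, ?_⟩
  · have c1 := mul_le_mul_of_nonneg_left a1 hX0.le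
    have c2 := mul_le_mul_of_nonneg_left a3 (show 0 ≤ X ^ 2 by positivity)
    have c3 : X ^ 2 * (K * (ρ / p)) ≤ K * (2 * (X * ρ)) := by
      have : X ^ 2 * (K * (ρ / p)) = K * ((X / p) * (X * ρ)) := by ring
      rw [this]
      have h4 : X / p ≤ 2 := by rw [div_le_iff₀ hp0]; exact hXp
      gcongr
    have c4 : K * (X * ρ) ≤ K * R := by gcongr
    have c5 : 0 ≤ K * R := by positivity
    nlinarith
  · have hy : 0 < Real.sqrt X := Real.sqrt_pos.mpr hX0
    have d1 : X * Real.sqrt X * Real.sqrt ρ ≤ Real.sqrt (X ^ 2 * R) := by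
      apply Real.le_sqrt_of_sq_le
      rw [mul_pow, mul_pow, Real.sq_sqrt hX0.le, Real.sq_sqrt hρ0.le]
      have := mul_le_mul_of_nonneg_left hlo (sq_nonneg X)
      linarith
    have d2 : X ^ 2 * Real.sqrt (ρ / p) ≤ 2 * Real.sqrt (X ^ 2 * R) := by
      have h4 : X / p ≤ 2 := by rw [div_le_iff₀ hp0]; exact hXp
      have : (X ^ 2 * Real.sqrt (ρ / p)) ^ 2 ≤ (2 * Real.sqrt (X ^ 2 * R)) ^ 2 := by
        rw [mul_pow, mul_pow, Real.sq_sqrt (by positivity), Real.sq_sqrt (by positivity)]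
        have e : (X ^ 2) ^ 2 * (ρ / p) = X ^ 2 * ((X / p) * (X * ρ)) := by field_simp
        rw [e]
        have f1 : (X / p) * (X * ρ) ≤ 4 * R := by
          have := mul_le_mul_of_nonneg_right h4 hpos3.le
          linarith
        have := mul_le_mul_of_nonneg_left f1 (sq_nonneg X)
        linarith
      exact (pow_le_pow_iff_left₀ (by positivity) (by positivity) (by norm_num)).mp this
    have c1 := mul_le_mul_of_nonneg_left a2 (show 0 ≤ X * Real.sqrt X by positivity)
    have c2 := mul_le_mul_of_nonneg_left a4 (show 0 ≤ X ^ 2 by positivity)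
    have c3 := mul_le_mul_of_nonneg_left d1 (show 0 ≤ K by linarith)
    have c4 := mul_le_mul_of_nonneg_left d2 (show 0 ≤ K by linarith)
    have c5 : 0 ≤ K * Real.sqrt (X ^ 2 * R) := by positivity
    nlinarith
  · have := kR s
    have : 0 ≤ X / (Fintype.card (D.Γ s) : ℝ) := by positivity
    nlinarith
  · have hk := kR s
    have c1 : X / (Fintype.card (D.Γ s) : ℝ) ≤ K * (X / ρ) := by
      calc X / (Fintype.card (D.Γ s) : ℝ) = X * (1 / (Fintype.card (D.Γ s) : ℝ)) := by ring
        _ ≤ X * (K * (1 / ρ)) := by gcongr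
        _ = _ := by ring
    have c2 : K * (p / ρ) ≤ K * (X / ρ) := by gcongr
    have c3 : X / ρ ≤ 2 * (X ^ 2 / R) := by
      rw [← mul_div_assoc, div_le_div_iff₀ hρ0 hR0]
      nlinarith
    have c4 : K * (X / ρ) ≤ K * (2 * (X ^ 2 / R)) := by gcongr
    nlinarith
  · intro j hj
    refine (v_origin s 8 (by norm_num) (hdec s) j).trans ?_
    gcongr
    rw [hX]
    exact Real.sqrt_le_sqrt (by exact_mod_cast hj.le)

end SE

namespace SE
set_option linter.unusedSectionVars false
set_option linter.unusedVariables false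
set_option linter.unusedSimpArgs false

variable {D : Sys}

theorem xi_abs (e : Bool × Bool) : (xi ℤ e).natAbs ≤ 1 := by
  rcases e with ⟨a, b⟩; cases a <;> cases b <;> simp [xi]

theorem q0_abs (l : List Om) : ∀ x, (q0 ℤ l x).natAbs ≤ l.length := by
  induction l with
  | nil => intro x; simp [q0]
  | cons ω l ih =>
    intro x
    rcases ω with e | α | α | e
    · rw [q0]; exact (ih _).trans (by simp)
    · rw [q0]; exact (ih _).trans (by simp)
    · rw [q0]; exact (ih _).trans (by simp)
    · rw [q0]
      have h1 := xi_abs e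
      have h2 := ih x
      simp only [List.length_cons]
      split_ifs <;> omega

theorem Phi_le (s : D.ι) (W : Finset ℤ) (l : List Om) : Phi s W (XX D ℤ l) ≤ l.length := by
  induction l using List.reverseRecOn with
  | nil => simp [XX, Xw, Phi_one]
  | append_singleton l ω ih =>
    have h : XX D ℤ (l ++ [ω]) = XX D ℤ l * val D ℤ ω := by simp [XX, Xw]
    rw [h]
    refine (Phi_step s W _ ω).trans ?_
    simp only [List.length_append, List.length_cons, List.length_nil]
    push_cast; linarith

theorem q_abs (l : List Om) (s : D.ι) (x : ℤ) (h : D.Γ s) : (((XX D ℤ l).φ s x).q h).natAbs ≤ l.length := by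
  have h1 := Phi_le s {x} l
  have h2 : |((((XX D ℤ l).φ s x).q h : ℤ) : ℝ)| ≤ Phi s {x} (XX D ℤ l) := by
    unfold Phi
    rw [Finset.sum_singleton]
    exact Finset.single_le_sum (f := fun h => |((((XX D ℤ l).φ s x).q h : ℤ) : ℝ)|) (fun _ _ => abs_nonneg _) (Finset.mem_univ h)
  have h3 := h2.trans h1
  rw [← Int.cast_abs, Int.abs_eq_natAbs] at h3
  exact_mod_cast h3

theorem reach_c (S : Set (Hg D ℤ)) (n : ℕ) (hn : 1 ≤ n)
    (hS : ∀ γ : ℤ, γ.natAbs ≤ n → hC D (Pi.single 0 γ) ∈ S) (k : ℕ) : ∀ γ : ℤ, γ.natAbs ≤ k * n →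
    Reach S (hC D (Pi.single 0 γ)) k := by
  induction k with
  | zero =>
    intro γ hγ
    have : γ = 0 := by simpa using hγ
    subst this
    rw [Pi.single_zero, hC_zero]; exact Reach.one
  | succ k ih =>
    intro γ hγ
    obtain ⟨δ, ε, rfl, h1, h2⟩ : ∃ δ ε : ℤ, γ = δ + ε ∧ δ.natAbs ≤ k * n ∧ ε.natAbs ≤ n := by
      have e : (k + 1) * n = k * n + n := by ring
      rw [e] at hγ
      generalize k * n = m at *
      rcases le_total 0 γ with h | h
      · rcases le_total γ n with h' | h'
        · exact ⟨0, γ, by ring, by simp, by omega⟩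
        · exact ⟨γ - n, n, by ring, by omega, by omega⟩
      · rcases le_total (-n : ℤ) γ with h' | h'
        · exact ⟨0, γ, by ring, by simp, by omega⟩
        · exact ⟨γ + n, -n, by ring, by omega, by omega⟩
    rw [Pi.single_add, hC_add]
    exact (ih δ h1).mul (Reach.of_mem (hS ε h2))

theorem mem_range_c (γ : ℤ) (h : γ.natAbs ≤ 1) : hC D (Pi.single 0 γ) ∈ Set.range (val D ℤ) := by
  have : γ = 0 ∨ γ = 1 ∨ γ = -1 := by omega
  rcases this with rfl | rfl | rfl
  · exact ⟨Sum.inr (Sum.inr (Sum.inr (false, false))), by simp [val, xi]⟩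
  · exact ⟨Sum.inr (Sum.inr (Sum.inr (true, false))), by simp [val, xi]⟩
  · exact ⟨Sum.inr (Sum.inr (Sum.inr (false, true))), by simp [val, xi]⟩

theorem cost_Z : Cost (Set.range (val D ℤ)) Int.natAbs where
  t1 := ⟨Sum.inl true, by simp [val, dir]⟩
  t2 := ⟨Sum.inl false, by simp [val, dir]⟩
  a α := ⟨Sum.inr (Sum.inl α), rfl⟩
  b α := ⟨Sum.inr (Sum.inr (Sum.inl α)), rfl⟩
  c γ := reach_c _ 1 le_rfl mem_range_c _ γ (by simp)
  w0 := rfl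
  wneg γ := Int.natAbs_neg γ
  wadd γ δ := Int.natAbs_add_le γ δ

theorem cost_2 : Cost (Set.range (val D Q2)) (fun γ => if γ = 0 then 0 else 1) where
  t1 := ⟨Sum.inl true, by simp [val, dir]⟩
  t2 := ⟨Sum.inl false, by simp [val, dir]⟩
  a α := ⟨Sum.inr (Sum.inl α), rfl⟩
  b α := ⟨Sum.inr (Sum.inr (Sum.inl α)), rfl⟩
  c γ := by
    have : ∀ γ : Q2, γ = 0 ∨ γ = 1 := by decide
    rcases this γ with rfl | rfl
    · rw [Pi.single_zero, hC_zero]; exact Reach.one.mono (Nat.zero_le _)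
    · rw [if_neg (by decide)]
      exact Reach.of_mem ⟨Sum.inr (Sum.inr (Sum.inr (true, false))), by simp [val, xi]⟩
  w0 := by simp
  wneg γ := by simp
  wadd γ δ := by
    by_cases h1 : γ = 0 <;> by_cases h2 : δ = 0 <;> simp [h1, h2]
    split_ifs <;> omega

noncomputable def wn (n : ℕ) (γ : ℤ) : ℕ := ⌈(γ.natAbs : ℚ) / n⌉₊

noncomputable def Tn (D : Sys) (n : ℕ) : Finset (Hg D ℤ) :=
  Finset.univ.image (val D ℤ) ∪ (Finset.Icc (-n : ℤ) n).image (fun γ => hC D (Pi.single 0 γ))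

theorem card_Om : Fintype.card Om = 38 := by
  have := card_AA
  simp only [Om, Fintype.card_sum, Fintype.card_prod, Fintype.card_bool, this]

theorem Tn_card (n : ℕ) (hn : 1 ≤ n) : ((Tn D n).card : ℝ) ≤ 41 * n := by
  have h1 : (Tn D n).card ≤ 38 + (2 * n + 1) := by
    refine (Finset.card_union_le _ _).trans (add_le_add (Finset.card_image_le.trans ?_) (Finset.card_image_le.trans ?_))
    · rw [Finset.card_univ, card_Om]
    · rw [Int.card_Icc]; omega
  have : (Tn D n).card ≤ 41 * n := by omega
  exact_mod_cast this

theorem cost_n (n : ℕ) (hn : 1 ≤ n) : Cost (Tn D n : Set (Hg D ℤ)) (wn n) where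
  t1 := by
    refine Finset.mem_coe.mpr (Finset.mem_union_left _ (Finset.mem_image.mpr ⟨Sum.inl true, Finset.mem_univ _, ?_⟩)); simp [val, dir]
  t2 := by
    refine Finset.mem_coe.mpr (Finset.mem_union_left _ (Finset.mem_image.mpr ⟨Sum.inl false, Finset.mem_univ _, ?_⟩)); simp [val, dir]
  a α := Finset.mem_coe.mpr (Finset.mem_union_left _ (Finset.mem_image.mpr ⟨Sum.inr (Sum.inl α), Finset.mem_univ _, rfl⟩))
  b α := Finset.mem_coe.mpr (Finset.mem_union_left _ (Finset.mem_image.mpr ⟨Sum.inr (Sum.inr (Sum.inl α)), Finset.mem_univ _, rfl⟩))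
  c γ := by
    refine reach_c _ n hn (fun γ hγ => ?_) _ γ ?_
    · refine Finset.mem_coe.mpr (Finset.mem_union_right _ (Finset.mem_image.mpr ⟨γ, ?_, rfl⟩))
      rw [Finset.mem_Icc]; omega
    · have h := Nat.le_ceil ((γ.natAbs : ℚ) / n)
      have hn' : (0 : ℚ) < n := by exact_mod_cast hn
      rw [div_le_iff₀ hn'] at h
      exact_mod_cast h
  w0 := by simp [wn]
  wneg γ := by simp [wn]
  wadd γ δ := by
    unfold wn
    refine le_trans ?_ (Nat.ceil_add_le _ _)
    rw [← add_div]
    refine Nat.ceil_mono ?_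
    have : ((γ + δ).natAbs : ℚ) ≤ γ.natAbs + δ.natAbs := by exact_mod_cast Int.natAbs_add_le γ δ
    gcongr

theorem wn_le (n : ℕ) (γ : ℤ) (h : γ.natAbs ≤ n) : wn n γ ≤ 1 := by
  unfold wn
  rw [Nat.ceil_le]
  push_cast
  refine div_le_one_of_le₀ ?_ (by positivity)
  exact_mod_cast h

end SE

namespace SE
set_option linter.unusedSectionVars false
set_option linter.unusedVariables false
set_option linter.unusedSimpArgs false

section Prod
variable {H H' Ω Ω' : Type} [Group H] [Group H'] (v : Ω → H) (v' : Ω' → H')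

def vP (ω : Ω × Ω') : H × H' := (v ω.1, v' ω.2)

theorem reach_map {H₁ H₂ : Type} [Group H₁] [Group H₂] (φ : H₁ →* H₂) {S : Set H₁} {S' : Set H₂}
    (h : ∀ s ∈ S, φ s ∈ S') {g : H₁} {N : ℕ} (hg : Reach S g N) : Reach S' (φ g) N := by
  obtain ⟨l, hl, hm, rfl⟩ := hg
  refine ⟨l.map φ, by simpa using hl, ?_, by rw [map_list_prod]⟩
  intro x hx
  obtain ⟨y, hy, rfl⟩ := List.mem_map.mp hx
  exact h y (hm y hy)

theorem reach_vP (ω : Ω) (ω' : Ω') (h1 : v ω = 1) (h1' : v' ω' = 1) {g : H} {g' : H'} {N N' : ℕ}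
    (hg : Reach (Set.range v) g N) (hg' : Reach (Set.range v') g' N') :
    Reach (Set.range (vP v v')) (g, g') (N + N') := by
  have a := reach_map (MonoidHom.inl H H') (S' := Set.range (vP v v')) (by
    rintro _ ⟨x, rfl⟩; exact ⟨(x, ω'), by simp [vP, h1']⟩) hg
  have b := reach_map (MonoidHom.inr H H') (S' := Set.range (vP v v')) (by
    rintro _ ⟨x, rfl⟩; exact ⟨(ω, x), by simp [vP, h1]⟩) hg'
  have := a.mul b
  simpa using this
end Prod

variable {D : Sys} {Q : Type} [CommRing Q]

theorem val_one : val D Q (Sum.inr (Sum.inl 1)) = 1 := by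
  simp only [val, Pi.mulSingle_one, hA_one]

theorem log_bound (n : ℕ) (hn : 1 ≤ n) : Real.log (2 * (41 * n)) ≤ 8 * Real.log (n + 1) := by
  have hnR : (1 : ℝ) ≤ n := by exact_mod_cast hn
  rw [show (8 : ℝ) = (8 : ℕ) by norm_num, ← Real.log_pow]
  apply Real.log_le_log (by positivity)
  have h1 : (2 : ℝ) ^ 7 ≤ ((n : ℝ) + 1) ^ 7 := pow_le_pow_left₀ (by norm_num) (by linarith) 7
  rw [pow_succ]
  norm_num at h1
  nlinarith

/-- The first factor. -/
theorem G1 (γ : ℝ) (hγ0 : 0 ≤ γ) (hγ : γ < 1) : ∃ K : ℝ, 1 ≤ K ∧ ∀ r : ℝ → ℝ,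
    (∀ x, 1 ≤ x → 0 < r x) → r 1 = 1 →
    (∀ a n : ℝ, 1 ≤ a → 1 ≤ n → a ^ ((1 : ℝ) / 2) * r n ≤ r (a * n) ∧ r (a * n) ≤ a ^ γ * r n) →
    ∃ D : Sys, ∃ N : List Om → ℕ, (∀ l, Reach (Set.range (val D Q2)) (XX D Q2 l) (N l)) ∧
      ∀ n : ℕ, 1 ≤ n → Ex pr n (fun l => (N l : ℝ)) ≤ K * r n ∧
        Ent pr (val D Q2) n ≤ K * r n ∧ r n ≤ K * Ent pr (val D Q2) n := by
  obtain ⟨K, hK, H⟩ := sys_real γ hγ0 hγ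
  have hlog76 : Real.log (2 * 38) ≤ 75 := by
    have := Real.log_le_sub_one_of_pos (show (0 : ℝ) < 2 * 38 by norm_num); linarith
  have hlog2 : Real.log 2 ≤ 1 := by
    have := Real.log_le_sub_one_of_pos (show (0 : ℝ) < 2 by norm_num); linarith
  have hlog2' : 1 / 2 ≤ Real.log 2 := by
    have := Real.log_two_gt_d9; linarith
  refine ⟨3200 * K * 75 + 1, by linarith, fun r hpos h1 hr => ?_⟩
  obtain ⟨D, hD⟩ := H r hpos h1 hr
  refine ⟨D, RB D (fun γ : Q2 => if γ = 0 then 0 else 1), cost_2.reach_RB, fun n hn => ?_⟩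
  obtain ⟨⟨Sat, Un, hcov, a1, a2⟩, s, M, hM1, hM, hMj⟩ := hD n hn
  have hnR : (1 : ℝ) ≤ n := by exact_mod_cast hn
  have hw : ∀ γ : Q2, (if γ = 0 then 0 else 1) ≤ 1 := by intro γ; split_ifs <;> omega
  have hr0 := hpos n hnR
  have hr1 : 1 ≤ r n := by
    have := (hr n 1 hnR le_rfl).1
    rw [h1, mul_one, mul_one] at this
    exact (Real.one_le_rpow hnR (by norm_num)).trans this
  have u := Ex_RB_small (D := D) (fun γ : Q2 => if γ = 0 then 0 else 1) (by simp) n hn Sat Un hcov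
    (fun l x _ => hw _) (fun l s x h _ => hw _)
  have u2 : Ex pr n (fun l => (RB D (fun γ : Q2 => if γ = 0 then 0 else 1) l : ℝ)) ≤ 3200 * (K * r n) :=
    u.trans (mul_le_mul_of_nonneg_left a1 (by norm_num))
  have hKr : 0 < K * r n := by positivity
  refine ⟨by nlinarith, ?_, ?_⟩
  · have e := Ent_le pr (val D Q2) pr_pos pr_sum (n := n) (Finset.univ.image (val D Q2)) 38
      (by
        have := Finset.card_image_le (s := Finset.univ) (f := val D Q2)
        rw [Finset.card_univ, card_Om] at this
        exact_mod_cast this) (by norm_num) (RB D (fun γ : Q2 => if γ = 0 then 0 else 1))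
      (fun l _ => by
        rw [Finset.coe_image, Finset.coe_univ, Set.image_univ]; exact cost_2.reach_RB l)
    have : Ex pr n (fun l => (RB D (fun γ : Q2 => if γ = 0 then 0 else 1) l : ℝ)) * Real.log (2 * 38)
        ≤ 3200 * (K * r n) * 75 :=
      mul_le_mul u2 hlog76 (Real.log_nonneg (by norm_num)) (by positivity)
    nlinarith
  · have e := Ent_low s n
    have e2 := low_N s n M (by linarith) hMj
    have e3 : n / (12 * M) ≤ n / (4 * (1 + 2 * M)) := by
      apply div_le_div_of_nonneg_left (by positivity) (by positivity); linarith
    have e4 : r n ≤ (12 * K) * (n / (12 * M)) := by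
      rw [mul_div_assoc', le_div_iff₀ (by positivity)]
      rw [mul_div_assoc', le_div_iff₀ hr0] at hM
      nlinarith
    have e5 := mul_le_mul_of_nonneg_left (e3.trans e2) (show 0 ≤ Real.log 2 by linarith)
    have e6 : 0 ≤ (n : ℝ) / (12 * M) := by positivity
    have e7 : n / (12 * M) ≤ 2 * Ent pr (val D Q2) n := by nlinarith
    have e8 : 0 ≤ Ent pr (val D Q2) n := by linarith
    have e9 := mul_le_mul_of_nonneg_left e7 (show 0 ≤ 12 * K by linarith)
    have e10 : 0 ≤ K * Ent pr (val D Q2) n := by positivity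
    nlinarith

/-- The second factor. -/
theorem G2 (γ : ℝ) (hγ0 : 0 ≤ γ) (hγ : γ < 1) : ∃ K : ℝ, 1 ≤ K ∧ ∀ r : ℝ → ℝ,
    (∀ x, 1 ≤ x → 0 < r x) → r 1 = 1 →
    (∀ a n : ℝ, 1 ≤ a → 1 ≤ n → a ^ ((1 : ℝ) / 2) * r n ≤ r (a * n) ∧ r (a * n) ≤ a ^ γ * r n) →
    ∃ D : Sys, ∃ N : List Om → ℕ, (∀ l, Reach (Set.range (val D ℤ)) (XX D ℤ l) (N l)) ∧
      ∀ n : ℕ, 1 ≤ n → Ex pr n (fun l => (N l : ℝ)) ≤ K * Real.sqrt (n * r n) ∧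
        Ent pr (val D ℤ) n ≤ K * (r n * Real.log (n + 1)) ∧
        ∃ s : D.ι, Real.sqrt (n * r n) ≤ K * Ex pr n (fun l => Phi s (Finset.Icc (loW l) (hiW l)) (XX D ℤ l)) := by
  obtain ⟨K, hK, H⟩ := sys_real γ hγ0 hγ
  refine ⟨30000 * K, by linarith, fun r hpos h1 hr => ?_⟩
  obtain ⟨D, hD⟩ := H r hpos h1 hr
  refine ⟨D, RB D Int.natAbs, cost_Z.reach_RB, fun n hn => ?_⟩
  obtain ⟨⟨Sat, Un, hcov, a1, a2⟩, s, M, hM1, hM, hMj⟩ := hD n hn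
  have hnR : (1 : ℝ) ≤ n := by exact_mod_cast hn
  have hr0 := hpos n hnR
  have hr1 : 1 ≤ r n := by
    have := (hr n 1 hnR le_rfl).1
    rw [h1, mul_one, mul_one] at this
    exact (Real.one_le_rpow hnR (by norm_num)).trans this
  have hrn : r n ≤ n := by
    have := (hr n 1 hnR le_rfl).2
    rw [h1, mul_one, mul_one] at this
    refine this.trans ?_
    calc (n : ℝ) ^ γ ≤ (n : ℝ) ^ (1 : ℝ) := Real.rpow_le_rpow_of_exponent_le hnR hγ.le
      _ = n := Real.rpow_one _
  refine ⟨?_, ?_, s, ?_⟩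
  · have u := Ex_RB_Z (D := D) n hn Sat Un hcov
    have c1 : r n ≤ Real.sqrt (n * r n) := by
      apply Real.le_sqrt_of_sq_le; nlinarith
    have c2 := mul_le_mul_of_nonneg_left c1 (show 0 ≤ K by linarith)
    have c3 : 0 ≤ K * Real.sqrt (n * r n) := by positivity
    nlinarith
  · have u := Ex_RB_small (D := D) (wn n) (by simp [wn]) n hn Sat Un hcov
      (fun l x hl => wn_le n _ (by rw [← hl]; exact q0_abs l x)) (fun l s x h hl => wn_le n _ (by rw [← hl]; exact q_abs l s x h))
    have u2 : Ex pr n (fun l => (RB D (wn n) l : ℝ)) ≤ 3200 * (K * r n) :=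
      u.trans (mul_le_mul_of_nonneg_left a1 (by norm_num))
    have e := Ent_le pr (val D ℤ) pr_pos pr_sum (n := n) (Tn D n) (41 * n) (Tn_card n hn) (by linarith) (RB D (wn n))
      (fun l _ => (cost_n n hn).reach_RB l)
    have hl1 := log_bound n hn
    have hl0 : 0 ≤ Real.log (n + 1) := Real.log_nonneg (by linarith)
    have hl2 : Real.log 2 ≤ Real.log (n + 1) := Real.log_le_log (by norm_num) (by linarith)
    have hl3 : 0 ≤ Real.log (2 * (41 * n)) := Real.log_nonneg (by linarith)
    have : Ex pr n (fun l => (RB D (wn n) l : ℝ)) * Real.log (2 * (41 * n)) ≤ 3200 * (K * r n) * (8 * Real.log (n + 1)) :=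
      mul_le_mul u2 hl1 hl3 (by positivity)
    have h5 : Real.log (n + 1) ≤ r n * Real.log (n + 1) := le_mul_of_one_le_left hl0 hr1
    have h6 : r n * Real.log (n + 1) ≤ K * (r n * Real.log (n + 1)) := le_mul_of_one_le_left (by positivity) hK
    nlinarith
  · have e2 := low_q s n M (by linarith) hMj
    simp only [Phi_XX]
    have hsM : Real.sqrt (1 + 3 * M) ≤ 2 * Real.sqrt M := by
      rw [show (2 : ℝ) = Real.sqrt 4 by rw [show (4 : ℝ) = 2 ^ 2 by norm_num, Real.sqrt_sq (by norm_num)],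
        ← Real.sqrt_mul (by norm_num)]
      exact Real.sqrt_le_sqrt (by linarith)
    have hsM0 : 0 < Real.sqrt M := Real.sqrt_pos.mpr (by linarith)
    have hs0 : 0 < Real.sqrt (1 + 3 * M) := Real.sqrt_pos.mpr (by linarith)
    have e3 : n / (16 * Real.sqrt M) ≤ n / (8 * Real.sqrt (1 + 3 * M)) := by
      apply div_le_div_of_nonneg_left (by positivity) (by positivity); linarith
    have e4 : Real.sqrt (n * r n) * Real.sqrt M ≤ K * n := by
      rw [← Real.sqrt_mul (by positivity), Real.sqrt_le_left (by positivity)]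
      rw [mul_div_assoc', le_div_iff₀ hr0] at hM
      have : n * r n * M ≤ n * (K * n) := by nlinarith
      have h7 : (n : ℝ) * (K * n) ≤ (K * n) ^ 2 := by nlinarith [show 0 ≤ (K * n) * n by positivity]
      linarith
    have e5 : Real.sqrt (n * r n) ≤ (16 * K) * (n / (16 * Real.sqrt M)) := by
      rw [mul_div_assoc', le_div_iff₀ (by positivity)]
      nlinarith
    have e6 := mul_le_mul_of_nonneg_left (e3.trans e2) (show 0 ≤ 16 * K by linarith)
    have e7 : 0 ≤ (n : ℝ) / (16 * Real.sqrt M) := by positivity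
    have e8 := e7.trans (e3.trans e2)
    have e9 := mul_nonneg (show 0 ≤ K by linarith) e8
    nlinarith

end SE

/-- **Theorem 1 (main theorem).** For any `γ ∈ [3/4, 1)` and any functions
`f, h : [1,∞) → (0,∞)` with `f(1) = h(1) = 1`, satisfying the log-Lipschitz conditions
`a^{3/4} f(n) ≤ f(an) ≤ a^γ f(n)` and `a^{3/4} h(n) ≤ h(an) ≤ a^γ h(n)` for all real
`a, n ≥ 1`, and the relation `h(n) ≼ f(n) ≼ √(n·h(n)/log(n+1))` (with relation constant `c`),
there are a finitely generated group `Γ` (with a finite symmetric generating set) and a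
symmetric finitely supported random walk `X_n` on `Γ` with `E|X_n| ≍ f(n)` and
`H(X_n) ≍ h(n)`, the implied constant `C` depending only on `γ` and `c`. -/
theorem speed_entropy_prescribed
    (γ : ℝ) (hγ : γ ∈ Set.Ico (3 / 4 : ℝ) 1) (c : ℝ) (hc : 0 < c) :
    ∃ C : ℝ, 0 < C ∧
      ∀ f h : ℝ → ℝ,
        (∀ x : ℝ, 1 ≤ x → 0 < f x) → (∀ x : ℝ, 1 ≤ x → 0 < h x) →
        f 1 = 1 → h 1 = 1 →
        (∀ a n : ℝ, 1 ≤ a → 1 ≤ n →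
          a ^ ((3 : ℝ) / 4) * f n ≤ f (a * n) ∧ f (a * n) ≤ a ^ γ * f n) →
        (∀ a n : ℝ, 1 ≤ a → 1 ≤ n →
          a ^ ((3 : ℝ) / 4) * h n ≤ h (a * n) ∧ h (a * n) ≤ a ^ γ * h n) →
        (∀ n : ℝ, 1 ≤ n → h n ≤ c * f n) →
        (∀ n : ℝ, 1 ≤ n → f n ≤ c * Real.sqrt (n * h n / Real.log (n + 1))) →
        ∃ (Γ : Type) (_ : Group Γ) (S : Set Γ) (μ : Γ → ℝ),
          IsGenSet S ∧ IsStepDist μ ∧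
          ∀ n : ℕ, 1 ≤ n →
            (speed S μ n ≤ C * f n ∧ f n ≤ C * speed S μ n) ∧
            (entropy (convPow μ n) ≤ C * h n ∧ h n ≤ C * entropy (convPow μ n)) := by
  have hγ1 := hγ.1
  have hγ2 := hγ.2
  obtain ⟨K1, hK1, H1⟩ := SE.G1 γ (by linarith) hγ2
  obtain ⟨K2, hK2, H2⟩ := SE.G2 (2 * γ - 1) (by linarith) (by linarith)
  refine ⟨K1 * c + K2 + K1 + K2 * c ^ 2, by positivity, ?_⟩
  intro f h hf0 hh0 hf1 hh1 hf hh hhf hfh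
  obtain ⟨D1, N1, hN1, b1⟩ := H1 h hh0 hh1 (fun a n ha hn => ⟨by
    refine le_trans ?_ (hh a n ha hn).1
    exact mul_le_mul_of_nonneg_right (Real.rpow_le_rpow_of_exponent_le ha (by norm_num)) (hh0 n hn).le,
    (hh a n ha hn).2⟩)
  obtain ⟨D2, N2, hN2, b2⟩ := H2 (fun x => f x ^ 2 / x) (fun x hx => div_pos (pow_pos (hf0 x hx) 2) (by linarith))
    (by simp [hf1]) (fun a n ha hn => by
      have ha0 : 0 < a := by linarith
      have hn0 : 0 < n := by linarith
      have hfn := hf0 n hn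
      obtain ⟨u1, u2⟩ := hf a n ha hn
      have hfan := hf0 (a * n) (by nlinarith)
      have v1 := pow_le_pow_left₀ (by positivity) u1 2
      have v2 := pow_le_pow_left₀ hfan.le u2 2
      have e1 : (a ^ ((3 : ℝ) / 4)) ^ 2 = a ^ ((1 : ℝ) / 2) * a := by
        rw [← Real.rpow_natCast, ← Real.rpow_mul ha0.le]
        nth_rewrite 3 [← Real.rpow_one a]
        rw [← Real.rpow_add ha0]; norm_num
      have e2 : (a ^ γ) ^ 2 = a ^ (2 * γ - 1) * a := by
        rw [← Real.rpow_natCast, ← Real.rpow_mul ha0.le]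
        nth_rewrite 3 [← Real.rpow_one a]
        rw [← Real.rpow_add ha0]
        congr 1; push_cast; ring
      rw [mul_pow, e1] at v1
      rw [mul_pow, e2] at v2
      constructor
      · rw [mul_div_assoc', div_le_div_iff₀ hn0 (by positivity)]
        nlinarith
      · rw [mul_div_assoc', div_le_div_iff₀ (by positivity) hn0]
        nlinarith)
  let P : SE.Om × SE.Om → ℝ := fun ω => SE.pr ω.1 * SE.pr ω.2
  let V : SE.Om × SE.Om → SE.Hg D1 SE.Q2 × SE.Hg D2 ℤ := fun ω => (SE.val D1 SE.Q2 ω.1, SE.val D2 ℤ ω.2)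
  have hPpos : ∀ ω, 0 < P ω := fun ω => mul_pos (SE.pr_pos _) (SE.pr_pos _)
  have hPs : ∑ ω, P ω = 1 := by
    rw [Fintype.sum_prod_type]
    simp only [P, ← Finset.mul_sum, SE.pr_sum, mul_one]
  obtain ⟨Γ, grp, S, μ, hS, hμ, hE⟩ := SE.assemble P V hPpos hPs (fun ω => (SE.invOm ω.1, SE.invOm ω.2))
    (fun ω => by simp [SE.invOm_inv ω.1, SE.invOm_inv ω.2])
    (fun ω => by simp only [P, SE.pr_invOm])
    (fun ω => by simp only [V, SE.val_invOm]; rfl)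
  refine ⟨Γ, grp, S, μ, hS, hμ, fun n hn => ?_⟩
  obtain ⟨s1, s2⟩ := hE n
  have hEp : SE.Ent P V n = SE.Ent SE.pr (SE.val D1 SE.Q2) n + SE.Ent SE.pr (SE.val D2 ℤ) n :=
    SE.Ent_prod SE.pr SE.pr (SE.val D1 SE.Q2) (SE.val D2 ℤ) SE.pr_pos SE.pr_pos SE.pr_sum SE.pr_sum n
  rw [s1, s2, hEp]
  have hnR : (1 : ℝ) ≤ n := by exact_mod_cast hn
  have hn0 : (0 : ℝ) < n := by linarith
  have hfn := hf0 n hnR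
  have hhn := hh0 n hnR
  have hsq : Real.sqrt (n * (f n ^ 2 / n)) = f n := by
    rw [mul_div_cancel₀ _ hn0.ne', Real.sqrt_sq hfn.le]
  obtain ⟨x1, x2, x3⟩ := b1 n hn
  obtain ⟨y1, y2, s, y3⟩ := b2 n hn
  simp only [hsq] at y1 y3 y2
  have hl0 : 0 < Real.log (n + 1) := Real.log_pos (by linarith)
  have hent2 : f n ^ 2 / n * Real.log (n + 1) ≤ c ^ 2 * h n := by
    have h1 := pow_le_pow_left₀ hfn.le (hfh n hnR) 2
    rw [mul_pow, Real.sq_sqrt (by positivity)] at h1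
    calc f n ^ 2 / n * Real.log (n + 1) ≤ (c ^ 2 * (n * h n / Real.log (n + 1))) / n * Real.log (n + 1) := by gcongr
      _ = c ^ 2 * h n := by field_simp
  have hent2p : 0 ≤ SE.Ent SE.pr (SE.val D2 ℤ) n := by
    have h0 : ∀ ω, 0 ≤ SE.pr ω := fun ω => (SE.pr_pos ω).le
    unfold SE.Ent
    refine SE.Ex_nonneg h0 fun l _ => ?_
    have hle : SE.Pr SE.pr (SE.val D2 ℤ) n (SE.Xw (SE.val D2 ℤ) l) ≤ 1 := by
      rw [← SE.Ex_const (n := n) SE.pr_sum (1 : ℝ)]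
      unfold SE.Pr
      refine SE.Ex_mono h0 fun l' _ => ?_
      split_ifs <;> norm_num
    have := Real.log_nonpos (SE.Pr_nonneg SE.pr (SE.val D2 ℤ) h0 n _) hle
    linarith
  have hhc := hhf n hnR
  have hup : SE.Ex P n (fun l => (wordLength (Set.range V) (SE.Xw V l) : ℝ)) ≤ K1 * h n + K2 * f n := by
    calc SE.Ex P n (fun l => (wordLength (Set.range V) (SE.Xw V l) : ℝ))
        ≤ SE.Ex P n (fun l => (N1 (l.map Prod.fst) : ℝ) + (N2 (l.map Prod.snd) : ℝ)) := by
          refine SE.Ex_mono (fun ω => (hPpos ω).le) fun l _ => ?_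
          have hr := SE.reach_vP (SE.val D1 SE.Q2) (SE.val D2 ℤ) _ _ SE.val_one SE.val_one (hN1 (l.map Prod.fst)) (hN2 (l.map Prod.snd))
          have e : SE.Xw V l = (SE.XX D1 SE.Q2 (l.map Prod.fst), SE.XX D2 ℤ (l.map Prod.snd)) := SE.Xw_prod _ _ l
          rw [e]
          have := hr.wordLength_le
          exact_mod_cast this
      _ = SE.Ex SE.pr n (fun l => (N1 l : ℝ)) + SE.Ex SE.pr n (fun l => (N2 l : ℝ)) := by
          rw [SE.Ex_add, SE.Ex_marg_fst SE.pr_sum (fun l => (N1 l : ℝ)), SE.Ex_marg_snd SE.pr_sum (fun l => (N2 l : ℝ))]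
      _ ≤ _ := add_le_add x1 y1
  have hlow : SE.Ex SE.pr n (fun l => SE.Phi s (Finset.Icc (SE.loW l) (SE.hiW l)) (SE.XX D2 ℤ l))
      ≤ SE.Ex P n (fun l => (wordLength (Set.range V) (SE.Xw V l) : ℝ)) := by
    rw [← SE.Ex_marg_snd (p := SE.pr) SE.pr_sum]
    refine SE.Ex_mono (fun ω => (hPpos ω).le) fun l _ => ?_
    have e : SE.Xw V l = (SE.XX D1 SE.Q2 (l.map Prod.fst), SE.XX D2 ℤ (l.map Prod.snd)) := SE.Xw_prod _ _ l
    have hw := SE.wordLength_lower (S := Set.range V) (by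
        rintro _ ⟨ω, rfl⟩
        exact ⟨(SE.invOm ω.1, SE.invOm ω.2), by simp only [V, SE.val_invOm]; rfl⟩)
      (fun g => SE.Phi s (Finset.Icc (SE.loW (l.map Prod.snd)) (SE.hiW (l.map Prod.snd))) g.2)
      (by simp [SE.Phi_one])
      (by rintro g _ ⟨ω, rfl⟩; exact SE.Phi_step s _ g.2 ω.2) (SE.Xw_mem_closure V l)
    rw [e] at hw ⊢
    exact hw
  have g1 : 0 ≤ K1 * f n := by positivity
  have g2 : 0 ≤ K2 * f n := by positivity
  have g3 : 0 ≤ K1 * h n := by positivity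
  have g4 : 0 ≤ K2 * h n := by positivity
  have g5 : 0 ≤ K2 * c ^ 2 * f n := by positivity
  have g6 : 0 ≤ K1 * c * f n := by positivity
  have g7 : 0 ≤ K1 * c * h n := by positivity
  have hE1p : 0 ≤ SE.Ent SE.pr (SE.val D1 SE.Q2) n := by
    by_contra hc'
    push Not at hc'
    nlinarith
  have hWp : 0 ≤ SE.Ex P n (fun l => (wordLength (Set.range V) (SE.Xw V l) : ℝ)) :=
    SE.Ex_nonneg (fun ω => (hPpos ω).le) (fun l _ => by positivity)
  have hbig1 : K2 ≤ K1 * c + K2 + K1 + K2 * c ^ 2 := by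
    have : 0 ≤ K1 * c := by positivity
    have : 0 ≤ K2 * c ^ 2 := by positivity
    linarith
  have hbig2 : K1 ≤ K1 * c + K2 + K1 + K2 * c ^ 2 := by
    have : 0 ≤ K1 * c := by positivity
    have : 0 ≤ K2 * c ^ 2 := by positivity
    linarith
  refine ⟨⟨?_, ?_⟩, ?_, ?_⟩
  · refine hup.trans ?_
    have := mul_le_mul_of_nonneg_left hhc (show 0 ≤ K1 by linarith)
    linarith
  · refine y3.trans ((mul_le_mul_of_nonneg_left hlow (by linarith)).trans ?_)
    exact mul_le_mul_of_nonneg_right hbig1 hWp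
  · have := mul_le_mul_of_nonneg_left hent2 (show 0 ≤ K2 by linarith)
    linarith
  · refine x3.trans (le_trans ?_ (mul_le_mul_of_nonneg_right hbig2 (by linarith)))
    exact mul_le_mul_of_nonneg_left (by linarith) (by linarith)
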